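/- Let M be an even nondegenerate lattice of signature (t₊, t₋) and let L be an even unimodular lattice of signature (l₊, l₋), with l₊ − t₊ > 0, l₋ − t₋ > 0, and l₊ + l₋ − 2t₊ − 2t₋ ≥ 2. Then the primitive embedding of M into L is unique up to automorphism of L: for any two primitive embeddings T and T' of M into L there exists S ∈ GL(n,ℤ) with SᵀGS = G (G the Gram matrix of L) and T' = S∘T. -/

import Mathlib

open Matrix

/-- The number of positive eigenvalues of an integer matrix, viewed as a real
symmetric matrix (0 if the real matrix is not Hermitian). -/
noncomputable def sigPlus {n : ℕ} (G : Matrix (Fin n) (Fin n) ℤ) : ℕ :=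
  if h : (G.map ((↑·) : ℤ → ℝ)).IsHermitian then
    Nat.card {i : Fin n // 0 < h.eigenvalues i}
  else 0

/-- The number of negative eigenvalues of an integer matrix, viewed as a real
symmetric matrix (0 if the real matrix is not Hermitian). -/
noncomputable def sigMinus {n : ℕ} (G : Matrix (Fin n) (Fin n) ℤ) : ℕ :=
  if h : (G.map ((↑·) : ℤ → ℝ)).IsHermitian then
    Nat.card {i : Fin n // h.eigenvalues i < 0}
  else 0

/-- An embedding of the lattice `(ℤ^m, M)` into the lattice `(ℤ^n, G)`:
an injective ℤ-linear map respecting the bilinear forms. -/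
def IsLatticeEmbedding {m n : ℕ} (M : Matrix (Fin m) (Fin m) ℤ)
    (G : Matrix (Fin n) (Fin n) ℤ) (T : Matrix (Fin n) (Fin m) ℤ) : Prop :=
  Function.Injective T.mulVec ∧
    ∀ x y : Fin m → ℤ, T.mulVec x ⬝ᵥ G.mulVec (T.mulVec y) = x ⬝ᵥ M.mulVec y

/-- A primitive embedding: an embedding whose cokernel `ℤ^n / T(ℤ^m)` is
torsion-free, i.e. if a nonzero multiple of `v` lies in the image then so does `v`. -/
def IsPrimitiveLatticeEmbedding {m n : ℕ} (M : Matrix (Fin m) (Fin m) ℤ)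
    (G : Matrix (Fin n) (Fin n) ℤ) (T : Matrix (Fin n) (Fin m) ℤ) : Prop :=
  IsLatticeEmbedding M G T ∧
    ∀ (v : Fin n → ℤ) (k : ℤ), k ≠ 0 → (∃ x, T.mulVec x = k • v) → ∃ x, T.mulVec x = v

/-- An automorphism of the lattice `(ℤ^n, G)`: a matrix in `GL(n, ℤ)`
preserving the Gram matrix. -/
def IsLatticeAut {n : ℕ} (G S : Matrix (Fin n) (Fin n) ℤ) : Prop :=
  IsUnit S.det ∧ Sᵀ * G * S = G

namespace NK

section field
variable {F : Type*} [Field F] {V V₁ V₂ : Type*} [AddCommGroup V] [Module F V]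
  [AddCommGroup V₁] [Module F V₁] [AddCommGroup V₂] [Module F V₂]

/-- symmetric -/
def Sym (B : V →ₗ[F] V →ₗ[F] F) : Prop := ∀ x y, B x y = B y x

/-- nondegenerate -/
def Nd (B : V →ₗ[F] V →ₗ[F] F) : Prop := ∀ x, (∀ y, B x y = 0) → x = 0

/-- totally isotropic -/
def TI (B : V →ₗ[F] V →ₗ[F] F) (N : Submodule F V) : Prop := ∀ x ∈ N, ∀ y ∈ N, B x y = 0

/-- orthogonal sum of two forms -/
noncomputable def bsum (B₁ : V₁ →ₗ[F] V₁ →ₗ[F] F) (B₂ : V₂ →ₗ[F] V₂ →ₗ[F] F) :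
    (V₁ × V₂) →ₗ[F] (V₁ × V₂) →ₗ[F] F :=
  (B₁.compl₁₂ (LinearMap.fst F V₁ V₂) (LinearMap.fst F V₁ V₂)) +
  (B₂.compl₁₂ (LinearMap.snd F V₁ V₂) (LinearMap.snd F V₁ V₂))

@[simp] lemma bsum_apply (B₁ : V₁ →ₗ[F] V₁ →ₗ[F] F) (B₂ : V₂ →ₗ[F] V₂ →ₗ[F] F) (x y) :
    bsum B₁ B₂ x y = B₁ x.1 y.1 + B₂ x.2 y.2 := rfl

lemma bsum_sym {B₁ : V₁ →ₗ[F] V₁ →ₗ[F] F} {B₂ : V₂ →ₗ[F] V₂ →ₗ[F] F} (h₁ : Sym B₁) (h₂ : Sym B₂) :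
    Sym (bsum B₁ B₂) := fun x y => by simp [h₁ x.1 y.1, h₂ x.2 y.2]

lemma bsum_nd {B₁ : V₁ →ₗ[F] V₁ →ₗ[F] F} {B₂ : V₂ →ₗ[F] V₂ →ₗ[F] F} (h₁ : Nd B₁) (h₂ : Nd B₂) :
    Nd (bsum B₁ B₂) := fun x hx => by
  ext
  · exact h₁ _ fun y => by simpa using hx (y, 0)
  · exact h₂ _ fun y => by simpa using hx (0, y)

lemma finrank_add_le_of_ortho [FiniteDimensional F V] {B : V →ₗ[F] V →ₗ[F] F} (hn : Nd B)
    (N N' : Submodule F V) (h : ∀ x ∈ N, ∀ y ∈ N', B x y = 0) :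
    Module.finrank F N + Module.finrank F N' ≤ Module.finrank F V := by
  let g : N →ₗ[F] (V ⧸ N') →ₗ[F] F :=
    { toFun := fun x => N'.liftQ (B x) (fun y hy => by simpa using h x x.2 y hy)
      map_add' := by intros; ext; simp
      map_smul' := by intros; ext; simp }
  have hg : Function.Injective g := by
    rw [injective_iff_map_eq_zero]
    intro x hx
    have : (x : V) = 0 := hn _ fun y => by
      have := LinearMap.congr_fun hx (Submodule.Quotient.mk y)
      simpa [g] using this
    exact_mod_cast this
  have h1 := LinearMap.finrank_le_finrank_of_injective hg
  have h2 : Module.finrank F ((V ⧸ N') →ₗ[F] F) = Module.finrank F (V ⧸ N') := Subspace.dual_finrank_eq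
  have h3 := Submodule.finrank_quotient_add_finrank N'
  omega

/-- Existence of enough orthogonal vectors. -/
lemma finrank_ortho_ge [FiniteDimensional F V] (B : V →ₗ[F] V →ₗ[F] F) (N N' : Submodule F V) :
    ∃ P : Submodule F V, P ≤ N' ∧ (∀ x ∈ N, ∀ y ∈ P, B y x = 0) ∧ (∀ y ∈ N', (∀ x ∈ N, B y x = 0) → y ∈ P) ∧
    Module.finrank F N' ≤ Module.finrank F P + Module.finrank F N := by
  let f : V →ₗ[F] (N →ₗ[F] F) :=
    { toFun := fun v => (B v).comp N.subtype
      map_add' := by intros; ext; simp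
      map_smul' := by intros; ext; simp }
  refine ⟨N' ⊓ LinearMap.ker f, inf_le_left, ?_, ?_, ?_⟩
  · intro x hx y hy
    have := LinearMap.congr_fun (LinearMap.mem_ker.1 hy.2) ⟨x, hx⟩
    simpa [f] using this
  · intro y hy h
    refine ⟨hy, LinearMap.mem_ker.2 ?_⟩
    ext x
    simpa [f] using h x x.2
  · have h1 := LinearMap.finrank_range_add_finrank_ker (f.domRestrict N')
    have h2 : Module.finrank F (LinearMap.range (f.domRestrict N')) ≤ Module.finrank F N := by
      have := Submodule.finrank_le (LinearMap.range (f.domRestrict N'))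
      rwa [show Module.finrank F (N →ₗ[F] F) = Module.finrank F N from Subspace.dual_finrank_eq] at this
    have h3 : Module.finrank F (LinearMap.ker (f.domRestrict N')) = Module.finrank F (N' ⊓ LinearMap.ker f : Submodule F V) := by
      have : N' ⊓ LinearMap.ker f = (LinearMap.ker (f.domRestrict N')).map N'.subtype := by
        ext x; simp [LinearMap.mem_ker, LinearMap.domRestrict_apply, and_comm]
      rw [this, Submodule.finrank_map_subtype_eq]
    omega

lemma finrank_prod_sub [FiniteDimensional F V₁] [FiniteDimensional F V₂] (P : Submodule F V₁) (Q : Submodule F V₂) :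
    Module.finrank F (P.prod Q) = Module.finrank F P + Module.finrank F Q := by
  let e : (P × Q) →ₗ[F] P.prod Q :=
    { toFun := fun x => ⟨(x.1, x.2), ⟨x.1.2, x.2.2⟩⟩
      map_add' := by intros; rfl
      map_smul' := by intros; rfl }
  have : Function.Bijective e := by
    constructor
    · rintro ⟨⟨a, ha⟩, ⟨b, hb⟩⟩ ⟨⟨c, hc⟩, ⟨d, hd⟩⟩ h
      have h' := congrArg Subtype.val h
      simpa [e] using h'
    · rintro ⟨⟨a, b⟩, ⟨ha, hb⟩⟩
      exact ⟨(⟨a, ha⟩, ⟨b, hb⟩), rfl⟩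
  rw [← (LinearEquiv.ofBijective e this).finrank_eq, Module.finrank_prod]

/-- Lagrangian reduction. -/
lemma lagr_red [FiniteDimensional F V₁] [FiniteDimensional F V₂]
    {B₁ : V₁ →ₗ[F] V₁ →ₗ[F] F} {B₂ : V₂ →ₗ[F] V₂ →ₗ[F] F}
    (hn₁ : Nd B₁) (hn₂ : Nd B₂)
    (N : Submodule F (V₁ × V₂)) (hN : TI (bsum B₁ B₂) N)
    (hNd : Module.finrank F V₁ + Module.finrank F V₂ ≤ 2 * Module.finrank F N)
    (C : Submodule F V₂) (hC : TI B₂ C) (hCd : Module.finrank F V₂ ≤ 2 * Module.finrank F C) :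
    ∃ N' : Submodule F V₁, TI B₁ N' ∧ Module.finrank F V₁ ≤ 2 * Module.finrank F N' ∧
      ∀ x ∈ N', ∃ c ∈ C, (x, c) ∈ N := by
  let E : Submodule F (V₁ × V₂) := (⊤ : Submodule F V₁).prod C
  let K : Submodule F (V₁ × V₂) := N ⊓ (⊥ : Submodule F V₁).prod C
  have hE : Module.finrank F E = Module.finrank F V₁ + Module.finrank F C := by
    rw [finrank_prod_sub, finrank_top]
  have h1 : Module.finrank F K + Module.finrank F (N ⊔ E : Submodule F (V₁ × V₂)) ≤
      Module.finrank F (V₁ × V₂) := by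
    apply finrank_add_le_of_ortho (bsum_nd hn₁ hn₂)
    intro x hx y hy
    obtain ⟨a, ha, b, hb, rfl⟩ := Submodule.mem_sup.1 hy
    rw [map_add, hN x hx.1 a ha, zero_add, bsum_apply, (Submodule.mem_bot F).1 hx.2.1,
      hC _ hx.2.2 _ hb.2]
    simp
  have h2 := Submodule.finrank_sup_add_finrank_inf_eq N E
  let f : (N ⊓ E : Submodule F (V₁ × V₂)) →ₗ[F] V₁ := (LinearMap.fst F V₁ V₂).domRestrict _
  have h3 := LinearMap.finrank_range_add_finrank_ker f
  have h4 : Module.finrank F (LinearMap.ker f) ≤ Module.finrank F K := by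
    have : (LinearMap.ker f).map (N ⊓ E).subtype ≤ K := by
      rintro _ ⟨⟨x, hx⟩, hx', rfl⟩
      refine ⟨hx.1, ?_, hx.2.2⟩
      simpa [f] using hx'
    have h5 := Submodule.finrank_mono this
    rwa [Submodule.finrank_map_subtype_eq] at h5
  rw [Module.finrank_prod] at h1
  refine ⟨LinearMap.range f, ?_, by omega, ?_⟩
  · rintro _ ⟨⟨x, hx⟩, rfl⟩ _ ⟨⟨y, hy⟩, rfl⟩
    have := hN x hx.1 y hy.1
    rw [bsum_apply, hC _ hx.2.2 _ hy.2.2, add_zero] at this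
    exact this
  · rintro _ ⟨⟨x, hx⟩, rfl⟩
    exact ⟨x.2, hx.2.2, hx.1⟩

end field

/-! ### Witt group of ℚ -/

/-- nondegenerate quadratic spaces over ℚ -/
structure Obj where
  V : Type
  [ig : AddCommGroup V]
  [im : Module ℚ V]
  [ifd : FiniteDimensional ℚ V]
  B : V →ₗ[ℚ] V →ₗ[ℚ] ℚ
  sym : Sym B
  nd : Nd B

attribute [instance] Obj.ig Obj.im Obj.ifd

namespace Obj

/-- dimension -/
noncomputable def dim (X : Obj) : ℕ := Module.finrank ℚ X.V

/-- metabolic -/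
def Met (X : Obj) : Prop := ∃ N : Submodule ℚ X.V, TI X.B N ∧ X.dim ≤ 2 * Module.finrank ℚ N

/-- sum -/
noncomputable def sum (X Y : Obj) : Obj := ⟨X.V × Y.V, bsum X.B Y.B, bsum_sym X.sym Y.sym, bsum_nd X.nd Y.nd⟩

/-- opposite -/
def op (X : Obj) : Obj := ⟨X.V, -X.B, fun x y => by simp [X.sym x y], fun x hx => X.nd x (by simpa using hx)⟩

/-- zero -/
def zero : Obj := ⟨PUnit, 0, fun _ _ => rfl, fun _ _ => rfl⟩

@[simp] lemma dim_sum (X Y : Obj) : (X.sum Y).dim = X.dim + Y.dim := Module.finrank_prod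
@[simp] lemma dim_op (X : Obj) : X.op.dim = X.dim := rfl
@[simp] lemma dim_zero : zero.dim = 0 := Module.finrank_zero_of_subsingleton (M := PUnit)

/-- A metabolic relation given by an injective linear map. -/
lemma met_of_map {X : Obj} {U : Type} [AddCommGroup U] [Module ℚ U] [FiniteDimensional ℚ U]
    (f : U →ₗ[ℚ] X.V) (hf : Function.Injective f) (h : ∀ u v, X.B (f u) (f v) = 0)
    (hd : X.dim ≤ 2 * Module.finrank ℚ U) : X.Met := by
  refine ⟨LinearMap.range f, ?_, ?_⟩
  · rintro _ ⟨u, rfl⟩ _ ⟨v, rfl⟩; exact h u v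
  · rwa [LinearMap.finrank_range_of_inj hf]

lemma met_red {X Y : Obj} (h : (X.sum Y).Met) (hY : Y.Met) : X.Met := by
  obtain ⟨N, hN, hNd⟩ := h
  obtain ⟨C, hC, hCd⟩ := hY
  rw [dim_sum] at hNd
  obtain ⟨N', h1, h2, -⟩ := lagr_red X.nd Y.nd N hN hNd C hC hCd
  exact ⟨N', h1, h2⟩

lemma met_map {X Y : Obj} (e : X.V →ₗ[ℚ] Y.V) (he : Function.Injective e) (hB : ∀ x y, Y.B (e x) (e y) = X.B x y)
    (hd : Y.dim ≤ X.dim) (h : X.Met) : Y.Met := by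
  obtain ⟨N, hN, hNd⟩ := h
  apply met_of_map (e.comp N.subtype) (he.comp Subtype.val_injective)
  · intro u v; simp [hB, hN u u.2 v v.2]
  · omega

lemma met_sum {X Y : Obj} (hX : X.Met) (hY : Y.Met) : (X.sum Y).Met := by
  obtain ⟨N, hN, hNd⟩ := hX
  obtain ⟨C, hC, hCd⟩ := hY
  refine ⟨N.prod C, ?_, ?_⟩
  · intro x hx y hy
    change X.B x.1 y.1 + Y.B x.2 y.2 = 0
    rw [hN _ hx.1 _ hy.1, hC _ hx.2 _ hy.2, add_zero]
  · have := finrank_prod_sub N C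
    rw [dim_sum]
    change _ ≤ 2 * Module.finrank ℚ (N.prod C : Submodule ℚ (X.V × Y.V))
    omega

/-- Witt equivalence -/
def Eqv (X Y : Obj) : Prop := (X.sum Y.op).Met

/-- An isometric map between spaces of same dimension gives equivalence. -/
lemma eqv_of_map {X Y : Obj} (f : X.V →ₗ[ℚ] Y.V) (h : ∀ x y, Y.B (f x) (f y) = X.B x y)
    (hd : Y.dim ≤ X.dim) : Eqv X Y := by
  apply met_of_map (X := X.sum Y.op) (LinearMap.prod LinearMap.id f : X.V →ₗ[ℚ] X.V × Y.V)
  · intro a b h; exact (Prod.ext_iff.1 h).1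
  · intro u v
    change X.B u v + -(Y.B (f u) (f v)) = 0
    rw [h]; ring
  · rw [dim_sum, dim_op]; change _ ≤ 2 * X.dim; omega

lemma eqv_refl (X : Obj) : Eqv X X := eqv_of_map LinearMap.id (fun _ _ => rfl) le_rfl

lemma eqv_symm {X Y : Obj} (h : Eqv X Y) : Eqv Y X := by
  obtain ⟨N, hN, hNd⟩ := h
  apply met_of_map (X := Y.sum X.op) ((LinearEquiv.prodComm ℚ X.V Y.V).toLinearMap.comp N.subtype)
  · exact (LinearEquiv.prodComm ℚ X.V Y.V).injective.comp Subtype.val_injective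
  · rintro ⟨u, hu⟩ ⟨v, hv⟩
    have := hN u hu v hv
    change X.B u.1 v.1 + -(Y.B u.2 v.2) = 0 at this
    change Y.B u.2 v.2 + -(X.B u.1 v.1) = 0
    linarith
  · rw [dim_sum, dim_op] at *; omega

lemma met_of_self_op (X : Obj) : (X.op.sum X).Met := eqv_symm (by
  exact eqv_of_map (X := X) (Y := X) LinearMap.id (fun _ _ => rfl) le_rfl) |> fun h => by
    refine met_map (X := X.sum X.op) (LinearEquiv.prodComm ℚ X.V X.V).toLinearMap
      (LinearEquiv.prodComm ℚ X.V X.V).injective ?_ ?_ h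
    · intro x y
      change -(X.B x.2 y.2) + X.B x.1 y.1 = X.B x.1 y.1 + -(X.B x.2 y.2)
      ring
    · simp

lemma eqv_trans {X Y Z : Obj} (h : Eqv X Y) (h' : Eqv Y Z) : Eqv X Z := by
  have h1 := met_sum h h'
  refine met_red (Y := Y.op.sum Y) ?_ (met_of_self_op Y)
  let e : ((X.V × Y.V) × (Y.V × Z.V)) →ₗ[ℚ] ((X.V × Z.V) × (Y.V × Y.V)) :=
    LinearMap.prod (LinearMap.prod (LinearMap.fst _ _ _ ∘ₗ LinearMap.fst _ _ _) (LinearMap.snd _ _ _ ∘ₗ LinearMap.snd _ _ _))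
      (LinearMap.prod (LinearMap.snd _ _ _ ∘ₗ LinearMap.fst _ _ _) (LinearMap.fst _ _ _ ∘ₗ LinearMap.snd _ _ _))
  refine met_map (X := (X.sum Y.op).sum (Y.sum Z.op)) e ?_ ?_ ?_ h1
  · rintro ⟨⟨a, b⟩, ⟨c, d⟩⟩ ⟨⟨a', b'⟩, ⟨c', d'⟩⟩ h
    have h1 := congrArg (fun x => x.1.1) h
    have h2 := congrArg (fun x => x.1.2) h
    have h3 := congrArg (fun x => x.2.1) h
    have h4 := congrArg (fun x => x.2.2) h
    exact Prod.ext (Prod.ext h1 h3) (Prod.ext h4 h2)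
  · rintro ⟨⟨a, b⟩, ⟨c, d⟩⟩ ⟨⟨a', b'⟩, ⟨c', d'⟩⟩
    change (X.B a a' + -(Z.B d d')) + (-(Y.B b b') + Y.B c c') = (X.B a a' + -(Y.B b b')) + (Y.B c c' + -(Z.B d d'))
    ring
  · simp; omega

lemma eqv_sum {X Y X' Y' : Obj} (h : Eqv X X') (h' : Eqv Y Y') : Eqv (X.sum Y) (X'.sum Y') := by
  have h1 := met_sum h h'
  let e : ((X.V × X'.V) × (Y.V × Y'.V)) →ₗ[ℚ] ((X.V × Y.V) × (X'.V × Y'.V)) :=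
    LinearMap.prod (LinearMap.prod (LinearMap.fst _ _ _ ∘ₗ LinearMap.fst _ _ _) (LinearMap.fst _ _ _ ∘ₗ LinearMap.snd _ _ _))
      (LinearMap.prod (LinearMap.snd _ _ _ ∘ₗ LinearMap.fst _ _ _) (LinearMap.snd _ _ _ ∘ₗ LinearMap.snd _ _ _))
  refine met_map (X := (X.sum X'.op).sum (Y.sum Y'.op)) e ?_ ?_ ?_ h1
  · rintro ⟨⟨a, b⟩, ⟨c, d⟩⟩ ⟨⟨a', b'⟩, ⟨c', d'⟩⟩ h
    have h1 := congrArg (fun x => x.1.1) h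
    have h2 := congrArg (fun x => x.1.2) h
    have h3 := congrArg (fun x => x.2.1) h
    have h4 := congrArg (fun x => x.2.2) h
    exact Prod.ext (Prod.ext h1 h3) (Prod.ext h2 h4)
  · rintro ⟨⟨a, b⟩, ⟨c, d⟩⟩ ⟨⟨a', b'⟩, ⟨c', d'⟩⟩
    change (X.B a a' + Y.B c c') + -(X'.B b b' + Y'.B d d') = (X.B a a' + -(X'.B b b')) + (Y.B c c' + -(Y'.B d d'))
    ring
  · simp; omega

lemma eqv_op {X X' : Obj} (h : Eqv X X') : Eqv X.op X'.op := by
  obtain ⟨N, hN, hd⟩ := h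
  refine ⟨N, ?_, hd⟩
  intro x hx y hy
  have := hN x hx y hy
  change X.B x.1 y.1 + -(X'.B x.2 y.2) = 0 at this
  change -X.B x.1 y.1 + - -(X'.B x.2 y.2) = 0
  linarith

instance setoid : Setoid Obj := ⟨Eqv, eqv_refl, eqv_symm, eqv_trans⟩

end Obj

/-- The Witt group of ℚ. -/
def W : Type 1 := Quotient Obj.setoid

/-- class of a space -/
def W.mk (X : Obj) : W := Quotient.mk _ X

lemma W.mk_eq {X Y : Obj} : W.mk X = W.mk Y ↔ Obj.Eqv X Y := Quotient.eq

noncomputable instance : Add W := ⟨Quotient.map₂ Obj.sum fun _ _ h _ _ h' => Obj.eqv_sum h h'⟩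
instance : Zero W := ⟨W.mk Obj.zero⟩
instance : Neg W := ⟨Quotient.map Obj.op fun _ _ h => Obj.eqv_op h⟩

lemma W.mk_add (X Y : Obj) : W.mk X + W.mk Y = W.mk (X.sum Y) := rfl
lemma W.mk_neg (X : Obj) : -W.mk X = W.mk X.op := rfl
lemma W.zero_def : (0 : W) = W.mk Obj.zero := rfl

lemma W.ind {P : W → Prop} (h : ∀ X, P (W.mk X)) (w : W) : P w := Quotient.ind h w

lemma W.mk_eq_of_map {X Y : Obj} (f : X.V →ₗ[ℚ] Y.V) (h : ∀ x y, Y.B (f x) (f y) = X.B x y)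
    (hd : Y.dim ≤ X.dim) : W.mk X = W.mk Y := W.mk_eq.2 (Obj.eqv_of_map f h hd)

lemma W.mk_eq_zero {X : Obj} : W.mk X = 0 ↔ X.Met := by
  rw [W.zero_def, W.mk_eq]
  constructor
  · intro h
    exact Obj.met_red h ⟨⊤, fun _ _ _ _ => by exact neg_zero, by simp⟩
  · intro h
    exact Obj.met_sum h ⟨⊤, fun _ _ _ _ => by exact neg_zero, by simp⟩

noncomputable instance : AddCommGroup W where
  add_assoc a b c := by
    induction a using W.ind with | h X
    induction b using W.ind with | h Y
    induction c using W.ind with | h Z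
    refine W.mk_eq_of_map (LinearEquiv.prodAssoc ℚ X.V Y.V Z.V).toLinearMap ?_ ?_
    · rintro ⟨⟨a, b⟩, c⟩ ⟨⟨a', b'⟩, c'⟩
      change X.B a a' + (Y.B b b' + Z.B c c') = (X.B a a' + Y.B b b') + Z.B c c'
      ring
    · simp; omega
  zero_add a := by
    induction a using W.ind with | h X
    refine W.mk_eq_of_map (X := Obj.zero.sum X) (LinearMap.snd ℚ PUnit X.V) ?_ ?_
    · rintro ⟨a, b⟩ ⟨a', b'⟩
      change X.B b b' = 0 + X.B b b'
      ring
    · simp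
  add_zero a := by
    induction a using W.ind with | h X
    refine W.mk_eq_of_map (X := X.sum Obj.zero) (LinearMap.fst ℚ X.V PUnit) ?_ ?_
    · rintro ⟨a, b⟩ ⟨a', b'⟩
      change X.B a a' = X.B a a' + 0
      ring
    · simp
  add_comm a b := by
    induction a using W.ind with | h X
    induction b using W.ind with | h Y
    refine W.mk_eq_of_map (LinearEquiv.prodComm ℚ X.V Y.V).toLinearMap ?_ ?_
    · rintro ⟨a, b⟩ ⟨a', b'⟩
      change Y.B b b' + X.B a a' = X.B a a' + Y.B b b'
      ring
    · simp; omega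
  neg_add_cancel a := by
    induction a using W.ind with | h X
    exact W.mk_eq_zero.2 (Obj.met_of_self_op X)
  nsmul := nsmulRec
  zsmul := zsmulRec

end NK

namespace NK

open Matrix

section mform
variable {F : Type*} [Field F] {ι : Type*} [Fintype ι] [DecidableEq ι]

/-- the bilinear form of a matrix -/
noncomputable def mform (A : Matrix ι ι F) : (ι → F) →ₗ[F] (ι → F) →ₗ[F] F := Matrix.toLinearMap₂' F A

lemma mform_apply (A : Matrix ι ι F) (x y : ι → F) : mform A x y = x ⬝ᵥ A *ᵥ y :=
  Matrix.toLinearMap₂'_apply' A x y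

lemma mform_sym {A : Matrix ι ι F} (h : A.IsSymm) : Sym (mform A) := fun x y => by
  rw [mform_apply, mform_apply, dotProduct_mulVec, ← mulVec_transpose, h.eq, dotProduct_comm]

lemma mform_nd {A : Matrix ι ι F} (h : A.IsSymm) (hd : A.det ≠ 0) : Nd (mform A) := fun x hx => by
  have h1 : A *ᵥ x = 0 := by
    ext i
    have := hx (Pi.single i 1)
    rw [mform_sym h, mform_apply] at this
    simpa using this
  exact Matrix.eq_zero_of_mulVec_eq_zero hd h1

end mform

/-- integral lattice tensored with ℚ -/
noncomputable def zObj {ι : Type} [Fintype ι] [DecidableEq ι] (A : Matrix ι ι ℤ) (hs : A.IsSymm) (hd : A.det ≠ 0) : Obj :=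
  ⟨ι → ℚ, mform (A.map (Int.cast : ℤ → ℚ)), mform_sym (by rw [IsSymm, ← transpose_map, hs.eq]),
    mform_nd (by rw [IsSymm, ← transpose_map, hs.eq]) (by
      have : (A.map (Int.cast : ℤ → ℚ)).det = (A.det : ℚ) := (Int.cast_det A).symm
      rw [this]; exact_mod_cast hd)⟩

lemma zObj_dim {ι : Type} [Fintype ι] [DecidableEq ι] (A : Matrix ι ι ℤ) (hs : A.IsSymm) (hd : A.det ≠ 0) :
    (zObj A hs hd).dim = Fintype.card ι := Module.finrank_fintype_fun_eq_card ℚ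

/-- rank one form -/
noncomputable def form1 (a : ℚ) : ℚ →ₗ[ℚ] ℚ →ₗ[ℚ] ℚ := a • LinearMap.mul ℚ ℚ

lemma form1_apply (a x y : ℚ) : form1 a x y = a * (x * y) := by simp [form1]

/-- rank one space -/
noncomputable def obj1 (a : ℚ) (ha : a ≠ 0) : Obj :=
  ⟨ℚ, form1 a, fun x y => by rw [form1_apply, form1_apply, mul_comm x], fun x hx => by
    have := hx 1
    rw [form1_apply] at this
    simpa [ha] using this⟩

lemma obj1_B (a : ℚ) (ha : a ≠ 0) (x y : ℚ) : (obj1 a ha).B x y = a * (x * y) := form1_apply a x y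
@[simp] lemma obj1_dim (a : ℚ) (ha : a ≠ 0) : (obj1 a ha).dim = 1 := Module.finrank_self ℚ

/-- class of the rank one form -/
noncomputable def cls (a : ℚ) : W := if h : a = 0 then 0 else W.mk (obj1 a h)

@[simp] lemma cls_zero : cls 0 = 0 := by simp [cls]
lemma cls_of_ne {a : ℚ} (h : a ≠ 0) : cls a = W.mk (obj1 a h) := by simp [cls, h]

lemma W.mk_eq_add {X P Q : Obj} (f : P.V →ₗ[ℚ] X.V) (g : Q.V →ₗ[ℚ] X.V)
    (hf : ∀ x y, X.B (f x) (f y) = P.B x y) (hg : ∀ x y, X.B (g x) (g y) = Q.B x y)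
    (hfg : ∀ x y, X.B (f x) (g y) = 0) (hd : X.dim ≤ P.dim + Q.dim) : W.mk X = W.mk P + W.mk Q := by
  rw [W.mk_add]
  symm
  refine W.mk_eq_of_map (X := P.sum Q) (f.coprod g) ?_ (by simpa using hd)
  rintro ⟨a, b⟩ ⟨c, d⟩
  change X.B (f a + g b) (f c + g d) = P.B a c + Q.B b d
  simp only [map_add, LinearMap.add_apply, hf, hg, hfg, X.sym (g b) (f c)]
  ring

lemma cls_mul_sq (a b : ℚ) (hb : b ≠ 0) : cls (a * b ^ 2) = cls a := by
  by_cases ha : a = 0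
  · simp [ha]
  rw [cls_of_ne ha, cls_of_ne (by positivity)]
  refine W.mk_eq_of_map (b • LinearMap.id : ℚ →ₗ[ℚ] ℚ) ?_ (by simp)
  intro (x : ℚ) (y : ℚ)
  rw [obj1_B]
  change (obj1 a ha).B (b * x) (b * y) = _
  rw [obj1_B]; ring

lemma cls_neg (a : ℚ) : cls (-a) = -cls a := by
  by_cases ha : a = 0
  · simp [ha]
  rw [cls_of_ne ha, cls_of_ne (by simpa using ha), W.mk_neg]
  refine W.mk_eq_of_map (LinearMap.id : ℚ →ₗ[ℚ] ℚ) ?_ (by simp)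
  intro (x : ℚ) (y : ℚ)
  rw [obj1_B]
  change -((obj1 a ha).B x y) = _
  rw [obj1_B]; ring

lemma cls_add (a b : ℚ) : cls a + cls b = cls (a + b) + cls (a * b * (a + b)) := by
  by_cases ha : a = 0
  · simp [ha]
  by_cases hb : b = 0
  · simp [hb]
  by_cases hab : a + b = 0
  · rw [hab, mul_zero, cls_zero, show b = -a by linarith, cls_neg]; simp
  rw [cls_of_ne ha, cls_of_ne hb, cls_of_ne hab, cls_of_ne (by positivity), W.mk_add]
  refine W.mk_eq_add (X := (obj1 a ha).sum (obj1 b hb)) (P := obj1 (a + b) hab) (Q := obj1 (a * b * (a + b)) (by positivity))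
    (LinearMap.prod LinearMap.id LinearMap.id : ℚ →ₗ[ℚ] ℚ × ℚ)
    (LinearMap.prod (b • LinearMap.id) ((-a) • LinearMap.id) : ℚ →ₗ[ℚ] ℚ × ℚ) ?_ ?_ ?_ ?_
  · intro (x : ℚ) (y : ℚ)
    change (obj1 a ha).B x y + (obj1 b hb).B x y = _
    simp only [obj1_B]; ring
  · intro (x : ℚ) (y : ℚ)
    change (obj1 a ha).B (b * x) (b * y) + (obj1 b hb).B (-a * x) (-a * y) = _
    simp only [obj1_B]; ring
  · intro (x : ℚ) (y : ℚ)
    change (obj1 a ha).B x (b * y) + (obj1 b hb).B x (-a * y) = _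
    simp only [obj1_B]; ring
  · simp

lemma isotropic_of_mk_eq {X Y : Obj} (h : W.mk X = W.mk Y) (hd : Y.dim < X.dim) :
    ∃ x : X.V, x ≠ 0 ∧ X.B x x = 0 := by
  obtain ⟨N, hN, hNd⟩ := W.mk_eq.1 h
  simp only [Obj.dim_sum, Obj.dim_op] at hNd
  let f : N →ₗ[ℚ] Y.V := (LinearMap.snd ℚ X.V Y.V).comp N.subtype
  have h1 : ¬ Function.Injective f := by
    intro h
    have := LinearMap.finrank_le_finrank_of_injective h
    change _ ≤ Y.dim at this
    omega
  rw [injective_iff_map_eq_zero] at h1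
  push Not at h1
  obtain ⟨⟨⟨x, y⟩, hxy⟩, h2, h3⟩ := h1
  have hy : y = 0 := h2
  subst hy
  refine ⟨x, ?_, ?_⟩
  · rintro rfl; exact h3 rfl
  · have := hN _ hxy _ hxy
    change X.B x x + -(Y.B 0 0) = 0 at this
    simpa using this

/-- `w` is represented by a form of rank `d` -/
def Rep (d : ℕ) (w : W) : Prop := ∃ X : Obj, W.mk X = w ∧ X.dim = d

lemma Rep.add {d e : ℕ} {w v : W} (h : Rep d w) (h' : Rep e v) : Rep (d + e) (w + v) := by
  obtain ⟨X, rfl, rfl⟩ := h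
  obtain ⟨Y, rfl, rfl⟩ := h'
  exact ⟨X.sum Y, rfl, by simp⟩

lemma Rep.neg {d : ℕ} {w : W} (h : Rep d w) : Rep d (-w) := by
  obtain ⟨X, rfl, rfl⟩ := h
  exact ⟨X.op, rfl, by simp⟩

lemma Rep.zero : Rep 0 0 := ⟨Obj.zero, rfl, by simp⟩
lemma Rep.cls {a : ℚ} (h : a ≠ 0) : Rep 1 (cls a) := ⟨obj1 a h, (cls_of_ne h).symm, by simp⟩

lemma Rep.sum {ι : Type*} (s : Finset ι) (a : ι → ℚ) (h : ∀ i ∈ s, a i ≠ 0) : Rep s.card (∑ i ∈ s, NK.cls (a i)) := by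
  classical
  induction s using Finset.induction_on with
  | empty => simpa using Rep.zero
  | insert i s hi ih =>
    rw [Finset.sum_insert hi, Finset.card_insert_of_notMem hi, add_comm s.card]
    exact (Rep.cls (h i (by simp))).add (ih fun j hj => h j (by simp [hj]))

/-- `w` is represented by a form of signature `(p,q)`. -/
def SigRep (p q : ℕ) (w : W) : Prop := ∃ X : Obj, W.mk X = w ∧ X.dim = p + q ∧
  ∃ P Q : Submodule ℚ X.V, (∀ x ∈ P, x ≠ 0 → 0 < X.B x x) ∧ (∀ x ∈ Q, x ≠ 0 → X.B x x < 0) ∧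
    Module.finrank ℚ P = p ∧ Module.finrank ℚ Q = q

lemma SigRep.add {p q p' q' : ℕ} {w v : W} (h : SigRep p q w) (h' : SigRep p' q' v) :
    SigRep (p + p') (q + q') (w + v) := by
  obtain ⟨X, rfl, hX, P, Q, h1, h2, h3, h4⟩ := h
  obtain ⟨Y, rfl, hY, P', Q', h1', h2', h3', h4'⟩ := h'
  refine ⟨X.sum Y, rfl, by simp; omega, P.prod P', Q.prod Q', ?_, ?_, ?_, ?_⟩
  · rintro ⟨x, y⟩ ⟨hx, hy⟩ h
    change 0 < X.B x x + Y.B y y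
    by_cases hx0 : x = 0
    · subst hx0
      have : y ≠ 0 := by rintro rfl; exact h rfl
      simpa using h1' y hy this
    · have := h1 x hx hx0
      by_cases hy0 : y = 0
      · subst hy0; simpa using this
      · have := h1' y hy hy0
        linarith
  · rintro ⟨x, y⟩ ⟨hx, hy⟩ h
    change X.B x x + Y.B y y < 0
    by_cases hx0 : x = 0
    · subst hx0
      have : y ≠ 0 := by rintro rfl; exact h rfl
      simpa using h2' y hy this
    · have := h2 x hx hx0
      by_cases hy0 : y = 0
      · subst hy0; simpa using this
      · have := h2' y hy hy0
        linarith
  · rw [← h3, ← h3']; exact finrank_prod_sub P P'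
  · rw [← h4, ← h4']; exact finrank_prod_sub Q Q'

lemma SigRep.zero : SigRep 0 0 0 := ⟨Obj.zero, rfl, by simp, ⊥, ⊥, by simp, by simp, by simp, by simp⟩

lemma SigRep.pos {a : ℚ} (h : 0 < a) : SigRep 1 0 (cls a) := by
  refine ⟨obj1 a h.ne', (cls_of_ne h.ne').symm, by simp, ⊤, ⊥, ?_, by simp, ?_, by simp⟩
  · intro (x : ℚ) _ (hx : x ≠ 0)
    rw [obj1_B]
    exact mul_pos h (mul_self_pos.2 hx)
  · rw [finrank_top]; exact Module.finrank_self ℚ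

lemma SigRep.neg {a : ℚ} (h : a < 0) : SigRep 0 1 (cls a) := by
  refine ⟨obj1 a h.ne, (cls_of_ne h.ne).symm, by simp, ⊥, ⊤, by simp, ?_, by simp, ?_⟩
  · intro (x : ℚ) _ (hx : x ≠ 0)
    rw [obj1_B]
    have : 0 < x * x := mul_self_pos.2 hx
    nlinarith
  · rw [finrank_top]; exact Module.finrank_self ℚ

lemma SigRep.sum {ι : Type*} (s : Finset ι) (a : ι → ℚ) (h : ∀ i ∈ s, a i ≠ 0) :
    SigRep (s.filter fun i => 0 < a i).card (s.filter fun i => a i < 0).card (∑ i ∈ s, cls (a i)) := by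
  classical
  induction s using Finset.induction_on with
  | empty => simpa using SigRep.zero
  | insert i s hi ih =>
    rw [Finset.sum_insert hi, Finset.filter_insert, Finset.filter_insert]
    have ih' := ih fun j hj => h j (by simp [hj])
    rcases lt_or_gt_of_ne (h i (by simp)) with h0 | h0
    · rw [if_neg (not_lt.2 h0.le), if_pos h0, Finset.card_insert_of_notMem (by simp [hi])]
      simpa [add_comm] using (SigRep.neg h0).add ih'
    · rw [if_neg (not_lt.2 h0.le), if_pos h0, Finset.card_insert_of_notMem (by simp [hi])]
      simpa [add_comm] using (SigRep.pos h0).add ih'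

lemma SigRep.le {p q p' q' : ℕ} {w : W} (h : SigRep p q w) (h' : SigRep p' q' w) : p + q' ≤ p' + q := by
  obtain ⟨X, rfl, hX, P, Q, h1, h2, h3, h4⟩ := h
  obtain ⟨Y, hXY, hY, P', Q', h1', h2', h3', h4'⟩ := h'
  obtain ⟨N, hN, hNd⟩ := W.mk_eq.1 hXY.symm
  simp only [Obj.dim_sum, Obj.dim_op] at hNd
  have h5 := finrank_prod_sub P Q'
  change Submodule ℚ (X.V × Y.V) at N
  have h6 : N ⊓ P.prod Q' = ⊥ := by
    rw [eq_bot_iff]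
    rintro ⟨x, y⟩ ⟨hxy, hx, hy⟩
    have := hN _ hxy _ hxy
    change X.B x x + -(Y.B y y) = 0 at this
    have hx0 : x = 0 := by
      by_contra hx0
      have := h1 x hx hx0
      by_cases hy0 : y = 0
      · subst hy0; simp at *; linarith
      · have := h2' y hy hy0; linarith
    subst hx0
    have hy0 : y = 0 := by
      by_contra hy0
      have := h2' y hy hy0; simp at *; linarith
    subst hy0
    exact Submodule.zero_mem _
  have h7 := Submodule.finrank_sup_add_finrank_inf_eq N (P.prod Q')
  have h8 := Submodule.finrank_le (N ⊔ P.prod Q')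
  rw [h6, finrank_bot, h5] at h7
  rw [Module.finrank_prod] at h8
  change _ ≤ X.dim + Y.dim at h8
  change _ ≤ 2 * Module.finrank ℚ N at hNd
  omega

/-- diagonal form -/
noncomputable def dObj {d : ℕ} (a : Fin d → ℚ) (h : ∀ i, a i ≠ 0) : Obj :=
  ⟨Fin d → ℚ, mform (Matrix.diagonal a), mform_sym (isSymm_diagonal a),
    mform_nd (isSymm_diagonal a) (by rw [det_diagonal]; exact Finset.prod_ne_zero_iff.2 fun i _ => h i)⟩

lemma dObj_B {d : ℕ} (a : Fin d → ℚ) (h : ∀ i, a i ≠ 0) (x y : Fin d → ℚ) :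
    (dObj a h).B x y = ∑ i, a i * (x i * y i) := by
  change mform _ x y = _
  rw [mform_apply]
  simp only [dotProduct, mulVec_diagonal]
  exact Finset.sum_congr rfl fun i _ => by ring

lemma dObj_mk {d : ℕ} (a : Fin d → ℚ) (h : ∀ i, a i ≠ 0) : W.mk (dObj a h) = ∑ i, cls (a i) := by
  have hdim : ∀ {d : ℕ} (a : Fin d → ℚ) (h : ∀ i, a i ≠ 0), (dObj a h).dim = d := fun a h => by
    exact (Module.finrank_fintype_fun_eq_card ℚ).trans (by simp)
  induction d with
  | zero =>
    rw [Finset.univ_eq_empty, Finset.sum_empty, W.mk_eq_zero]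
    exact ⟨⊥, fun x hx y _ => by rw [(Submodule.mem_bot ℚ).1 hx]; simp, by rw [hdim]; simp⟩
  | succ d ih =>
    rw [Fin.sum_univ_succ, ← ih (fun i => a i.succ) (fun i => h _), cls_of_ne (h 0)]
    let f : ℚ →ₗ[ℚ] (Fin (d+1) → ℚ) := LinearMap.single ℚ (fun _ => ℚ) 0
    let g : (Fin d → ℚ) →ₗ[ℚ] (Fin (d+1) → ℚ) :=
      { toFun := fun x => Fin.cons 0 x
        map_add' := fun x y => by ext i; refine Fin.cases ?_ (fun i => ?_) i <;> simp
        map_smul' := fun x y => by ext i; refine Fin.cases ?_ (fun i => ?_) i <;> simp }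
    refine W.mk_eq_add (X := dObj a h) (P := obj1 (a 0) (h 0)) (Q := dObj (fun i => a i.succ) (fun i => h _)) f g ?_ ?_ ?_ ?_
    · intro (x : ℚ) (y : ℚ)
      refine (dObj_B a h (f x) (f y)).trans ((?_ : _ = _).trans (obj1_B _ (h 0) x y).symm)
      rw [Fin.sum_univ_succ]
      simp [f]
    · intro (x : Fin d → ℚ) (y : Fin d → ℚ)
      refine (dObj_B a h (g x) (g y)).trans ((?_ : _ = _).trans (dObj_B _ (fun i => h _) x y).symm)
      rw [Fin.sum_univ_succ]
      simp [g]
    · intro (x : ℚ) (y : Fin d → ℚ)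
      refine (dObj_B a h (f x) (g y)).trans ?_
      rw [Fin.sum_univ_succ]
      simp [f, g]
    · rw [hdim, hdim, obj1_dim]; omega

/-- orthogonal basis and the class -/
lemma exists_orth_basis (X : Obj) : ∃ v : Module.Basis (Fin X.dim) ℚ X.V,
    (∀ i j, i ≠ j → X.B (v i) (v j) = 0) ∧ (∀ i, X.B (v i) (v i) ≠ 0) ∧
    W.mk X = ∑ i, cls (X.B (v i) (v i)) := by
  haveI : Invertible (2 : ℚ) := invertibleOfNonzero two_ne_zero
  obtain ⟨v, hv⟩ := LinearMap.BilinForm.exists_orthogonal_basis (B := X.B) ⟨fun x y => by simpa using X.sym x y⟩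
  have ho : ∀ i j, i ≠ j → X.B (v i) (v j) = 0 := fun i j hij => hv hij
  have hne : ∀ i, X.B (v i) (v i) ≠ 0 := by
    intro i hi
    refine v.ne_zero i (X.nd _ fun y => ?_)
    have : X.B (v i) = 0 := v.ext fun j => by
      by_cases hij : i = j
      · subst hij; simpa using hi
      · simpa using ho i j hij
    simp [this]
  refine ⟨v, ho, hne, ?_⟩
  refine Eq.trans ?_ (dObj_mk _ hne)
  symm
  refine W.mk_eq_of_map (X := dObj _ hne) v.equivFun.symm.toLinearMap ?_ ?_
  · intro (x : Fin (Module.finrank ℚ X.V) → ℚ) (y : Fin (Module.finrank ℚ X.V) → ℚ)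
    refine Eq.trans ?_ (dObj_B _ hne x y).symm
    change X.B (v.equivFun.symm x) (v.equivFun.symm y) = _
    rw [v.equivFun_symm_apply, v.equivFun_symm_apply]
    simp only [map_sum, LinearMap.sum_apply, map_smul, LinearMap.smul_apply, smul_eq_mul]
    refine Finset.sum_congr rfl fun i _ => ?_
    rw [Finset.sum_eq_single i]
    · ring
    · intro j _ hij; rw [ho j i hij]; ring
    · simp
  · exact le_of_eq (LinearEquiv.finrank_eq v.equivFun)

end NK

namespace NK
open Matrix

/-- A saturated submodule of a free ℤ-module has a basis with dual functionals. -/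
lemma sat_dual {E : Type*} [AddCommGroup E] [Module.Free ℤ E] [Module.Finite ℤ E] (Λ : Submodule ℤ E)
    (hs : ∀ (k : ℤ) (x : E), k ≠ 0 → k • x ∈ Λ → x ∈ Λ) :
    ∃ ρ : E →ₗ[ℤ] Λ, ∀ x : Λ, ρ x = x := by
  haveI : Module.IsTorsionFree ℤ (E ⧸ Λ) := by
    refine Module.IsTorsionFree.mk fun k hk => ?_
    have hk0 : k ≠ 0 := hk.ne_zero
    intro x y hxy
    obtain ⟨x, rfl⟩ := Submodule.Quotient.mk_surjective _ x
    obtain ⟨y, rfl⟩ := Submodule.Quotient.mk_surjective _ y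
    rw [Submodule.Quotient.eq]
    apply hs k _ hk0
    rw [smul_sub, ← Submodule.Quotient.eq]
    simpa using hxy
  haveI : Module.Free ℤ (E ⧸ Λ) := Module.free_of_finite_type_torsion_free'
  obtain ⟨σ, hσ⟩ := Module.projective_lifting_property Λ.mkQ LinearMap.id Λ.mkQ_surjective
  refine ⟨LinearMap.codRestrict Λ (LinearMap.id - σ.comp Λ.mkQ) ?_, ?_⟩
  · intro x
    rw [← Submodule.Quotient.mk_eq_zero]
    have := LinearMap.congr_fun hσ (Λ.mkQ x)
    simp only [LinearMap.sub_apply, LinearMap.id_apply, Submodule.Quotient.mk_sub, LinearMap.comp_apply] at this ⊢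
    rw [sub_eq_zero]
    exact this.symm
  · intro x
    ext
    simp [(Submodule.Quotient.mk_eq_zero Λ).2 x.2]

section redu
variable {ι : Type*} [Fintype ι] [DecidableEq ι]

/-- cast of an integer vector -/
def cv {ι : Type*} (R : Type*) [Ring R] (x : ι → ℤ) : ι → R := fun i => (x i : R)

@[simp] lemma cv_apply {ι : Type*} (R : Type*) [Ring R] (x : ι → ℤ) (i : ι) : cv R x i = (x i : R) := rfl
lemma cv_add {ι : Type*} (R : Type*) [Ring R] (x y : ι → ℤ) : cv R (x + y) = cv R x + cv R y := by ext; simp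
lemma cv_sub {ι : Type*} (R : Type*) [Ring R] (x y : ι → ℤ) : cv R (x - y) = cv R x - cv R y := by ext; simp
lemma cv_zero {ι : Type*} (R : Type*) [Ring R] : cv R (0 : ι → ℤ) = 0 := by ext; simp
lemma cv_smul {ι : Type*} (R : Type*) [Ring R] (k : ℤ) (x : ι → ℤ) : cv R (k • x) = (k : R) • cv R x := by ext; simp

lemma cv_sum {ι κ : Type*} [Fintype κ] (R : Type*) [Ring R] (x : κ → ι → ℤ) : cv R (∑ i, x i) = ∑ i, cv R (x i) := by
  ext; simp

lemma exists_int_multiple (v : ι → ℚ) : ∃ (k : ℤ) (x : ι → ℤ), k ≠ 0 ∧ (k : ℚ) • v = cv ℚ x := by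
  refine ⟨((∏ i, (v i).den : ℕ) : ℤ), fun i => (v i).num * ((∏ j ∈ Finset.univ.erase i, (v j).den : ℕ) : ℤ), ?_, ?_⟩
  · exact_mod_cast Finset.prod_ne_zero_iff.2 fun i _ => (v i).den_nz
  · ext i
    rw [← Finset.mul_prod_erase _ _ (Finset.mem_univ i)]
    simp only [Pi.smul_apply, smul_eq_mul, cv_apply]
    push_cast
    have := Rat.mul_den_eq_num (v i)
    rw [← this]; ring

lemma cv_dot (R : Type*) [CommRing R] (A : Matrix ι ι ℤ) (x y : ι → ℤ) :
    cv R x ⬝ᵥ (A.map (Int.cast : ℤ → R)) *ᵥ cv R y = ((x ⬝ᵥ A *ᵥ y : ℤ) : R) := by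
  simp [dotProduct, mulVec, Finset.mul_sum]

/-- Reduction of a rational subspace mod `p`. -/
lemma reduce (p : ℕ) [Fact p.Prime] (N : Submodule ℚ (ι → ℚ)) :
    ∃ Nb : Submodule (ZMod p) (ι → ZMod p), Module.finrank ℚ N ≤ Module.finrank (ZMod p) Nb ∧
      ∀ xb ∈ Nb, ∃ x : ι → ℤ, cv ℚ x ∈ N ∧ cv (ZMod p) x = xb := by
  let Λ : Submodule ℤ (ι → ℤ) :=
    { carrier := {x | cv ℚ x ∈ N}
      add_mem' := fun {a b} ha hb => by
        change cv ℚ (a + b) ∈ N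
        rw [cv_add]; exact N.add_mem ha hb
      zero_mem' := by change cv ℚ 0 ∈ N; rw [cv_zero]; exact N.zero_mem
      smul_mem' := fun k x hx => by change cv ℚ (k • x) ∈ N; rw [cv_smul]; exact N.smul_mem _ hx }
  have hΛ : ∀ x, x ∈ Λ ↔ cv ℚ x ∈ N := fun x => Iff.rfl
  obtain ⟨ρ, hρ⟩ := sat_dual Λ (fun k x hk hx => by
    rw [hΛ, cv_smul] at hx
    have := N.smul_mem ((k : ℚ)⁻¹) hx
    rw [smul_smul, inv_mul_cancel₀ (by exact_mod_cast hk), one_smul] at this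
    exact this)
  let b := Module.finBasis ℤ Λ
  set d := Module.finrank ℤ Λ
  let Nb : Submodule (ZMod p) (ι → ZMod p) :=
    { carrier := {xb | ∃ x ∈ Λ, cv (ZMod p) x = xb}
      add_mem' := by
        rintro _ _ ⟨x, hx, rfl⟩ ⟨y, hy, rfl⟩
        exact ⟨x + y, Λ.add_mem hx hy, cv_add _ _ _⟩
      zero_mem' := ⟨0, Λ.zero_mem, cv_zero _⟩
      smul_mem' := by
        rintro c _ ⟨x, hx, rfl⟩
        refine ⟨(c.val : ℤ) • x, Λ.smul_mem _ hx, ?_⟩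
        rw [cv_smul]; simp }
  refine ⟨Nb, ?_, fun xb ⟨x, hx, h⟩ => ⟨x, hx, h⟩⟩
  -- upper bound
  have h1 : Module.finrank ℚ N ≤ d := by
    have hle : N ≤ Submodule.span ℚ (Set.range fun i : Fin d => cv ℚ (b i : ι → ℤ)) := by
      intro v hv
      obtain ⟨k, x, hk, hx⟩ := exists_int_multiple v
      have hxm : x ∈ Λ := by rw [hΛ, ← hx]; exact N.smul_mem _ hv
      have h2 := congrArg (fun y : Λ => cv ℚ (y : ι → ℤ)) (b.sum_repr ⟨x, hxm⟩)
      have hv' : v = (k : ℚ)⁻¹ • cv ℚ x := by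
        rw [← hx, smul_smul, inv_mul_cancel₀ (by exact_mod_cast hk), one_smul]
      rw [hv']
      refine Submodule.smul_mem _ _ ?_
      simp only [Submodule.coe_sum, Submodule.coe_smul, cv_sum, cv_smul] at h2
      rw [← h2]
      exact Submodule.sum_mem _ fun i _ => Submodule.smul_mem _ _ (Submodule.subset_span ⟨i, rfl⟩)
    have h3 := Submodule.finrank_mono hle
    have h4 := finrank_range_le_card (R := ℚ) (b := fun i : Fin d => cv ℚ (b i : ι → ℤ))
    rw [Set.finrank, Fintype.card_fin] at h4
    omega
  -- independence
  let φ : Fin d → (ι → ZMod p) →ₗ[ZMod p] ZMod p := fun i =>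
    ∑ k, ((b.repr (ρ (Pi.single k 1)) i : ℤ) : ZMod p) • LinearMap.proj k
  have hφ : ∀ i (x : ι → ℤ), φ i (cv (ZMod p) x) = ((b.repr (ρ x) i : ℤ) : ZMod p) := by
    intro i x
    have : x = ∑ k, x k • (Pi.single k 1 : ι → ℤ) := by
      ext j; simp [Finset.sum_apply, Pi.single_apply]
    conv_rhs => rw [this]
    simp only [map_sum, map_smul, Finsupp.coe_finsetSum, Finset.sum_apply, Finsupp.smul_apply, smul_eq_mul, φ,
      LinearMap.sum_apply, LinearMap.smul_apply, LinearMap.proj_apply, cv_apply]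
    push_cast
    exact Finset.sum_congr rfl fun k _ => mul_comm _ _
  have h5 : LinearIndependent (ZMod p) (fun i : Fin d => (⟨cv (ZMod p) (b i : ι → ℤ), ⟨b i, (b i).2, rfl⟩⟩ : Nb)) := by
    rw [Fintype.linearIndependent_iff]
    intro g hg i
    have h6 := congrArg (fun y : Nb => φ i y) hg
    simp only [Submodule.coe_sum, Submodule.coe_smul, map_sum, map_smul, hφ, hρ, Module.Basis.repr_self,
      ZeroMemClass.coe_zero, map_zero, smul_eq_mul] at h6
    rw [Finset.sum_eq_single i] at h6
    · simpa using h6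
    · intro j _ hj; simp [Finsupp.single_apply, hj]
    · simp
  have h6 := h5.fintype_card_le_finrank
  rw [Fintype.card_fin] at h6
  omega

end redu

/-- classes with a `p`-unimodular model -/
def Uset (p : ℕ) (w : W) : Prop := ∃ (k : ℕ) (A : Matrix (Fin k) (Fin k) ℤ) (hs : A.IsSymm) (hd : A.det ≠ 0),
  ¬ ((p : ℤ) ∣ A.det) ∧ W.mk (zObj A hs hd) = w

lemma zObj_reindex {ι κ : Type} [Fintype ι] [DecidableEq ι] [Fintype κ] [DecidableEq κ] (e : ι ≃ κ)
    (A : Matrix ι ι ℤ) (hs : A.IsSymm) (hd : A.det ≠ 0) (hs') (hd') :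
    W.mk (zObj (A.submatrix e.symm e.symm) hs' hd') = W.mk (zObj A hs hd) := by
  symm
  refine W.mk_eq_of_map (X := zObj A hs hd) (Y := zObj (A.submatrix e.symm e.symm) hs' hd')
    (LinearMap.funLeft ℚ ℚ e.symm) ?_ ?_
  · intro (x : ι → ℚ) (y : ι → ℚ)
    change mform _ (x ∘ e.symm) (y ∘ e.symm) = mform _ x y
    rw [mform_apply, mform_apply]
    have : (A.submatrix e.symm e.symm).map (Int.cast : ℤ → ℚ) = (A.map Int.cast).submatrix e.symm e.symm := rfl
    rw [this, submatrix_mulVec_equiv]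
    simp only [Equiv.symm_symm, Function.comp_assoc, Equiv.symm_comp_self, Function.comp_id]
    exact comp_equiv_dotProduct_comp_equiv _ _ _
  · rw [zObj_dim, zObj_dim, Fintype.card_congr e]

lemma uset_of {ι : Type} [Fintype ι] [DecidableEq ι] {p : ℕ}
    (A : Matrix ι ι ℤ) (hs : A.IsSymm) (hd : A.det ≠ 0) (h : ¬ ((p : ℤ) ∣ A.det)) : Uset p (W.mk (zObj A hs hd)) := by
  let e := Fintype.equivFin ι
  have h0 : (A.submatrix e.symm e.symm).det = A.det := det_submatrix_equiv_self _ _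
  exact ⟨Fintype.card ι, A.submatrix e.symm e.symm, hs.submatrix _, by rwa [h0], by rwa [h0],
    zObj_reindex e A hs hd _ _⟩

lemma zObj_blocks {ι κ : Type} [Fintype ι] [DecidableEq ι] [Fintype κ] [DecidableEq κ]
    (A : Matrix ι ι ℤ) (hs : A.IsSymm) (hd : A.det ≠ 0)
    (B : Matrix κ κ ℤ) (hs' : B.IsSymm) (hd' : B.det ≠ 0) (hs2) (hd2) :
    W.mk (zObj (fromBlocks A 0 0 B) hs2 hd2) = W.mk (zObj A hs hd) + W.mk (zObj B hs' hd') := by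
  rw [W.mk_add]
  symm
  refine W.mk_eq_of_map (X := (zObj A hs hd).sum (zObj B hs' hd')) (Y := zObj (fromBlocks A 0 0 B) hs2 hd2)
    (LinearEquiv.sumArrowLequivProdArrow ι κ ℚ ℚ).symm.toLinearMap ?_ ?_
  · rintro (⟨x, y⟩ : (ι → ℚ) × (κ → ℚ)) (⟨z, w⟩ : (ι → ℚ) × (κ → ℚ))
    change mform _ (Sum.elim x y) (Sum.elim z w) = mform _ x z + mform _ y w
    simp only [mform_apply, fromBlocks_map, Matrix.map_zero _ Int.cast_zero, fromBlocks_mulVec,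
      Sum.elim_comp_inl, Sum.elim_comp_inr, zero_mulVec, add_zero, zero_add]
    simp [dotProduct]
  · simp [zObj_dim]

lemma Uset.add {p : ℕ} [Fact p.Prime] {w v : W} (h : Uset p w) (h' : Uset p v) : Uset p (w + v) := by
  obtain ⟨k, A, hs, hd, h1, rfl⟩ := h
  obtain ⟨l, B, hs', hd', h1', rfl⟩ := h'
  have h2 : (fromBlocks A 0 0 B).det = A.det * B.det := det_fromBlocks_zero₂₁ _ _ _
  have hd2 : (fromBlocks A 0 0 B).det ≠ 0 := by rw [h2]; exact mul_ne_zero hd hd'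
  have hs2 : (fromBlocks A 0 0 B).IsSymm := by
    rw [IsSymm, fromBlocks_transpose, hs.eq, hs'.eq, transpose_zero, transpose_zero]
  rw [← zObj_blocks A hs hd B hs' hd' hs2 hd2]
  apply uset_of
  rw [h2]
  intro h
  rcases (Nat.prime_iff_prime_int.1 Fact.out).dvd_or_dvd h with h | h
  · exact h1 h
  · exact h1' h

lemma Uset.neg {p : ℕ} [Fact p.Prime] {w : W} (h : Uset p w) : Uset p (-w) := by
  obtain ⟨k, A, hs, hd, h1, rfl⟩ := h
  have h2 : (-A).det = (-1) ^ k * A.det := by rw [det_neg, Fintype.card_fin]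
  have h3 : IsUnit ((-1 : ℤ) ^ k) := (isUnit_one.neg).pow k
  have hd' : (-A).det ≠ 0 := by rw [h2]; exact mul_ne_zero h3.ne_zero hd
  refine ⟨k, -A, hs.neg, hd', ?_, ?_⟩
  · rwa [h2, h3.dvd_mul_left]
  · rw [W.mk_neg]
    refine W.mk_eq_of_map (X := zObj (-A) hs.neg hd') (Y := (zObj A hs hd).op) (LinearMap.id : (Fin k → ℚ) →ₗ[ℚ] _) ?_ ?_
    · intro (x : Fin k → ℚ) (y : Fin k → ℚ)
      change -(mform _ x y) = mform _ x y
      have : (-A).map (Int.cast : ℤ → ℚ) = - A.map (Int.cast : ℤ → ℚ) := by ext; simp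
      rw [mform_apply, mform_apply, this, neg_mulVec, dotProduct_neg]
    · rw [Obj.dim_op, zObj_dim, zObj_dim]

lemma zObj_empty (A : Matrix (Fin 0) (Fin 0) ℤ) (hs) (hd) : W.mk (zObj A hs hd) = 0 :=
  W.mk_eq_zero.2 ⟨⊥, fun x hx y _ => by rw [(Submodule.mem_bot ℚ).1 hx]; simp, by rw [zObj_dim]; simp⟩

/-- the subgroup of `p`-unimodular classes -/
noncomputable def U (p : ℕ) [Fact p.Prime] : AddSubgroup W where
  carrier := {w | Uset p w}
  add_mem' h h' := Uset.add h h'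
  zero_mem' := by
    refine ⟨0, 1, isSymm_one, by simp, ?_, zObj_empty _ _ _⟩
    rw [det_one]
    intro h
    exact (Nat.prime_iff_prime_int.1 (Fact.out : p.Prime)).not_unit (isUnit_of_dvd_one h)
  neg_mem' h := Uset.neg h

lemma cls_int {a : ℤ} (h : a ≠ 0) : ∃ hs hd, cls (a : ℚ) = W.mk (zObj (Matrix.diagonal (fun _ : Fin 1 => a)) hs hd) := by
  have hd : (Matrix.diagonal (fun _ : Fin 1 => a)).det ≠ 0 := by simpa using h
  refine ⟨isSymm_diagonal _, hd, ?_⟩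
  rw [cls_of_ne (by exact_mod_cast h)]
  refine W.mk_eq_of_map (X := obj1 _ _) (Y := zObj _ (isSymm_diagonal _) hd) (LinearMap.pi fun _ => LinearMap.id : ℚ →ₗ[ℚ] (Fin 1 → ℚ)) ?_ ?_
  · intro (x : ℚ) (y : ℚ)
    rw [obj1_B]
    change mform _ (fun _ => x) (fun _ => y) = _
    rw [mform_apply, diagonal_map (by simp)]
    simp [dotProduct, mulVec_diagonal]
    ring
  · rw [zObj_dim, obj1_dim]; simp

lemma cls_mem_U {p : ℕ} [Fact p.Prime] {a : ℤ} (h : ¬ (p : ℤ) ∣ a) : cls (a : ℚ) ∈ U p := by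
  obtain ⟨hs, hd, h1⟩ := cls_int (a := a) (by rintro rfl; simp at h)
  rw [h1]
  exact uset_of _ _ _ (by simpa using h)

end NK

namespace NK
open Matrix

lemma zObj_diag {d : ℕ} (a : Fin d → ℤ) (hs) (hd) : W.mk (zObj (Matrix.diagonal a) hs hd) = ∑ i, cls (a i : ℚ) := by
  have h : ∀ i, (a i : ℚ) ≠ 0 := by
    rw [det_diagonal] at hd
    intro i
    exact_mod_cast Finset.prod_ne_zero_iff.1 hd i (Finset.mem_univ i)
  rw [← dObj_mk _ h]
  refine W.mk_eq_of_map (X := zObj _ hs hd) (Y := dObj _ h) (LinearMap.id : (Fin d → ℚ) →ₗ[ℚ] _) ?_ ?_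
  · intro (x : Fin d → ℚ) (y : Fin d → ℚ)
    change mform _ x y = mform _ x y
    rw [diagonal_map (by simp)]
  · rw [zObj_dim]
    change Module.finrank ℚ (Fin d → ℚ) ≤ _
    rw [Module.finrank_fintype_fun_eq_card]

/-- an element of `N ∩ ℤ^ι` pairs to zero -/
lemma int_pair_zero {ι : Type} [Fintype ι] [DecidableEq ι] {A : Matrix ι ι ℤ} {hs : A.IsSymm} {hd : A.det ≠ 0}
    {N : Submodule ℚ (ι → ℚ)} (hN : TI (zObj A hs hd).B N) {x y : ι → ℤ} (hx : cv ℚ x ∈ N) (hy : cv ℚ y ∈ N) :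
    x ⬝ᵥ A *ᵥ y = 0 := by
  have h1 : mform _ (cv ℚ x) (cv ℚ y) = 0 := hN _ hx _ hy
  rw [mform_apply, cv_dot] at h1
  exact_mod_cast h1

lemma not_met {p : ℕ} [Fact p.Prime] {k r : ℕ} (hr : 0 < r) (A : Matrix (Fin k) (Fin k) ℤ) (hs : A.IsSymm)
    (hd : ¬ (p : ℤ) ∣ A.det) (n : Fin r → ℤ) (hn : ∀ y : Fin r → ZMod p, ∑ i, (n i : ZMod p) * y i ^ 2 = 0 → y = 0)
    (hs') (hd') : ¬ (zObj (fromBlocks A 0 0 (Matrix.diagonal fun i => (p : ℤ) * n i)) hs' hd').Met := by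
  rintro ⟨N, hN, hNd⟩
  change Submodule ℚ (Fin k ⊕ Fin r → ℚ) at N
  obtain ⟨Nb, h1, h2⟩ := reduce p N
  rw [zObj_dim] at hNd
  simp only [Fintype.card_sum, Fintype.card_fin] at hNd
  change _ ≤ 2 * Module.finrank ℚ N at hNd
  let f : Nb →ₗ[ZMod p] (Fin k → ZMod p) := (LinearMap.funLeft (ZMod p) (ZMod p) Sum.inl).comp Nb.subtype
  have key : ∀ x y : Fin k ⊕ Fin r → ℤ, cv ℚ x ∈ N → cv ℚ y ∈ N →
      (x ∘ Sum.inl) ⬝ᵥ A *ᵥ (y ∘ Sum.inl) + p * ∑ i, n i * (x (Sum.inr i) * y (Sum.inr i)) = 0 := by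
    intro x y hx hy
    have h3 := int_pair_zero hN hx hy
    rw [fromBlocks_mulVec] at h3
    simp only [zero_mulVec, add_zero, zero_add] at h3
    rw [← h3, dotProduct, dotProduct, Fintype.sum_sum_type, Finset.mul_sum]
    congr 1
    refine Finset.sum_congr rfl fun i _ => ?_
    simp [mulVec_diagonal]
    ring
  have hpp : Prime (p : ℤ) := Nat.prime_iff_prime_int.1 Fact.out
  have hinj : Function.Injective f := by
    rw [injective_iff_map_eq_zero]
    rintro ⟨xb, hxb⟩ hx0
    obtain ⟨x, hx, rfl⟩ := h2 xb hxb
    have h3 := key x x hx hx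
    have h4 : ∀ i, (p : ℤ) ∣ x (Sum.inl i) := fun i => by
      have := congrFun hx0 i
      exact (ZMod.intCast_zmod_eq_zero_iff_dvd _ p).1 this
    choose u hu using h4
    have h5 : x ∘ Sum.inl = (p : ℤ) • u := by ext i; simp [hu]
    rw [h5, mulVec_smul, dotProduct_smul, smul_dotProduct, smul_eq_mul, smul_eq_mul, ← mul_add] at h3
    have h6 := (mul_eq_zero.1 h3).resolve_left hpp.ne_zero
    have h7 : cv (ZMod p) x ∘ Sum.inr = 0 := by
      apply hn
      have := congrArg (Int.cast : ℤ → ZMod p) h6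
      push_cast at this
      rw [show ((p : ℕ) : ZMod p) = 0 by simp, zero_mul, zero_add] at this
      rw [← this]
      refine Finset.sum_congr rfl fun i _ => ?_
      simp [sq]
    ext i
    rcases i with i | i
    · exact congrFun hx0 i
    · exact congrFun h7 i
  have h3 : Module.finrank (ZMod p) (LinearMap.range f) + Module.finrank (ZMod p) (LinearMap.range f) ≤
      Module.finrank (ZMod p) (Fin k → ZMod p) := by
    apply finrank_add_le_of_ortho (B := mform (A.map (Int.cast : ℤ → ZMod p)))
    · apply mform_nd
      · rw [IsSymm, ← transpose_map, hs.eq]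
      · have : (A.map (Int.cast : ℤ → ZMod p)).det = (A.det : ZMod p) := (Int.cast_det A).symm
        rw [this, Ne, ZMod.intCast_zmod_eq_zero_iff_dvd]
        exact hd
    · rintro _ ⟨⟨xb, hx⟩, rfl⟩ _ ⟨⟨yb, hy⟩, rfl⟩
      obtain ⟨x, hx', rfl⟩ := h2 xb hx
      obtain ⟨y, hy', rfl⟩ := h2 yb hy
      have h4 := congrArg (Int.cast : ℤ → ZMod p) (key x y hx' hy')
      push_cast at h4
      rw [show ((p : ℕ) : ZMod p) = 0 by simp, zero_mul, add_zero] at h4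
      rw [← cv_dot (ZMod p)] at h4
      rw [mform_apply]
      exact h4
  rw [LinearMap.finrank_range_of_inj hinj, Module.finrank_fintype_fun_eq_card, Fintype.card_fin] at h3
  omega

lemma not_mem_U {p : ℕ} [Fact p.Prime] {r : ℕ} (hr : 0 < r) 
    (n : Fin r → ℤ) (hn : ∀ y : Fin r → ZMod p, ∑ i, (n i : ZMod p) * y i ^ 2 = 0 → y = 0) :
    ∑ i, cls ((p * n i : ℤ) : ℚ) ∉ U p := by
  rintro ⟨k, A, hs, hd, hp, h⟩
  have hp0 : (p : ℤ) ≠ 0 := by exact_mod_cast (Fact.out : p.Prime).ne_zero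
  have hn0 : ∀ i, n i ≠ 0 := by
    intro i hi
    have := congrFun (hn (Pi.single i 1) (by
      rw [Finset.sum_eq_single i]
      · simp [hi]
      · intro j _ hj; simp [hj]
      · simp)) i
    simp at this
  have hd2 : (Matrix.diagonal fun i => (p : ℤ) * (-n i)).det ≠ 0 := by
    rw [det_diagonal]
    exact Finset.prod_ne_zero_iff.2 fun i _ => mul_ne_zero hp0 (neg_ne_zero.2 (hn0 i))
  have hd3 : (fromBlocks A 0 0 (Matrix.diagonal fun i => (p : ℤ) * (-n i))).det ≠ 0 := by
    rw [det_fromBlocks_zero₂₁]; exact mul_ne_zero hd hd2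
  have hs3 : (fromBlocks A 0 0 (Matrix.diagonal fun i => (p : ℤ) * (-n i))).IsSymm := by
    rw [IsSymm, fromBlocks_transpose, hs.eq, (isSymm_diagonal _).eq, transpose_zero, transpose_zero]
  refine not_met (p := p) hr A hs hp (fun i => -n i) ?_ hs3 hd3 ?_
  · intro y hy
    apply hn
    simpa using hy
  · rw [← W.mk_eq_zero, zObj_blocks A hs hd _ (isSymm_diagonal _) hd2, zObj_diag, h, ← Finset.sum_add_distrib]
    refine Finset.sum_eq_zero fun i _ => ?_
    rw [show ((p * -n i : ℤ) : ℚ) = -((p * n i : ℤ) : ℚ) by push_cast; ring, cls_neg, add_neg_cancel]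

end NK

namespace NK
open Matrix

/-- the formal properties of a residue map on a finite prime field -/
structure PhiSys (p : ℕ) (Q : Type*) [AddCommGroup Q] (φ : ZMod p → Q) : Prop where
  z : φ 0 = 0
  sq : ∀ a c, c ≠ 0 → φ (a * c ^ 2) = φ a
  neg : ∀ a, φ (-a) = -φ a
  add : ∀ a b, φ a + φ b = φ (a + b) + φ (a * b * (a + b))

lemma PhiSys.rep {p : ℕ} [Fact p.Prime] {Q : Type*} [AddCommGroup Q] {φ : ZMod p → Q} (H : PhiSys p Q φ)
    {a b t x y : ZMod p} (h : a * x ^ 2 + b * y ^ 2 = t) (ht : t ≠ 0) : φ a + φ b = φ t + φ (a * b * t) := by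
  by_cases hx : x = 0
  · have hy : y ≠ 0 := by rintro rfl; apply ht; rw [← h, hx]; ring
    have hb : b ≠ 0 := by rintro rfl; apply ht; rw [← h, hx]; ring
    rw [← h, hx, show a * 0 ^ 2 + b * y ^ 2 = b * y ^ 2 by ring, H.sq _ _ hy,
      show a * b * (b * y ^ 2) = a * (b * y) ^ 2 by ring, H.sq _ _ (mul_ne_zero hb hy), add_comm]
  · by_cases hy : y = 0
    · have ha : a ≠ 0 := by rintro rfl; apply ht; rw [← h, hy]; ring
      rw [← h, hy, show a * x ^ 2 + b * 0 ^ 2 = a * x ^ 2 by ring, H.sq _ _ hx,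
        show a * b * (a * x ^ 2) = b * (a * x) ^ 2 by ring, H.sq _ _ (mul_ne_zero ha hx)]
    · rw [← H.sq a x hx, ← H.sq b y hy, H.add, h, show a * x ^ 2 * (b * y ^ 2) * t = a * b * t * (x * y) ^ 2 by ring,
        H.sq _ _ (mul_ne_zero hx hy)]

lemma PhiSys.iso {p : ℕ} [Fact p.Prime] {Q : Type*} [AddCommGroup Q] {φ : ZMod p → Q} (H : PhiSys p Q φ)
    {a b x y : ZMod p} (ha : a ≠ 0) (hb : b ≠ 0) (h : a * x ^ 2 + b * y ^ 2 = 0) (hxy : x ≠ 0 ∨ y ≠ 0) : φ a + φ b = 0 := by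
  have hx : x ≠ 0 := by
    rintro rfl
    have : y ≠ 0 := by simpa using hxy
    have : b * y ^ 2 = 0 := by rw [← h]; ring
    simp_all
  have hy : y ≠ 0 := by
    rintro rfl
    have : a * x ^ 2 = 0 := by rw [← h]; ring
    simp_all
  rw [← H.sq a x hx, ← H.sq b y hy, show b * y ^ 2 = -(a * x ^ 2) by linear_combination h, H.neg, add_neg_cancel]

lemma two_squares {p : ℕ} [Fact p.Prime] (hp : p ≠ 2) {a b : ZMod p} (ha : a ≠ 0) (hb : b ≠ 0) (c : ZMod p) :
    ∃ x y, a * x ^ 2 + b * y ^ 2 = c := by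
  have hodd : Fintype.card (ZMod p) % 2 = 1 := by
    rw [ZMod.card]; exact (Fact.out : p.Prime).mod_two_eq_one_iff_ne_two.2 hp
  open Polynomial in
  have := FiniteField.exists_root_sum_quadratic (f := C a * X ^ 2) (g := C b * X ^ 2 - C c) 
    (Polynomial.degree_C_mul_X_pow 2 ha) (by
      rw [sub_eq_add_neg, ← C_neg, Polynomial.degree_add_C (by rw [Polynomial.degree_C_mul_X_pow 2 hb]; norm_num)]
      exact Polynomial.degree_C_mul_X_pow 2 hb) hodd
  obtain ⟨x, y, h⟩ := this
  refine ⟨x, y, ?_⟩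
  simp at h
  linear_combination h

lemma PhiSys.collapse {p : ℕ} [Fact p.Prime] (hp : p ≠ 2) {Q : Type*} [AddCommGroup Q] {φ : ZMod p → Q} (H : PhiSys p Q φ)
    {w : Q} (hw : w ∈ AddSubgroup.closure (Set.range φ)) :
    w = 0 ∨ (∃ a, a ≠ 0 ∧ w = φ a) ∨ (∃ a b, (∀ x y, a * x ^ 2 + b * y ^ 2 = 0 → x = 0 ∧ y = 0) ∧ w = φ a + φ b) := by
  have key : ∀ c (w : Q), (w = 0 ∨ (∃ a, a ≠ 0 ∧ w = φ a) ∨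
      (∃ a b, (∀ x y, a * x ^ 2 + b * y ^ 2 = 0 → x = 0 ∧ y = 0) ∧ w = φ a + φ b)) →
      (φ c + w = 0 ∨ (∃ a, a ≠ 0 ∧ φ c + w = φ a) ∨
      (∃ a b, (∀ x y, a * x ^ 2 + b * y ^ 2 = 0 → x = 0 ∧ y = 0) ∧ φ c + w = φ a + φ b)) := by
    intro c w hw
    by_cases hc : c = 0
    · simpa [hc, H.z] using hw
    rcases hw with rfl | ⟨a, ha, rfl⟩ | ⟨a, b, hab, rfl⟩
    · exact Or.inr (Or.inl ⟨c, hc, by simp⟩)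
    · by_cases h : ∃ x y, c * x ^ 2 + a * y ^ 2 = 0 ∧ (x ≠ 0 ∨ y ≠ 0)
      · obtain ⟨x, y, h, hxy⟩ := h
        exact Or.inl (H.iso hc ha h hxy)
      · push Not at h
        exact Or.inr (Or.inr ⟨c, a, fun x y hxy => h x y hxy, rfl⟩)
    · have ha : a ≠ 0 := by rintro rfl; simpa using hab 1 0
      have hb : b ≠ 0 := by rintro rfl; simpa using hab 0 1
      obtain ⟨x, y, h⟩ := two_squares hp ha hb (-c)
      refine Or.inr (Or.inl ⟨a * b * -c, mul_ne_zero (mul_ne_zero ha hb) (neg_ne_zero.2 hc), ?_⟩)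
      rw [H.rep h (neg_ne_zero.2 hc), H.neg]
      abel
  induction hw using AddSubgroup.closure_induction_left with
  | zero => exact Or.inl rfl
  | add_left x hx y hy ih => obtain ⟨c, rfl⟩ := hx; exact key c _ ih
  | neg_add_cancel x hx y hy ih => obtain ⟨c, rfl⟩ := hx; rw [← H.neg]; exact key (-c) _ ih

/-- a set of good multipliers modulo a subgroup of `W` -/
structure GoodSys (p : ℕ) (A : AddSubgroup W) (g : ℤ → Prop) : Prop where
  mul : ∀ a b, g a → g b → g (a * b)
  small : ∀ r : ℤ, r ≠ 0 → |r| < p → g r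
  ndvd : ∀ a, g a → ¬ (p : ℤ) ∣ a
  mem : ∀ a, g a → cls (a : ℚ) ∈ A
  cong : ∀ a b : ℤ, g a → g b → (a : ZMod p) = b → cls ((p * a : ℤ) : ℚ) - cls ((p * b : ℤ) : ℚ) ∈ A

noncomputable def phi (p : ℕ) (A : AddSubgroup W) (a : ZMod p) : W ⧸ A := QuotientAddGroup.mk (cls ((p * (a.val : ℤ) : ℤ) : ℚ))

lemma val_cast {p : ℕ} [Fact p.Prime] (a : ZMod p) : ((a.val : ℤ) : ZMod p) = a := by simp
lemma val_pos' {p : ℕ} [Fact p.Prime] {a : ZMod p} (ha : a ≠ 0) : (0 : ℤ) < a.val := by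
  have : a.val ≠ 0 := (ZMod.val_ne_zero a).2 ha
  omega

lemma GoodSys.val {p : ℕ} [Fact p.Prime] {A : AddSubgroup W} {g : ℤ → Prop} (H : GoodSys p A g) {a : ZMod p} (ha : a ≠ 0) :
    g (a.val : ℤ) := by
  apply H.small
  · exact (val_pos' ha).ne'
  · rw [abs_of_nonneg (by positivity)]; exact_mod_cast a.val_lt

lemma GoodSys.phi_eq {p : ℕ} [Fact p.Prime] {A : AddSubgroup W} {g : ℤ → Prop} (H : GoodSys p A g) {n : ℤ} (hn : g n) :
    phi p A n = QuotientAddGroup.mk (cls ((p * n : ℤ) : ℚ)) := by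
  symm
  rw [phi, QuotientAddGroup.eq_iff_sub_mem]
  apply H.cong _ _ hn
  · apply H.val
    rw [Ne, ZMod.intCast_zmod_eq_zero_iff_dvd]
    exact H.ndvd _ hn
  · simp

lemma GoodSys.phiSys {p : ℕ} [Fact p.Prime] {A : AddSubgroup W} {g : ℤ → Prop} (H : GoodSys p A g) :
    PhiSys p (W ⧸ A) (phi p A) := by
  have hp0 : (p : ℚ) ≠ 0 := by exact_mod_cast (Fact.out : p.Prime).ne_zero
  have z : phi p A 0 = 0 := by simp [phi, cls_zero]
  have neg : ∀ a, phi p A (-a) = -phi p A a := by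
    intro a
    by_cases ha : a = 0
    · simp [ha, z]
    have h1 := H.phi_eq (n := -(a.val : ℤ)) (by
      apply H.small
      · exact neg_ne_zero.2 (val_pos' ha).ne'
      · rw [abs_neg, abs_of_nonneg (by positivity)]; exact_mod_cast a.val_lt)
    rw [Int.cast_neg, val_cast] at h1
    rw [h1, phi, ← QuotientAddGroup.mk_neg, ← cls_neg]
    congr 2
    push_cast; ring
  refine ⟨z, ?_, neg, ?_⟩
  · intro a c hc
    by_cases ha : a = 0
    · simp [ha]
    have h1 := H.phi_eq (n := (a.val : ℤ) * ((c.val : ℤ) * c.val)) (H.mul _ _ (H.val ha) (H.mul _ _ (H.val hc) (H.val hc)))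
    rw [Int.cast_mul, Int.cast_mul, val_cast, val_cast] at h1
    rw [show a * c ^ 2 = a * (c * c) by ring, h1, phi]
    congr 1
    have := cls_mul_sq (((p * (a.val : ℤ) : ℤ) : ℚ)) ((c.val : ℤ) : ℚ) (by exact_mod_cast (val_pos' hc).ne')
    rw [← this]
    congr 1
    push_cast; ring
  · intro a b
    by_cases ha : a = 0
    · simp [ha, z]
    by_cases hb : b = 0
    · simp [hb, z]
    by_cases hab : a + b = 0
    · rw [hab, mul_zero, z, eq_neg_of_add_eq_zero_right hab, neg, add_neg_cancel, add_zero]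
    obtain ⟨s, hs0, hs1, hs2, hs3⟩ : ∃ s : ℤ, (s : ZMod p) = b ∧ s ≠ 0 ∧ |s| < p ∧ |(a.val : ℤ) + s| < p := by
      have h1 := a.val_lt
      have h2 := b.val_lt
      have h3 : 0 < a.val := by rw [pos_iff_ne_zero]; simpa using ha
      have h4 : 0 < b.val := by rw [pos_iff_ne_zero]; simpa using hb
      by_cases h : a.val + b.val < p
      · refine ⟨b.val, by simp, by omega, ?_, ?_⟩ <;> rw [abs_lt] <;> constructor <;> omega
      · refine ⟨b.val - p, by simp, by omega, ?_, ?_⟩ <;> rw [abs_lt] <;> constructor <;> omega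
    have gs := H.small s hs1 hs2
    have ga := H.val ha
    have has : (((a.val : ℤ) + s : ℤ) : ZMod p) = a + b := by simp [hs0]
    have gas : g ((a.val : ℤ) + s) := H.small _ (by
      intro h; rw [h] at has; simp at has; exact hab has.symm) hs3
    have e1 := H.phi_eq gas
    rw [has] at e1
    have e2 := H.phi_eq gs
    rw [hs0] at e2
    have e3 := H.phi_eq (H.mul _ _ (H.mul _ _ ga gs) gas)
    rw [show (((a.val : ℤ) * s * ((a.val : ℤ) + s) : ℤ) : ZMod p) = a * b * (a + b) by simp [hs0]] at e3
    rw [e1, e2, e3, phi, ← QuotientAddGroup.mk_add, ← QuotientAddGroup.mk_add, cls_add]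
    rw [← cls_mul_sq ((p * ((a.val : ℤ) * s * ((a.val : ℤ) + s)) : ℤ) : ℚ) (p : ℚ) hp0]
    congr 3
    · push_cast; ring_nf
    · push_cast; ring_nf

lemma step_eq (p m n k n' : ℤ) (hp : p ≠ 0) (hm : m ≠ 0) (h : n' = n + p * k) :
    cls ((p * (m * n) : ℤ) : ℚ) - cls ((p * (m * n') : ℤ) : ℚ) = cls ((m * n * k * n' : ℤ) : ℚ) - cls ((m * k : ℤ) : ℚ) := by
  have hp' : (p : ℚ) ≠ 0 := by exact_mod_cast hp
  have hm' : (m : ℚ) ≠ 0 := by exact_mod_cast hm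
  have h1 := cls_add ((p * (m * n) : ℤ) : ℚ) ((m * k : ℤ) * (p : ℚ) ^ 2)
  rw [cls_mul_sq _ _ hp'] at h1
  rw [show ((p * (m * n) : ℤ) : ℚ) + ((m * k : ℤ) * (p : ℚ) ^ 2) = ((p * (m * n') : ℤ) : ℚ) by rw [h]; push_cast; ring,
    show ((p * (m * n) : ℤ) : ℚ) * ((m * k : ℤ) * (p : ℚ) ^ 2) * ((p * (m * n') : ℤ) : ℚ) =
      ((m * n * k * n' : ℤ) : ℚ) * ((m : ℚ) * (p : ℚ) ^ 2) ^ 2 by push_cast; ring,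
    cls_mul_sq _ _ (by positivity)] at h1
  rw [sub_eq_sub_iff_add_eq_add, h1, add_comm]

lemma goodU (p : ℕ) [Fact p.Prime] : GoodSys p (U p) (fun n => ¬ (p : ℤ) ∣ n) where
  mul a b ha hb h := ((Nat.prime_iff_prime_int.1 (Fact.out : p.Prime)).dvd_or_dvd h).elim ha hb
  small r hr h hd := hr (Int.eq_zero_of_abs_lt_dvd hd h)
  ndvd a ha := ha
  mem a ha := cls_mem_U ha
  cong a b ha hb hab := by
    have hpp := Nat.prime_iff_prime_int.1 (Fact.out : p.Prime)
    have key : ∀ n k : ℤ, ¬ (p : ℤ) ∣ n → ¬ (p : ℤ) ∣ k → cls ((p * n : ℤ) : ℚ) - cls ((p * (n + p * k) : ℤ) : ℚ) ∈ U p := by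
      intro n k hn hk
      have := step_eq p 1 n k (n + p * k) hpp.ne_zero one_ne_zero rfl
      simp only [one_mul] at this
      rw [this]
      apply sub_mem
      · apply cls_mem_U
        intro h
        rcases hpp.dvd_or_dvd h with h | h
        · rcases hpp.dvd_or_dvd h with h | h
          · exact hn h
          · exact hk h
        · exact hn ((Int.dvd_add_left (Dvd.intro _ rfl)).1 h)
      · exact cls_mem_U hk
    rw [ZMod.intCast_eq_intCast_iff_dvd_sub] at hab
    obtain ⟨k, hk⟩ := hab
    obtain rfl : b = a + p * k := by linarith
    by_cases hk : (p : ℤ) ∣ k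
    · have h1 := key a 1 ha (fun h => hpp.not_unit (isUnit_of_dvd_one h))
      have h2 := key (a + p * 1) (k - 1) (fun h => ha ((Int.dvd_add_left (Dvd.intro _ rfl)).1 h))
        (fun h => hpp.not_unit (isUnit_of_dvd_one ((Int.dvd_iff_dvd_of_dvd_sub h).1 hk)))
      have h3 := add_mem h1 h2
      rw [sub_add_sub_cancel] at h3
      convert h3 using 4
      ring
    · exact key a k ha hk

end NK

namespace NK
open Matrix

def Smooth (k : ℕ) (n : ℤ) : Prop := n ≠ 0 ∧ ∀ q : ℕ, q.Prime → (q : ℤ) ∣ n → q < k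

lemma Smooth.mul {k : ℕ} {a b : ℤ} (ha : Smooth k a) (hb : Smooth k b) : Smooth k (a * b) :=
  ⟨mul_ne_zero ha.1 hb.1, fun q hq h => ((Nat.prime_iff_prime_int.1 hq).dvd_or_dvd h).elim (ha.2 q hq) (hb.2 q hq)⟩

lemma Smooth.neg {k : ℕ} {a : ℤ} (ha : Smooth k a) : Smooth k (-a) :=
  ⟨neg_ne_zero.2 ha.1, fun q hq h => ha.2 q hq ((dvd_neg).1 h)⟩

lemma Smooth.of_lt {k : ℕ} {r : ℤ} (h0 : r ≠ 0) (h : |r| < k) : Smooth k r :=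
  ⟨h0, fun q _ hd => by
    have := Int.le_of_dvd (abs_pos.2 h0) ((dvd_abs _ _).2 hd)
    omega⟩

lemma Smooth.of_dvd {k : ℕ} {a b : ℤ} (ha : Smooth k a) (h : b ∣ a) : Smooth k b :=
  ⟨fun h0 => ha.1 (by rw [h0] at h; exact zero_dvd_iff.1 h), fun q hq hd => ha.2 q hq (hd.trans h)⟩

noncomputable def Lsub (k : ℕ) : AddSubgroup W := AddSubgroup.closure {w | ∃ n : ℤ, Smooth k n ∧ w = cls (n : ℚ)}

lemma cls_mem_Lsub {k : ℕ} {n : ℤ} (h : Smooth k n) : cls (n : ℚ) ∈ Lsub k := AddSubgroup.subset_closure ⟨n, h, rfl⟩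

lemma Lsub_mono {k l : ℕ} (h : k ≤ l) : Lsub k ≤ Lsub l := AddSubgroup.closure_mono (by
  rintro _ ⟨n, hn, rfl⟩
  exact ⟨n, ⟨hn.1, fun q hq hd => (hn.2 q hq hd).trans_le h⟩, rfl⟩)

lemma Lsub_le_U (p : ℕ) [Fact p.Prime] : Lsub p ≤ U p := by
  refine (AddSubgroup.closure_le _).2 ?_
  rintro _ ⟨n, hn, rfl⟩
  exact cls_mem_U fun h => (lt_irrefl _ (hn.2 p Fact.out h))

lemma step_mem {p : ℕ} [hp : Fact p.Prime] {m n k n' : ℤ} (hm : Smooth p m) (hn : Smooth p n) (hk : Smooth p k)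
    (hn' : Smooth p n') (h : n' = n + p * k) :
    cls ((p * (m * n) : ℤ) : ℚ) - cls ((p * (m * n') : ℤ) : ℚ) ∈ Lsub p := by
  rw [step_eq p m n k n' (by exact_mod_cast hp.out.ne_zero) hm.1 h]
  exact sub_mem (cls_mem_Lsub (((hm.mul hn).mul hk).mul hn')) (cls_mem_Lsub (hm.mul hk))

lemma smooth_cong_nat {p : ℕ} [hp : Fact p.Prime] (n : ℕ) : Smooth p n → ∀ m, Smooth p m → 
    cls ((p * (m * n) : ℤ) : ℚ) - cls ((p * (m * ((n : ZMod p).val : ℤ)) : ℤ) : ℚ) ∈ Lsub p := by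
  induction n using Nat.recOnMul with
  | zero => intro h; exact absurd rfl h.1
  | one => 
    intro _ m _
    have : Fact (1 < p) := ⟨hp.out.one_lt⟩
    rw [Nat.cast_one, Nat.cast_one, ZMod.val_one, Nat.cast_one, sub_self]
    exact zero_mem _
  | prime q hq =>
    intro h m _
    have : q < p := h.2 q hq dvd_rfl
    rw [ZMod.val_natCast_of_lt this, sub_self]
    exact zero_mem _
  | mul a b iha ihb =>
    intro h m hm
    have ha : Smooth p a := h.of_dvd (by push_cast; exact Dvd.intro _ rfl)
    have hb : Smooth p b := h.of_dvd (by push_cast; exact Dvd.intro_left _ rfl)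
    have hnd : ∀ {a : ℕ}, Smooth p a → ((a : ZMod p)) ≠ 0 := fun {a} ha h => by
      rw [ZMod.natCast_eq_zero_iff] at h
      exact lt_irrefl _ (ha.2 p hp.out (by exact_mod_cast h))
    have sv : ∀ {x : ZMod p}, x ≠ 0 → Smooth p (x.val : ℤ) := fun {x} hx => Smooth.of_lt (val_pos' hx).ne' (by
      rw [abs_of_nonneg (by positivity)]; exact_mod_cast x.val_lt)
    have h1 := iha ha (m * b) (hm.mul hb)
    have h2 := ihb hb (m * ((a : ZMod p).val : ℤ)) (hm.mul (sv (hnd ha)))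
    set x := (a : ZMod p).val with hx
    set y := (b : ZMod p).val with hy
    have hxp : x < p := ZMod.val_lt _
    have hyp : y < p := ZMod.val_lt _
    have hv : (((a * b : ℕ) : ZMod p)).val = x * y % p := by
      rw [Nat.cast_mul, ZMod.val_mul]
    have h3 : cls ((p * (m * ((((a * b : ℕ) : ZMod p)).val : ℤ)) : ℤ) : ℚ) - cls ((p * (m * (x * y)) : ℤ) : ℚ) ∈ Lsub p := by
      by_cases hk : x * y / p = 0
      · have : x * y % p = x * y := by have := Nat.mod_add_div (x * y) p; rw [hk] at this; simpa using this
        rw [hv, this]; push_cast; rw [sub_self]; exact zero_mem _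
      · refine step_mem (k := ((x * y / p : ℕ) : ℤ)) hm (sv (hnd h)) ?_ ((sv (hnd ha)).mul (sv (hnd hb))) ?_
        · refine Smooth.of_lt (by exact_mod_cast hk) ?_
          rw [abs_of_nonneg (by positivity)]
          have : x * y / p < p := by
            rw [Nat.div_lt_iff_lt_mul hp.out.pos]
            exact Nat.mul_lt_mul'' hxp hyp
          exact_mod_cast this
        · rw [hv]; exact_mod_cast (Nat.mod_add_div (x * y) p).symm
    have h4 := sub_mem (add_mem h1 h2) h3
    convert h4 using 1
    rw [show (p * (m * b * (x : ℤ)) : ℤ) = p * (m * x * b) by ring, sub_add_sub_cancel,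
      show (p * (m * x * (y : ℤ)) : ℤ) = p * (m * (x * y)) by ring, sub_sub_sub_cancel_right]
    congr 3
    push_cast; ring

lemma smooth_cong {p : ℕ} [hp : Fact p.Prime] (n : ℤ) (h : Smooth p n) : 
    cls ((p * n : ℤ) : ℚ) - cls ((p * ((n : ZMod p).val : ℤ) : ℤ) : ℚ) ∈ Lsub p := by
  have h1 : Smooth p 1 := ⟨one_ne_zero, fun q hq h => by
    exact absurd (isUnit_of_dvd_one h) (Nat.prime_iff_prime_int.1 hq).not_unit⟩
  rcases Int.eq_nat_or_neg n with ⟨a, rfl | rfl⟩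
  · have := smooth_cong_nat a h 1 h1
    simpa using this
  · have ha : Smooth p a := by simpa using h.neg
    have h2 := smooth_cong_nat a ha (-1) h1.neg
    have hnd : (a : ZMod p) ≠ 0 := fun h => by
      rw [ZMod.natCast_eq_zero_iff] at h
      exact lt_irrefl _ (ha.2 p hp.out (by exact_mod_cast h))
    have sv : ∀ {x : ZMod p}, x ≠ 0 → Smooth p (x.val : ℤ) := fun {x} hx => Smooth.of_lt (val_pos' hx).ne' (by
      rw [abs_of_nonneg (by positivity)]; exact_mod_cast x.val_lt)
    have hv : ((-(a : ZMod p)).val : ℤ) = p - (a : ZMod p).val := by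
      have : NeZero (a : ZMod p) := ⟨hnd⟩
      rw [ZMod.val_neg_of_ne_zero]
      have := (a : ZMod p).val_lt
      omega
    have h3 := step_mem (k := 1) h1 (sv hnd).neg h1 (sv (neg_ne_zero.2 hnd)) (by rw [hv]; ring)
    have h4 := add_mem h2 h3
    push_cast at h4 ⊢
    convert h4 using 1
    simp

lemma goodL (p : ℕ) [hp : Fact p.Prime] : GoodSys p (Lsub p) (Smooth p) where
  mul a b ha hb := ha.mul hb
  small r hr h := Smooth.of_lt hr h
  ndvd a ha h := lt_irrefl _ (ha.2 p hp.out h)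
  mem a ha := cls_mem_Lsub ha
  cong a b ha hb hab := by
    have h1 := smooth_cong a ha
    have h2 := smooth_cong b hb
    rw [hab] at h1
    have := sub_mem h1 h2
    rwa [sub_sub_sub_cancel_right] at this

/-- removing the prime `p` from an integer -/
lemma cls_split (p : ℕ) [hp : Fact p.Prime] {a : ℤ} (ha : a ≠ 0) :
    ∃ n : ℤ, n ∣ a ∧ ¬ (p : ℤ) ∣ n ∧ (cls (a : ℚ) = cls (n : ℚ) ∨ cls (a : ℚ) = cls ((p * n : ℤ) : ℚ)) := by
  have hpp := Nat.prime_iff_prime_int.1 hp.out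
  have hfin : FiniteMultiplicity (p : ℤ) a := FiniteMultiplicity.of_not_isUnit hpp.not_unit ha
  obtain ⟨n, h1, h2⟩ := hfin.exists_eq_pow_mul_and_not_dvd
  have hp0 : (p : ℚ) ≠ 0 := by exact_mod_cast hp.out.ne_zero
  refine ⟨n, Dvd.intro_left _ h1.symm, h2, ?_⟩
  rcases Nat.even_or_odd' (multiplicity (p : ℤ) a) with ⟨e, he | he⟩ <;> rw [he] at h1
  · left
    rw [h1, ← cls_mul_sq (n : ℚ) ((p : ℚ) ^ e) (by positivity)]
    push_cast; ring_nf
  · right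
    rw [h1, ← cls_mul_sq ((p * n : ℤ) : ℚ) ((p : ℚ) ^ e) (by positivity)]
    push_cast; ring_nf

lemma Smooth.pred {p : ℕ} {n : ℤ} (h : Smooth (p + 1) n) (hn : ¬ (p : ℤ) ∣ n) : Smooth p n :=
  ⟨h.1, fun q hq hd => lt_of_le_of_ne (Nat.lt_succ_iff.1 (h.2 q hq hd)) (by rintro rfl; exact hn hd)⟩

lemma descent_odd {p : ℕ} [hp : Fact p.Prime] (hp2 : p ≠ 2) {w : W} (h : w ∈ Lsub (p + 1)) (hU : w ∈ U p) : w ∈ Lsub p := by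
  have hg := goodL p
  have hφ := hg.phiSys
  have h1 : (QuotientAddGroup.mk w : W ⧸ Lsub p) ∈ AddSubgroup.closure (Set.range (phi p (Lsub p))) := by
    have h2 : Lsub (p + 1) ≤ (AddSubgroup.closure (Set.range (phi p (Lsub p)))).comap (QuotientAddGroup.mk' (Lsub p)) := by
      refine (AddSubgroup.closure_le _).2 ?_
      rintro _ ⟨a, ha, rfl⟩
      obtain ⟨n, hn, hpn, hc⟩ := cls_split p ha.1
      have hs : Smooth p n := (ha.of_dvd hn).pred hpn
      rcases hc with hc | hc
      · rw [hc]
        change (QuotientAddGroup.mk _ : W ⧸ Lsub p) ∈ AddSubgroup.closure (Set.range (phi p (Lsub p)))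
        rw [(QuotientAddGroup.eq_zero_iff _).2 (cls_mem_Lsub hs)]
        exact zero_mem _
      · rw [hc]
        change (QuotientAddGroup.mk _ : W ⧸ Lsub p) ∈ AddSubgroup.closure (Set.range (phi p (Lsub p)))
        rw [← hg.phi_eq hs]
        exact AddSubgroup.subset_closure ⟨_, rfl⟩
    exact h2 h
  rcases hφ.collapse hp2 h1 with h2 | ⟨a, ha, h2⟩ | ⟨a, b, hab, h2⟩
  · exact (QuotientAddGroup.eq_zero_iff _).1 h2
  · exfalso
    rw [phi, QuotientAddGroup.eq_iff_sub_mem] at h2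
    have h3 := sub_mem hU (Lsub_le_U p h2)
    rw [sub_sub_cancel] at h3
    refine not_mem_U (p := p) one_pos (fun _ => (a.val : ℤ)) ?_ (by simpa using h3)
    intro y hy
    rw [Fin.sum_univ_one, val_cast] at hy
    ext i; fin_cases i
    simpa [ha] using hy
  · exfalso
    rw [phi, phi, ← QuotientAddGroup.mk_add, QuotientAddGroup.eq_iff_sub_mem] at h2
    have h3 := sub_mem hU (Lsub_le_U p h2)
    rw [sub_sub_cancel] at h3
    refine not_mem_U (p := p) two_pos ![(a.val : ℤ), (b.val : ℤ)] ?_ (by simpa [Fin.sum_univ_two] using h3)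
    intro y hy
    rw [Fin.sum_univ_two] at hy
    simp only [Matrix.cons_val_zero, Matrix.cons_val_one, val_cast] at hy
    have := hab _ _ hy
    ext i; fin_cases i
    · exact this.1
    · exact this.2

lemma smooth_two {n : ℤ} (h : Smooth 2 n) : n = 1 ∨ n = -1 := by
  suffices n.natAbs = 1 by omega
  by_contra h1
  obtain ⟨q, hq, hd⟩ := Nat.exists_prime_and_dvd h1
  have := h.2 q hq (Int.natCast_dvd.2 hd)
  have := hq.two_le
  omega

lemma cls_one_mem : cls 1 ∈ Lsub 2 := by
  have : Smooth 2 1 := Smooth.of_lt one_ne_zero (by norm_num)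
  simpa using cls_mem_Lsub this

lemma descent_two {w : W} (h : w ∈ Lsub 3) (hU : w ∈ @U 2 ⟨Nat.prime_two⟩) : w ∈ Lsub 2 := by
  haveI : Fact (Nat.Prime 2) := ⟨Nat.prime_two⟩
  have h2 : cls 2 + cls 2 ∈ Lsub 2 := by
    have := cls_add 1 1
    norm_num at this
    rw [← this]
    exact add_mem cls_one_mem cls_one_mem
  have key : w ∈ Lsub 2 ∨ w - cls 2 ∈ Lsub 2 := by
    have gen : ∀ x ∈ {w | ∃ n : ℤ, Smooth 3 n ∧ w = cls (n : ℚ)}, x ∈ Lsub 2 ∨ x - cls 2 ∈ Lsub 2 := by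
      rintro _ ⟨a, ha, rfl⟩
      obtain ⟨n, hn, hpn, hc⟩ := cls_split 2 ha.1
      have hs : Smooth 2 n := (ha.of_dvd hn).pred hpn
      rcases hc with hc | hc
      · left; rw [hc]; exact cls_mem_Lsub hs
      · right
        rw [hc]
        rcases smooth_two hs with rfl | rfl
        · simp
        · have : cls (((2 : ℕ) * (-1 : ℤ) : ℤ) : ℚ) = -cls 2 := by rw [← cls_neg]; norm_num
          rw [this, ← neg_add']
          exact neg_mem h2
    have comb : ∀ x y, (x ∈ Lsub 2 ∨ x - cls 2 ∈ Lsub 2) → (y ∈ Lsub 2 ∨ y - cls 2 ∈ Lsub 2) →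
        (x + y ∈ Lsub 2 ∨ x + y - cls 2 ∈ Lsub 2) := by
      intro x y hx hy
      rcases hx with hx | hx <;> rcases hy with hy | hy
      · exact Or.inl (add_mem hx hy)
      · right; convert add_mem hx hy using 1; abel
      · right; convert add_mem hx hy using 1; abel
      · left; convert add_mem (add_mem hx hy) h2 using 1; abel
    clear hU
    induction h using AddSubgroup.closure_induction with
    | mem x hx => exact gen x hx
    | zero => exact Or.inl (zero_mem _)
    | add x y _ _ hx hy => exact comb x y hx hy
    | neg x _ hx =>
      rcases hx with hx | hx
      · exact Or.inl (neg_mem hx)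
      · right; convert neg_mem (add_mem hx h2) using 1; abel
  rcases key with h | h
  · exact h
  · exfalso
    have h3 := sub_mem hU (Lsub_le_U 2 h)
    rw [sub_sub_cancel] at h3
    refine not_mem_U (p := 2) one_pos (fun _ => 1) ?_ (by simpa using h3)
    intro y hy
    rw [Fin.sum_univ_one] at hy
    ext i; fin_cases i
    simpa using hy

lemma descent {k : ℕ} (hk : 2 ≤ k) {w : W} (h : w ∈ Lsub (k + 1)) (hU : ∀ (p : ℕ) (hp : Fact p.Prime), w ∈ U p) : w ∈ Lsub k := by
  by_cases hkp : k.Prime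
  · haveI : Fact k.Prime := ⟨hkp⟩
    by_cases h2 : k = 2
    · subst h2; exact descent_two h (hU _ _)
    · exact descent_odd h2 h (hU _ _)
  · refine AddSubgroup.closure_mono ?_ h
    rintro _ ⟨n, hn, rfl⟩
    exact ⟨n, ⟨hn.1, fun q hq hd => lt_of_le_of_ne (Nat.lt_succ_iff.1 (hn.2 q hq hd)) (by rintro rfl; exact hkp hq)⟩, rfl⟩

lemma cls_int_form (a : ℚ) : cls a = cls ((a.num * a.den : ℤ) : ℚ) := by
  have h : (a.den : ℚ) ≠ 0 := by exact_mod_cast a.den_nz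
  rw [← cls_mul_sq a _ h]
  congr 1
  have := Rat.mul_den_eq_num a
  push_cast
  rw [← this]; ring

lemma mem_some_Lsub (w : W) : ∃ k, 2 ≤ k ∧ w ∈ Lsub k := by
  induction w using W.ind with
  | _ X =>
    obtain ⟨v, _, hn, hv⟩ := exists_orth_basis X
    rw [hv]
    let c : Fin X.dim → ℤ := fun i => (X.B (v i) (v i)).num * (X.B (v i) (v i)).den
    refine ⟨2 + ∑ i, ((c i).natAbs + 1), by omega, sum_mem fun i _ => ?_⟩
    rw [cls_int_form]
    refine cls_mem_Lsub (Smooth.of_lt ?_ ?_)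
    · exact mul_ne_zero (Rat.num_ne_zero.2 (hn i)) (by exact_mod_cast Rat.den_nz _)
    · have h1 : (c i).natAbs + 1 ≤ ∑ i, ((c i).natAbs + 1) := Finset.single_le_sum (f := fun i => (c i).natAbs + 1) (fun _ _ => Nat.zero_le _) (Finset.mem_univ i)
      change |c i| < _
      rw [Int.abs_eq_natAbs]
      omega

/-- classes unimodular at every prime are multiples of `⟨1⟩` -/
lemma lemmaW {w : W} (hU : ∀ (p : ℕ) (hp : Fact p.Prime), w ∈ U p) : ∃ σ : ℤ, w = σ • cls 1 := by
  obtain ⟨k, hk, hw⟩ := mem_some_Lsub w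
  have h2 : w ∈ Lsub 2 := by
    induction k, hk using Nat.le_induction with
    | base => exact hw
    | succ k hk ih => exact ih (descent hk hw hU)
  have h3 : Lsub 2 ≤ AddSubgroup.zmultiples (cls 1) := by
    refine (AddSubgroup.closure_le _).2 ?_
    rintro _ ⟨n, hn, rfl⟩
    rcases smooth_two hn with rfl | rfl
    · simp
    · have : cls ((-1 : ℤ) : ℚ) = -cls 1 := by rw [← cls_neg]; norm_num
      rw [this]
      exact neg_mem (AddSubgroup.mem_zmultiples _)
  obtain ⟨σ, h⟩ := AddSubgroup.mem_zmultiples_iff.1 (h3 h2)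
  exact ⟨σ, h.symm⟩

end NK

namespace NK
open Matrix

lemma cls_congr {a b s : ℚ} (hs : s ≠ 0) (h : a = b * s ^ 2) : cls a = cls b := by rw [h, cls_mul_sq _ _ hs]

lemma two_pair {a b : ℤ} (ha : ¬ (2 : ℤ) ∣ a) (hb : ¬ (2 : ℤ) ∣ b) : 
    cls ((2 * a : ℤ) : ℚ) + cls ((2 * b : ℤ) : ℚ) ∈ @U 2 ⟨Nat.prime_two⟩ := by
  haveI : Fact (Nat.Prime 2) := ⟨Nat.prime_two⟩
  have key : ∀ {a b c : ℤ}, ¬ (2 : ℤ) ∣ a → ¬ (2 : ℤ) ∣ b → ¬ (2 : ℤ) ∣ c → a + b = 2 * c →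
      cls ((2 * a : ℤ) : ℚ) + cls ((2 * b : ℤ) : ℚ) ∈ U 2 := by
    intro a b c ha hb hc h
    rw [cls_add]
    have h' : (a : ℚ) + b = 2 * c := by exact_mod_cast h
    have e1 : cls (((2 * a : ℤ) : ℚ) + ((2 * b : ℤ) : ℚ)) = cls (c : ℚ) := by
      apply cls_congr (s := 2) (by norm_num)
      push_cast; linear_combination 2 * h'
    have e2 : cls (((2 * a : ℤ) : ℚ) * ((2 * b : ℤ) : ℚ) * (((2 * a : ℤ) : ℚ) + ((2 * b : ℤ) : ℚ))) = cls ((a * b * c : ℤ) : ℚ) := by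
      apply cls_congr (s := 4) (by norm_num)
      push_cast; linear_combination 8 * a * b * h'
    rw [e1, e2]
    refine add_mem (cls_mem_U (by exact_mod_cast hc)) (cls_mem_U ?_)
    intro h
    have := Int.prime_two
    rcases this.dvd_or_dvd (by exact_mod_cast h) with h | h
    · rcases this.dvd_or_dvd h with h | h
      · exact ha h
      · exact hb h
    · exact hc h
  by_cases hc : (2 : ℤ) ∣ (a + b) / 2
  · have h1 := key (a := -a) (b := b) (c := (b - a) / 2) (by omega) hb (by omega) (by omega)
    have h2 := key (a := b) (b := b) (c := b) hb hb hb (by ring)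
    have h3 := sub_mem h2 h1
    rw [show ((2 * -a : ℤ) : ℚ) = -((2 * a : ℤ) : ℚ) by push_cast; ring, cls_neg] at h3
    convert h3 using 1; abel
  · exact key (c := (a + b) / 2) ha hb hc (by omega)

lemma ndvd_mul {p : ℕ} [hp : Fact p.Prime] {a b : ℤ} (ha : ¬ (p : ℤ) ∣ a) (hb : ¬ (p : ℤ) ∣ b) : ¬ (p : ℤ) ∣ a * b :=
  fun h => ((Nat.prime_iff_prime_int.1 hp.out).dvd_or_dvd h).elim ha hb

lemma quad4 {p : ℕ} [hp : Fact p.Prime] {n x y : ℤ} (hn : ¬ (p : ℤ) ∣ n) (hx : ¬ (p : ℤ) ∣ x) (hy : ¬ (p : ℤ) ∣ y) :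
    cls (p * n : ℚ) + cls (p * (n * x) : ℚ) + (cls (p * (n * y) : ℚ) + cls (p * (n * x * y) : ℚ)) ∈ U p := by
  by_cases h2 : p = 2
  · subst h2
    have h1 := two_pair (a := n) (b := n * x) (by exact_mod_cast hn) (by exact_mod_cast ndvd_mul hn hx)
    have h2 := two_pair (a := n * y) (b := n * x * y) (by exact_mod_cast ndvd_mul hn hy)
      (by exact_mod_cast ndvd_mul (ndvd_mul hn hx) hy)
    have := add_mem h1 h2
    push_cast at this ⊢
    exact this
  · have hg := goodU p
    have H := hg.phiSys
    have nz : ∀ {a : ℤ}, ¬ (p : ℤ) ∣ a → (a : ZMod p) ≠ 0 := fun {a} h => by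
      rwa [Ne, ZMod.intCast_zmod_eq_zero_iff_dvd]
    have e1 := hg.phi_eq hn
    have e2 := hg.phi_eq (ndvd_mul hn hx)
    have e3 := hg.phi_eq (ndvd_mul hn hy)
    have e4 := hg.phi_eq (ndvd_mul (ndvd_mul hn hx) hy)
    push_cast at e1 e2 e3 e4
    rw [← QuotientAddGroup.eq_zero_iff, QuotientAddGroup.mk_add, QuotientAddGroup.mk_add, QuotientAddGroup.mk_add,
      ← e1, ← e2, ← e3, ← e4]
    obtain ⟨s, t, hst⟩ := two_squares h2 (a := (1 : ZMod p)) (b := (x : ZMod p)) one_ne_zero (nz hx) (-y)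
    have := H.rep (a := (n : ZMod p)) (b := n * x) (x := s) (y := t) (t := -(n * y)) (by linear_combination (n : ZMod p) * hst)
      (neg_ne_zero.2 (mul_ne_zero (nz hn) (nz hy)))
    rw [this, H.neg, show (n : ZMod p) * (n * x) * -(n * y) = -((n * x * y) * n ^ 2) by ring, H.neg, H.sq _ _ (nz hn)]
    abel

noncomputable def pf (a b c d : ℚ) : W := cls a + cls b + cls c + cls d + cls (a * b * c) + cls (a * b * d) + cls (a * c * d) + cls (b * c * d)

lemma pf_swap1 (a b c d : ℚ) : pf a b c d = pf b a c d := by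
  unfold pf
  rw [mul_comm b a]
  abel

lemma pf_swap2 (a b c d : ℚ) : pf a b c d = pf a c b d := by
  unfold pf
  rw [mul_right_comm a c b, mul_comm c b]
  abel

lemma pf_swap3 (a b c d : ℚ) : pf a b c d = pf a b d c := by
  unfold pf
  rw [mul_right_comm a d c, mul_right_comm b d c]
  abel

lemma pf_sq1 (a b c d s : ℚ) (hs : s ≠ 0) : pf (a * s ^ 2) b c d = pf a b c d := by
  unfold pf
  rw [cls_congr hs (a := a * s ^ 2) (b := a) rfl, cls_congr hs (a := a * s ^ 2 * b * c) (b := a * b * c) (by ring),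
    cls_congr hs (a := a * s ^ 2 * b * d) (b := a * b * d) (by ring),
    cls_congr hs (a := a * s ^ 2 * c * d) (b := a * c * d) (by ring)]

lemma pf_sq2 (a b c d s : ℚ) (hs : s ≠ 0) : pf a (b * s ^ 2) c d = pf a b c d := by
  rw [pf_swap1, pf_sq1 _ _ _ _ _ hs, pf_swap1]
lemma pf_sq3 (a b c d s : ℚ) (hs : s ≠ 0) : pf a b (c * s ^ 2) d = pf a b c d := by
  rw [pf_swap2, pf_sq2 _ _ _ _ _ hs, pf_swap2]
lemma pf_sq4 (a b c d s : ℚ) (hs : s ≠ 0) : pf a b c (d * s ^ 2) = pf a b c d := by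
  rw [pf_swap3, pf_sq3 _ _ _ _ _ hs, pf_swap3]

section
variable {p : ℕ} [hp : Fact p.Prime] {a b c d : ℤ}

lemma u3 (ha : ¬ (p : ℤ) ∣ a) (hb : ¬ (p : ℤ) ∣ b) (hc : ¬ (p : ℤ) ∣ c) (hd : ¬ (p : ℤ) ∣ d) : cls (a * b * c : ℚ) ∈ U p := by
  have := cls_mem_U (ndvd_mul (ndvd_mul ha hb) hc)
  push_cast at this
  exact this

lemma pf0 (ha : ¬ (p : ℤ) ∣ a) (hb : ¬ (p : ℤ) ∣ b) (hc : ¬ (p : ℤ) ∣ c) (hd : ¬ (p : ℤ) ∣ d) : pf a b c d ∈ U p :=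
  add_mem (add_mem (add_mem (add_mem (add_mem (add_mem (add_mem (cls_mem_U ha) (cls_mem_U hb)) (cls_mem_U hc)) (cls_mem_U hd))
    (u3 ha hb hc hd)) (u3 ha hb hd hc)) (u3 ha hc hd hb)) (u3 hb hc hd ha)

lemma pf1 (ha : ¬ (p : ℤ) ∣ a) (hb : ¬ (p : ℤ) ∣ b) (hc : ¬ (p : ℤ) ∣ c) (hd : ¬ (p : ℤ) ∣ d) : pf (p * a) b c d ∈ U p := by
  have h1 := quad4 ha (ndvd_mul hb hc) (ndvd_mul hb hd)
  have hb0 : (b : ℚ) ≠ 0 := by rintro h; apply hb; rw [show b = 0 by exact_mod_cast h]; simp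
  have h2 := add_mem (add_mem (add_mem (add_mem h1 (cls_mem_U hb)) (cls_mem_U hc)) (cls_mem_U hd)) (u3 hb hc hd ha)
  push_cast at h2
  rw [cls_congr hb0 (a := (p * (a * (b * c) * (b * d)) : ℚ)) (b := p * a * c * d) (by ring)] at h2
  convert h2 using 1
  unfold pf
  simp only [mul_assoc]
  abel

lemma pf2 (ha : ¬ (p : ℤ) ∣ a) (hb : ¬ (p : ℤ) ∣ b) (hc : ¬ (p : ℤ) ∣ c) (hd : ¬ (p : ℤ) ∣ d) : pf (p * a) (p * b) c d ∈ U p := by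
  have h1 := quad4 ha (ndvd_mul ha hb) (ndvd_mul hc hd)
  have ha0 : (a : ℚ) ≠ 0 := by rintro h; apply ha; rw [show a = 0 by exact_mod_cast h]; simp
  have hp0 : (p : ℚ) ≠ 0 := by exact_mod_cast hp.out.ne_zero
  have h2 := add_mem (add_mem (add_mem (add_mem h1 (cls_mem_U hc)) (cls_mem_U hd)) (u3 ha hb hc hd)) (u3 ha hb hd hc)
  push_cast at h2
  rw [cls_congr ha0 (a := (p * (a * (a * b)) : ℚ)) (b := p * b) (by ring),
    cls_congr ha0 (a := (p * (a * (a * b) * (c * d)) : ℚ)) (b := p * b * c * d) (by ring),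
    ← cls_congr hp0 (b := (a * b * c : ℚ)) (a := p * a * (p * b) * c) (by ring),
    ← cls_congr hp0 (b := (a * b * d : ℚ)) (a := p * a * (p * b) * d) (by ring)] at h2
  convert h2 using 1
  unfold pf
  simp only [mul_assoc]
  abel

lemma pf3 (ha : ¬ (p : ℤ) ∣ a) (hb : ¬ (p : ℤ) ∣ b) (hc : ¬ (p : ℤ) ∣ c) (hd : ¬ (p : ℤ) ∣ d) : pf (p * a) (p * b) (p * c) d ∈ U p := by
  have h1 := quad4 ha (ndvd_mul ha hb) (ndvd_mul ha hc)
  have ha0 : (a : ℚ) ≠ 0 := by rintro h; apply ha; rw [show a = 0 by exact_mod_cast h]; simp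
  have hp0 : (p : ℚ) ≠ 0 := by exact_mod_cast hp.out.ne_zero
  have h2 := add_mem (add_mem (add_mem (add_mem h1 (cls_mem_U hd)) (u3 ha hb hd hc)) (u3 ha hc hd hb)) (u3 hb hc hd ha)
  push_cast at h2
  rw [cls_congr ha0 (a := (p * (a * (a * b)) : ℚ)) (b := p * b) (by ring),
    cls_congr ha0 (a := (p * (a * (a * c)) : ℚ)) (b := p * c) (by ring),
    cls_congr ha0 (a := (p * (a * (a * b) * (a * c)) : ℚ)) (b := p * a * b * c) (by ring),
    ← cls_congr hp0 (b := (p * a * b * c : ℚ)) (a := p * a * (p * b) * (p * c)) (by ring),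
    ← cls_congr hp0 (b := (a * b * d : ℚ)) (a := p * a * (p * b) * d) (by ring),
    ← cls_congr hp0 (b := (a * c * d : ℚ)) (a := p * a * (p * c) * d) (by ring),
    ← cls_congr hp0 (b := (b * c * d : ℚ)) (a := p * b * (p * c) * d) (by ring)] at h2
  convert h2 using 1
  unfold pf
  simp only [mul_assoc]
  abel

lemma pf4 (ha : ¬ (p : ℤ) ∣ a) (hb : ¬ (p : ℤ) ∣ b) (hc : ¬ (p : ℤ) ∣ c) (hd : ¬ (p : ℤ) ∣ d) : pf (p * a) (p * b) (p * c) (p * d) ∈ U p := by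
  have h1 := quad4 ha (ndvd_mul ha hb) (ndvd_mul ha hc)
  have h1' := quad4 hd (ndvd_mul ha hb) (ndvd_mul ha hc)
  have ha0 : (a : ℚ) ≠ 0 := by rintro h; apply ha; rw [show a = 0 by exact_mod_cast h]; simp
  have hp0 : (p : ℚ) ≠ 0 := by exact_mod_cast hp.out.ne_zero
  have h2 := add_mem h1 h1'
  push_cast at h2
  rw [cls_congr ha0 (a := (p * (a * (a * b)) : ℚ)) (b := p * b) (by ring),
    cls_congr ha0 (a := (p * (a * (a * c)) : ℚ)) (b := p * c) (by ring),
    cls_congr ha0 (a := (p * (a * (a * b) * (a * c)) : ℚ)) (b := p * a * b * c) (by ring),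
    ← cls_congr hp0 (b := (p * a * b * c : ℚ)) (a := p * a * (p * b) * (p * c)) (by ring),
    ← cls_congr hp0 (b := (p * (d * (a * b)) : ℚ)) (a := p * a * (p * b) * (p * d)) (by ring),
    ← cls_congr hp0 (b := (p * (d * (a * c)) : ℚ)) (a := p * a * (p * c) * (p * d)) (by ring),
    cls_congr ha0 (a := (p * (d * (a * b) * (a * c)) : ℚ)) (b := p * (d * b * c)) (by ring),
    ← cls_congr hp0 (b := (p * (d * b * c) : ℚ)) (a := p * b * (p * c) * (p * d)) (by ring)] at h2
  convert h2 using 1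
  unfold pf
  simp only [mul_assoc]
  abel
end

lemma int_split (p : ℕ) [hp : Fact p.Prime] {a : ℤ} (ha : a ≠ 0) :
    ∃ (n : ℤ) (s : ℚ), s ≠ 0 ∧ ¬ (p : ℤ) ∣ n ∧ ((a : ℚ) = n * s ^ 2 ∨ (a : ℚ) = p * n * s ^ 2) := by
  have hpp := Nat.prime_iff_prime_int.1 hp.out
  have hfin : FiniteMultiplicity (p : ℤ) a := FiniteMultiplicity.of_not_isUnit hpp.not_unit ha
  obtain ⟨n, h1, h2⟩ := hfin.exists_eq_pow_mul_and_not_dvd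
  have hp0 : (p : ℚ) ≠ 0 := by exact_mod_cast hp.out.ne_zero
  rcases Nat.even_or_odd' (multiplicity (p : ℤ) a) with ⟨e, he | he⟩ <;> rw [he] at h1
  · refine ⟨n, (p : ℚ) ^ e, by positivity, h2, Or.inl ?_⟩
    rw [h1]
    push_cast; ring_nf
  · refine ⟨n, (p : ℚ) ^ e, by positivity, h2, Or.inr ?_⟩
    rw [h1]
    push_cast; ring_nf

lemma pf_mem_U (p : ℕ) [hp : Fact p.Prime] {a b c d : ℤ} (ha : a ≠ 0) (hb : b ≠ 0) (hc : c ≠ 0) (hd : d ≠ 0) :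
    pf a b c d ∈ U p := by
  obtain ⟨a', s, hs, ha', ha⟩ := int_split p ha
  obtain ⟨b', t, ht, hb', hb⟩ := int_split p hb
  obtain ⟨c', u, hu, hc', hc⟩ := int_split p hc
  obtain ⟨d', v, hv, hd', hd⟩ := int_split p hd
  rcases ha with ha | ha <;> rcases hb with hb | hb <;> rcases hc with hc | hc <;> rcases hd with hd | hd <;>
    rw [ha, hb, hc, hd, pf_sq1 _ _ _ _ _ hs, pf_sq2 _ _ _ _ _ ht, pf_sq3 _ _ _ _ _ hu, pf_sq4 _ _ _ _ _ hv]
  · exact pf0 ha' hb' hc' hd'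
  · rw [pf_swap3, pf_swap2, pf_swap1]; exact pf1 hd' ha' hb' hc'
  · rw [pf_swap2, pf_swap1]; exact pf1 hc' ha' hb' hd'
  · rw [pf_swap2, pf_swap1, pf_swap3, pf_swap2]; exact pf2 hc' hd' ha' hb'
  · rw [pf_swap1]; exact pf1 hb' ha' hc' hd'
  · rw [pf_swap1, pf_swap3, pf_swap2]; exact pf2 hb' hd' ha' hc'
  · rw [pf_swap1, pf_swap2]; exact pf2 hb' hc' ha' hd'
  · rw [pf_swap1, pf_swap2, pf_swap3]; exact pf3 hb' hc' hd' ha'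
  · exact pf1 ha' hb' hc' hd'
  · rw [pf_swap3, pf_swap2]; exact pf2 ha' hd' hb' hc'
  · rw [pf_swap2]; exact pf2 ha' hc' hb' hd'
  · rw [pf_swap2, pf_swap3]; exact pf3 ha' hc' hd' hb'
  · exact pf2 ha' hb' hc' hd'
  · rw [pf_swap3]; exact pf3 ha' hb' hd' hc'
  · exact pf3 ha' hb' hc' hd'
  · exact pf4 ha' hb' hc' hd'

lemma SigRep.nsmul (k : ℕ) : SigRep k 0 (k • cls 1) := by
  induction k with
  | zero => simpa using SigRep.zero
  | succ k ih => rw [succ_nsmul]; exact ih.add (SigRep.pos one_pos)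

lemma SigRep.nsmul_neg (k : ℕ) : SigRep 0 k (-(k • cls 1)) := by
  induction k with
  | zero => simpa using SigRep.zero
  | succ k ih => 
    rw [succ_nsmul, neg_add, ← cls_neg]; exact ih.add (SigRep.neg (by norm_num))

/-- determination of the multiple of `⟨1⟩` by the signature -/
lemma sig_of_zsmul {p q : ℕ} {σ : ℤ} (h : SigRep p q (σ • cls 1)) : σ = p - q := by
  rcases Int.eq_nat_or_neg σ with ⟨k, rfl | rfl⟩
  · rw [natCast_zsmul] at h
    have h1 := h.le (SigRep.nsmul k)
    have h2 := (SigRep.nsmul k).le h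
    omega
  · rw [neg_smul, natCast_zsmul] at h
    have h1 := h.le (SigRep.nsmul_neg k)
    have h2 := (SigRep.nsmul_neg k).le h
    omega

lemma pf_eq_int {a b c d : ℤ} (ha : 0 < a) (hb : 0 < b) (hc : 0 < c) (hd : 0 < d) : pf a b c d = 8 • cls 1 := by
  obtain ⟨σ, h⟩ := lemmaW (w := pf a b c d) (fun p hp => pf_mem_U p ha.ne' hb.ne' hc.ne' hd.ne')
  have ha : (0 : ℚ) < a := by exact_mod_cast ha
  have hb : (0 : ℚ) < b := by exact_mod_cast hb
  have hc : (0 : ℚ) < c := by exact_mod_cast hc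
  have hd : (0 : ℚ) < d := by exact_mod_cast hd
  have h1 : SigRep (1 + 1 + 1 + 1 + 1 + 1 + 1 + 1) (0 + 0 + 0 + 0 + 0 + 0 + 0 + 0) (pf a b c d) :=
    ((((((((SigRep.pos ha).add (SigRep.pos hb)).add (SigRep.pos hc)).add (SigRep.pos hd)).add (SigRep.pos (by positivity))).add
    (SigRep.pos (by positivity))).add (SigRep.pos (by positivity))).add (SigRep.pos (by positivity)))
  rw [h] at h1
  have := sig_of_zsmul h1
  rw [h, show σ = ((8 : ℕ) : ℤ) by omega, natCast_zsmul]

lemma pf_eq {a b c d : ℚ} (ha : 0 < a) (hb : 0 < b) (hc : 0 < c) (hd : 0 < d) : pf a b c d = 8 • cls 1 := by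
  have key : ∀ {a : ℚ}, 0 < a → ∃ (n : ℤ) (s : ℚ), 0 < n ∧ s ≠ 0 ∧ a = n * s ^ 2 := by
    intro a ha
    have h : (a.den : ℚ) ≠ 0 := by exact_mod_cast a.den_nz
    refine ⟨a.num * a.den, (a.den : ℚ)⁻¹, mul_pos (Rat.num_pos.2 ha) (by exact_mod_cast a.den_pos), inv_ne_zero h, ?_⟩
    have := Rat.mul_den_eq_num a
    push_cast
    rw [← this]; field_simp
  obtain ⟨a', s, ha', hs, rfl⟩ := key ha
  obtain ⟨b', t, hb', ht, rfl⟩ := key hb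
  obtain ⟨c', u, hc', hu, rfl⟩ := key hc
  obtain ⟨d', v, hd', hv, rfl⟩ := key hd
  rw [pf_sq1 _ _ _ _ _ hs, pf_sq2 _ _ _ _ _ ht, pf_sq3 _ _ _ _ _ hu, pf_sq4 _ _ _ _ _ hv, pf_eq_int ha' hb' hc' hd']

/-- four positive entries can be traded -/
lemma pfister_rep {a b c d : ℚ} (ha : 0 < a) (hb : 0 < b) (hc : 0 < c) (hd : 0 < d) :
    Rep 4 (8 • cls 1 - (cls a + cls b + cls c + cls d)) := by
  rw [← pf_eq ha hb hc hd]
  have h1 := (((Rep.cls (a := a * b * c) (by positivity)).add (Rep.cls (a := a * b * d) (by positivity))).add 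
    (Rep.cls (a := a * c * d) (by positivity))).add (Rep.cls (a := b * c * d) (by positivity))
  convert h1 using 1
  unfold pf
  abel

end NK

namespace NK
open Matrix

lemma equiv_wss {n : ℕ} (A P : Matrix (Fin n) (Fin n) ℝ) (w : Fin n → ℝ) (hP : P.det ≠ 0) (h : Pᵀ * A * P = diagonal w) :
    QuadraticMap.Equivalent (Matrix.toQuadraticMap' A) (QuadraticMap.weightedSumSquares ℝ w) := by
  have hu : IsUnit P.det := hP.isUnit
  symm
  refine ⟨⟨Matrix.toLinearEquiv' P (P.invertibleOfIsUnitDet hu), ?_⟩⟩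
  intro x
  change LinearMap.BilinMap.toQuadraticMap (Matrix.toLinearMap₂' ℝ A) (P *ᵥ x) = _
  rw [LinearMap.BilinMap.toQuadraticMap_apply, Matrix.toLinearMap₂'_apply', QuadraticMap.weightedSumSquares_apply]
  have : (P *ᵥ x) ⬝ᵥ A *ᵥ P *ᵥ x = x ⬝ᵥ (Pᵀ * A * P) *ᵥ x := by
    rw [← mulVec_mulVec, ← mulVec_mulVec, dotProduct_mulVec x Pᵀ, vecMul_transpose]
  rw [this, h]
  simp only [dotProduct, mulVec_diagonal, smul_eq_mul]
  refine Finset.sum_congr rfl fun i _ => by ring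

lemma counts_eq {n : ℕ} {A P P' : Matrix (Fin n) (Fin n) ℝ} {w w' : Fin n → ℝ} (hP : P.det ≠ 0) (h : Pᵀ * A * P = diagonal w)
    (hP' : P'.det ≠ 0) (h' : P'ᵀ * A * P' = diagonal w') :
    {i | 0 < w i}.ncard = {i | 0 < w' i}.ncard ∧ {i | w i < 0}.ncard = {i | w' i < 0}.ncard := by
  have h1 := equiv_wss A P w hP h
  have h2 := equiv_wss A P' w' hP' h'
  exact ⟨(QuadraticForm.sigPos_of_equiv_weightedSumSquares h1).symm.trans (QuadraticForm.sigPos_of_equiv_weightedSumSquares h2),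
    (QuadraticForm.sigNeg_of_equiv_weightedSumSquares h1).symm.trans (QuadraticForm.sigNeg_of_equiv_weightedSumSquares h2)⟩

lemma rat_diag {n : ℕ} (G : Matrix (Fin n) (Fin n) ℤ) (hs : G.IsSymm) (hd : G.det ≠ 0) :
    ∃ (P : Matrix (Fin n) (Fin n) ℚ) (a : Fin n → ℚ), P.det ≠ 0 ∧ (∀ i, a i ≠ 0) ∧
      Pᵀ * (G.map (Int.cast : ℤ → ℚ)) * P = diagonal a ∧ W.mk (zObj G hs hd) = ∑ i, cls (a i) := by
  obtain ⟨v, h1, h2, h3⟩ := exists_orth_basis (zObj G hs hd)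
  have hdim : (zObj G hs hd).dim = n := by rw [zObj_dim, Fintype.card_fin]
  let e : Fin n ≃ Fin (zObj G hs hd).dim := finCongr hdim.symm
  let f : Fin n → Fin n → ℚ := fun j => v (e j)
  let P : Matrix (Fin n) (Fin n) ℚ := Matrix.of fun i j => f j i
  have hPG : ∀ i j, (Pᵀ * (G.map (Int.cast : ℤ → ℚ)) * P) i j = f i ⬝ᵥ (G.map (Int.cast : ℤ → ℚ)) *ᵥ f j := by
    intro i j
    rw [Matrix.mul_assoc, Matrix.mul_apply_eq_vecMul, vecMul_eq_sum]
    simp only [dotProduct, Finset.sum_apply, Pi.smul_apply, smul_eq_mul]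
    rfl
  have hB : ∀ i j, (zObj G hs hd).B (v (e i)) (v (e j)) = f i ⬝ᵥ (G.map (Int.cast : ℤ → ℚ)) *ᵥ f j := fun i j => mform_apply _ (f i) (f j)
  have hPd : Pᵀ * (G.map (Int.cast : ℤ → ℚ)) * P = diagonal fun i => (zObj G hs hd).B (v (e i)) (v (e i)) := by
    ext i j
    rw [hPG, ← hB]
    by_cases hij : i = j
    · subst hij; rw [diagonal_apply_eq]
    · rw [diagonal_apply_ne _ hij, h1 _ _ (fun h => hij (e.injective h))]
  refine ⟨P, fun i => (zObj G hs hd).B (v (e i)) (v (e i)), ?_, fun i => h2 _, hPd, ?_⟩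
  · have h4 := congrArg Matrix.det hPd
    rw [det_mul, det_diagonal] at h4
    intro h5
    rw [h5, mul_zero] at h4
    exact Finset.prod_ne_zero_iff.2 (fun i _ => h2 (e i)) h4.symm
  · rw [h3]
    exact (Equiv.sum_comp e fun i => cls ((zObj G hs hd).B (v i) (v i))).symm

lemma inertia {n : ℕ} (G : Matrix (Fin n) (Fin n) ℤ) (hs : G.IsSymm) (hd : G.det ≠ 0) :
    ∃ (a : Fin n → ℚ), (∀ i, a i ≠ 0) ∧ W.mk (zObj G hs hd) = ∑ i, cls (a i) ∧
      (Finset.univ.filter fun i => 0 < a i).card = sigPlus G ∧ (Finset.univ.filter fun i => a i < 0).card = sigMinus G := by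
  obtain ⟨P, a, hP, ha, h1, h2⟩ := rat_diag G hs hd
  refine ⟨a, ha, h2, ?_⟩
  have hH : (G.map ((↑·) : ℤ → ℝ)).IsHermitian := by
    ext i j
    simp only [conjTranspose_apply, map_apply, star_trivial]
    rw [hs.apply]
  rw [sigPlus, sigMinus, dif_pos hH, dif_pos hH]
  have hreal : (P.map (Rat.cast : ℚ → ℝ))ᵀ * (G.map ((↑·) : ℤ → ℝ)) * (P.map (Rat.cast : ℚ → ℝ)) = diagonal fun i => (a i : ℝ) := by
    have h3 := congrArg (fun X => X.map (Rat.castHom ℝ)) h1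
    rw [Matrix.map_mul, Matrix.map_mul, diagonal_map (by simp), transpose_map] at h3
    have h4 : (G.map (Int.cast : ℤ → ℚ)).map (Rat.castHom ℝ) = G.map ((↑·) : ℤ → ℝ) := by ext i j; simp
    rw [h4] at h3
    exact h3
  have hPd : (P.map (Rat.cast : ℚ → ℝ)).det ≠ 0 := by
    have : (P.map (Rat.cast : ℚ → ℝ)).det = ((P.det : ℚ) : ℝ) := (RingHom.map_det (Rat.castHom ℝ) P).symm
    rw [this]; exact_mod_cast hP
  let O : Matrix (Fin n) (Fin n) ℝ := hH.eigenvectorUnitary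
  have hO : star O * O = 1 := Unitary.coe_star_mul_self hH.eigenvectorUnitary
  have hOd : O.det ≠ 0 := by
    intro h
    have := congrArg Matrix.det hO
    rw [det_mul, h, mul_zero, det_one] at this
    exact zero_ne_one this
  have hOA : Oᵀ * (G.map ((↑·) : ℤ → ℝ)) * O = diagonal hH.eigenvalues := by
    have h4 := hH.conjStarAlgAut_star_eigenvectorUnitary
    rw [Unitary.conjStarAlgAut_apply] at h4
    simpa [star_eq_conjTranspose, conjTranspose_eq_transpose_of_trivial] using h4
  obtain ⟨c1, c2⟩ := counts_eq hPd hreal hOd hOA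
  change _ = Nat.card ({i | 0 < hH.eigenvalues i} : Set (Fin n)) ∧ _ = Nat.card ({i | hH.eigenvalues i < 0} : Set (Fin n))
  rw [Nat.card_coe_set_eq {i | 0 < hH.eigenvalues i}, Nat.card_coe_set_eq {i | hH.eigenvalues i < 0}, ← c1, ← c2,
    ← Set.ncard_coe_finset, ← Set.ncard_coe_finset]
  constructor <;> congr 1 <;> ext i <;> simp

lemma sig_add {n : ℕ} (G : Matrix (Fin n) (Fin n) ℤ) (hs : G.IsSymm) (hd : G.det ≠ 0) : sigPlus G + sigMinus G = n := by
  obtain ⟨a, ha, _, h1, h2⟩ := inertia G hs hd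
  rw [← h1, ← h2, ← Finset.card_union_of_disjoint]
  · rw [← Finset.filter_or, Finset.filter_true_of_mem]
    · simp
    · intro i _
      exact (lt_or_gt_of_ne (ha i)).symm
  · rw [Finset.disjoint_filter]
    intro i _ h; exact not_lt.2 h.le

lemma sigRep_zObj {n : ℕ} (G : Matrix (Fin n) (Fin n) ℤ) (hs : G.IsSymm) (hd : G.det ≠ 0) :
    SigRep (sigPlus G) (sigMinus G) (W.mk (zObj G hs hd)) := by
  obtain ⟨a, ha, h0, h1, h2⟩ := inertia G hs hd
  rw [h0, ← h1, ← h2]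
  exact SigRep.sum _ _ fun i _ => ha i

end NK

namespace NK
open Matrix

lemma uni_mem_U {n : ℕ} (G : Matrix (Fin n) (Fin n) ℤ) (hs : G.IsSymm) (hu : IsUnit G.det) (p : ℕ) [hp : Fact p.Prime] :
    W.mk (zObj G hs hu.ne_zero) ∈ U p :=
  uset_of G hs hu.ne_zero fun h => (Nat.prime_iff_prime_int.1 hp.out).not_unit (isUnit_of_dvd_unit h hu)

lemma uni_class {n : ℕ} (G : Matrix (Fin n) (Fin n) ℤ) (hs : G.IsSymm) (hu : IsUnit G.det) :
    W.mk (zObj G hs hu.ne_zero) = ((sigPlus G : ℤ) - sigMinus G) • cls 1 := by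
  obtain ⟨σ, h⟩ := lemmaW (fun p hp => uni_mem_U G hs hu p)
  have h1 := sigRep_zObj G hs hu.ne_zero
  rw [h] at h1 ⊢
  rw [sig_of_zsmul h1]

lemma det_negone_ne {κ : Type} [Fintype κ] [DecidableEq κ] : (-1 : Matrix κ κ ℤ).det ≠ 0 := by
  rw [det_neg, det_one, mul_one]; exact pow_ne_zero _ (by norm_num)

lemma zObj_negone {κ : Type} [Fintype κ] [DecidableEq κ] (hs) (hd) :
    W.mk (zObj (-1 : Matrix κ κ ℤ) hs hd) = -(Fintype.card κ • cls 1) := by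
  let e := Fintype.equivFin κ
  have h1 : (-1 : Matrix κ κ ℤ).submatrix e.symm e.symm = diagonal fun _ => -1 := by
    rw [submatrix_neg]
    simp only [Pi.neg_apply]
    rw [submatrix_one_equiv, ← diagonal_one, diagonal_neg]
  have hs2 := hs.submatrix e.symm
  have hd2 : ((-1 : Matrix κ κ ℤ).submatrix e.symm e.symm).det ≠ 0 := by rwa [det_submatrix_equiv_self]
  rw [← zObj_reindex e _ hs hd hs2 hd2]
  simp only [h1]
  rw [zObj_diag]
  simp only [Int.cast_neg, Int.cast_one, cls_neg]
  simp

lemma fb_dot {n : ℕ} {κ : Type} [Fintype κ] [DecidableEq κ] (G : Matrix (Fin n) (Fin n) ℤ) (x y : Fin n ⊕ κ → ℤ) :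
    x ⬝ᵥ (fromBlocks G 0 0 (-1 : Matrix κ κ ℤ)) *ᵥ y = (x ∘ Sum.inl) ⬝ᵥ G *ᵥ (y ∘ Sum.inl) - (x ∘ Sum.inr) ⬝ᵥ (y ∘ Sum.inr) := by
  rw [fromBlocks_mulVec]
  simp only [zero_mulVec, add_zero, zero_add, neg_mulVec, one_mulVec]
  simp only [dotProduct, Fintype.sum_sum_type, Sum.elim_inl, Sum.elim_inr, Pi.neg_apply, Function.comp, mul_neg, Finset.sum_neg_distrib]
  ring

lemma lagr_mod {n : ℕ} {κ : Type} [Fintype κ] [DecidableEq κ] (G : Matrix (Fin n) (Fin n) ℤ) (hs : G.IsSymm) (hu : IsUnit G.det)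
    (h : W.mk (zObj G hs hu.ne_zero) = Fintype.card κ • cls 1) (p : ℕ) [Fact p.Prime] :
    ∃ (Λ : Set ((Fin n → ℤ) × (κ → ℤ))) (N : Submodule (ZMod p) ((Fin n → ZMod p) × (κ → ZMod p))),
      (∀ z ∈ Λ, ∀ z' ∈ Λ, z.1 ⬝ᵥ G *ᵥ z'.1 = z.2 ⬝ᵥ z'.2) ∧ n + Fintype.card κ ≤ 2 * Module.finrank (ZMod p) N ∧
      (∀ zb ∈ N, ∃ z ∈ Λ, cv (ZMod p) z.1 = zb.1 ∧ cv (ZMod p) z.2 = zb.2) := by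
  have hd3 : (fromBlocks G 0 0 (-1 : Matrix κ κ ℤ)).det ≠ 0 := by
    rw [det_fromBlocks_zero₂₁]; exact mul_ne_zero hu.ne_zero det_negone_ne
  have hs2 : (-1 : Matrix κ κ ℤ).IsSymm := isSymm_one.neg
  have hs3 : (fromBlocks G 0 0 (-1 : Matrix κ κ ℤ)).IsSymm := by
    rw [IsSymm, fromBlocks_transpose, hs.eq, hs2.eq, transpose_zero, transpose_zero]
  have hm : (zObj _ hs3 hd3).Met := by
    rw [← W.mk_eq_zero, zObj_blocks G hs hu.ne_zero _ hs2 det_negone_ne, h, zObj_negone, add_neg_cancel]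
  obtain ⟨N, hN, hNd⟩ := hm
  change Submodule ℚ (Fin n ⊕ κ → ℚ) at N
  rw [zObj_dim, Fintype.card_sum, Fintype.card_fin] at hNd
  change _ ≤ 2 * Module.finrank ℚ N at hNd
  obtain ⟨Nb, h1, h2⟩ := reduce p N
  let e : (Fin n ⊕ κ → ZMod p) ≃ₗ[ZMod p] ((Fin n → ZMod p) × (κ → ZMod p)) := LinearEquiv.sumArrowLequivProdArrow _ _ _ _
  refine ⟨{z | ∃ x : Fin n ⊕ κ → ℤ, cv ℚ x ∈ N ∧ z = (x ∘ Sum.inl, x ∘ Sum.inr)}, Nb.map e.toLinearMap, ?_, ?_, ?_⟩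
  · rintro _ ⟨x, hx, rfl⟩ _ ⟨y, hy, rfl⟩
    have := int_pair_zero hN hx hy
    rw [fb_dot] at this
    linarith
  · rw [LinearEquiv.finrank_map_eq e Nb]
    omega
  · rintro _ ⟨xb, hx, rfl⟩
    obtain ⟨x, hx', rfl⟩ := h2 xb hx
    exact ⟨_, ⟨x, hx', rfl⟩, rfl, rfl⟩

lemma even_diag {n : ℕ} {G : Matrix (Fin n) (Fin n) ℤ} (hs : G.IsSymm) (he : ∀ i, 2 ∣ G i i) (x : Fin n → ℤ) :
    2 ∣ x ⬝ᵥ G *ᵥ x := by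
  have key : ∀ (s : Finset (Fin n)), (2 : ℤ) ∣ ∑ i ∈ s, ∑ j ∈ s, x i * G i j * x j := by
    intro s
    induction s using Finset.induction_on with
    | empty => simp
    | insert a s ha ih =>
      rw [Finset.sum_insert ha, Finset.sum_insert ha]
      have h1 : ∑ i ∈ s, ∑ j ∈ insert a s, x i * G i j * x j = ∑ j ∈ s, x a * G a j * x j + ∑ i ∈ s, ∑ j ∈ s, x i * G i j * x j := by
        rw [← Finset.sum_add_distrib]
        refine Finset.sum_congr rfl fun i _ => ?_
        rw [Finset.sum_insert ha, hs.apply a i]; ring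
      rw [h1, show x a * G a a * x a + ∑ j ∈ s, x a * G a j * x j + (∑ j ∈ s, x a * G a j * x j + ∑ i ∈ s, ∑ j ∈ s, x i * G i j * x j)
        = G a a * (x a * x a) + 2 * ∑ j ∈ s, x a * G a j * x j + ∑ i ∈ s, ∑ j ∈ s, x i * G i j * x j by ring]
      exact dvd_add (dvd_add (Dvd.dvd.mul_right (he a) _) (Dvd.intro _ rfl)) ih
  have h := key Finset.univ
  convert h using 1
  simp only [dotProduct, mulVec, Finset.mul_sum, mul_assoc]

lemma lift_of_mod {ι : Type*} {p : ℕ} {x y : ι → ℤ} (h : cv (ZMod p) x = cv (ZMod p) y) : ∃ u, x = y + (p : ℤ) • u := by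
  have : ∀ i, ∃ k, x i = y i + p * k := fun i => by
    have h1 := congrFun h i
    rw [cv_apply, cv_apply, ZMod.intCast_eq_intCast_iff_dvd_sub] at h1
    obtain ⟨k, hk⟩ := h1
    exact ⟨-k, by linarith⟩
  choose u hu using this
  exact ⟨u, by ext i; simp [hu]⟩

lemma cv_surj {ι : Type*} {p : ℕ} [Fact p.Prime] (xb : ι → ZMod p) : ∃ x : ι → ℤ, cv (ZMod p) x = xb :=
  ⟨fun i => ((xb i).val : ℤ), by ext i; rw [cv_apply]; exact val_cast _⟩

lemma sig_mod_eight {n k : ℕ} (G : Matrix (Fin n) (Fin n) ℤ) (hs : G.IsSymm) (hu : IsUnit G.det) (he : ∀ i, 2 ∣ G i i)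
    (h : W.mk (zObj G hs hu.ne_zero) = k • cls 1) : 8 ∣ k := by
  haveI : Fact (Nat.Prime 2) := ⟨Nat.prime_two⟩
  obtain ⟨Λ, N, h1, h2, h3⟩ := lagr_mod (κ := Fin k) G hs hu (by simpa using h) 2
  let w : (Fin n → ZMod 2) × (Fin k → ZMod 2) := (0, fun _ => 1)
  let N' := N ⊔ Submodule.span _ {w}
  have par : ∀ s : Fin k → ℤ, (2 : ℤ) ∣ s ⬝ᵥ s - ∑ i, s i := by
    intro s
    rw [dotProduct, ← Finset.sum_sub_distrib]
    refine Finset.dvd_sum fun i _ => ?_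
    have := Int.even_mul_pred_self (s i)
    rw [show s i * s i - s i = s i * (s i - 1) by ring]
    exact this.two_dvd
  have hle : Module.finrank (ZMod 2) N + Module.finrank (ZMod 2) N' ≤ Module.finrank (ZMod 2) ((Fin n → ZMod 2) × (Fin k → ZMod 2)) := by
    apply finrank_add_le_of_ortho (B := bsum (mform (G.map (Int.cast : ℤ → ZMod 2))) (mform (-1)))
    · apply bsum_nd
      · apply mform_nd
        · rw [IsSymm, ← transpose_map, hs.eq]
        · have : (G.map (Int.cast : ℤ → ZMod 2)).det = (G.det : ZMod 2) := (Int.cast_det G).symm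
          rw [this]
          exact (hu.map (Int.castRingHom (ZMod 2))).ne_zero
      · apply mform_nd isSymm_one.neg
        rw [det_neg, det_one, mul_one]; exact pow_ne_zero _ (neg_ne_zero.2 one_ne_zero)
    · intro x hx y hy
      obtain ⟨z, hz, hz1, hz2⟩ := h3 x hx
      obtain ⟨y1, hy1, y2, hy2, rfl⟩ := Submodule.mem_sup.1 hy
      obtain ⟨a, rfl⟩ := Submodule.mem_span_singleton.1 hy2
      obtain ⟨z', hz', hz1', hz2'⟩ := h3 y1 hy1
      have e1 : bsum (mform (G.map (Int.cast : ℤ → ZMod 2))) (mform (-1)) x y1 = 0 := by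
        rw [bsum_apply, mform_apply, mform_apply, ← hz1, ← hz1', cv_dot, h1 z hz z' hz', ← hz2, ← hz2']
        rw [neg_mulVec, one_mulVec, dotProduct_neg]
        simp only [dotProduct, Int.cast_sum, Int.cast_mul, cv_apply]
        exact add_neg_cancel _
      have e2 : bsum (mform (G.map (Int.cast : ℤ → ZMod 2))) (mform (-1)) x w = 0 := by
        rw [bsum_apply, mform_apply, mform_apply, ← hz2, neg_mulVec, one_mulVec]
        change _ ⬝ᵥ _ *ᵥ (0 : Fin n → ZMod 2) + _ ⬝ᵥ (- fun _ => 1) = _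
        rw [mulVec_zero, dotProduct_zero, zero_add, dotProduct_neg, neg_eq_zero]
        have hd : (2 : ℤ) ∣ ∑ i, z.2 i := by
          have a1 := even_diag hs he z.1
          rw [h1 z hz z hz] at a1
          have := par z.2
          omega
        have := (ZMod.intCast_zmod_eq_zero_iff_dvd (∑ i, z.2 i) 2).2 (by exact_mod_cast hd)
        rw [← this]
        simp [dotProduct]
      rw [map_add, map_smul, e1, e2, smul_zero, add_zero]
  have hw : w ∈ N := by
    have hNN : N = N' := by
      apply Submodule.eq_of_le_of_finrank_le le_sup_left
      rw [Module.finrank_prod, Module.finrank_fintype_fun_eq_card, Module.finrank_fintype_fun_eq_card] at hle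
      simp only [Fintype.card_fin] at hle h2
      omega
    rw [hNN]
    exact Submodule.mem_sup_right (Submodule.mem_span_singleton_self w)
  obtain ⟨z, hz, hz1, hz2⟩ := h3 w hw
  obtain ⟨u, hu1⟩ := lift_of_mod (p := 2) (x := z.1) (y := 0) (by rw [hz1, cv_zero])
  obtain ⟨v, hv⟩ := lift_of_mod (p := 2) (x := z.2) (y := fun _ => 1) (by rw [hz2]; ext i; simp [w])
  have e := h1 z hz z hz
  rw [zero_add] at hu1
  have hv' : z.2 ⬝ᵥ z.2 = k + 4 * ∑ i, v i + 4 * (v ⬝ᵥ v) := by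
    rw [hv]
    simp only [dotProduct, Pi.add_apply, Pi.smul_apply, smul_eq_mul]
    rw [Finset.mul_sum, Finset.mul_sum, show (k : ℤ) = ∑ i : Fin k, 1 by simp, ← Finset.sum_add_distrib, ← Finset.sum_add_distrib]
    refine Finset.sum_congr rfl fun i _ => by push_cast; ring
  rw [hv', hu1, mulVec_smul, dotProduct_smul, smul_dotProduct] at e
  have a1 := even_diag hs he u
  have a2 := par v
  simp only [smul_eq_mul] at e
  omega

end NK

namespace NK
open Matrix

lemma rep_pos (c : ℕ) : ∀ (l : List ℚ), (∀ a ∈ l, 0 < a) →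
    ∃ d, d + 2 * min l.length (4 * c) ≤ 8 * c + l.length ∧ Rep d ((8 * c) • cls 1 - (l.map cls).sum) := by
  induction c with
  | zero =>
    intro l hl
    refine ⟨l.length, by simp, ?_⟩
    simp only [mul_zero, zero_smul, zero_sub]
    apply Rep.neg
    induction l with
    | nil => exact Rep.zero
    | cons a l ih =>
      rw [List.map_cons, List.sum_cons, List.length_cons, add_comm]
      exact (Rep.cls (hl a (by simp)).ne').add (ih fun b hb => hl b (by simp [hb]))
  | succ c ih =>
    have hone : (0 : ℚ) < 1 := one_pos
    have r1 := Rep.cls (a := 1) one_ne_zero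
    have s8 : (8 * (c + 1)) • cls 1 = 8 • cls 1 + (8 * c) • cls 1 := by rw [← add_smul]; congr 1; ring
    obtain ⟨d0, hd0, hr0⟩ := ih [] (by simp)
    simp at hd0 hr0
    intro l hl
    match l, hl with
    | [], _ =>
      refine ⟨4 + (1 + (1 + (1 + 1))) + d0, by simp; omega, ?_⟩
      have := ((pfister_rep hone hone hone hone).add (r1.add (r1.add (r1.add r1)))).add hr0
      convert this using 1
      rw [s8]; simp; abel
    | [a], hl =>
      refine ⟨4 + (1 + (1 + 1)) + d0, by simp; omega, ?_⟩
      have := ((pfister_rep (hl a (by simp)) hone hone hone).add (r1.add (r1.add r1))).add hr0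
      convert this using 1
      rw [s8]; simp; abel
    | [a, b], hl =>
      refine ⟨4 + (1 + 1) + d0, by simp; omega, ?_⟩
      have := ((pfister_rep (hl a (by simp)) (hl b (by simp)) hone hone).add (r1.add r1)).add hr0
      convert this using 1
      rw [s8]; simp; abel
    | [a, b, e], hl =>
      refine ⟨4 + 1 + d0, by simp; omega, ?_⟩
      have := ((pfister_rep (hl a (by simp)) (hl b (by simp)) (hl e (by simp)) hone).add r1).add hr0
      convert this using 1
      rw [s8]; simp; abel
    | a :: b :: e :: f :: t, hl =>
      obtain ⟨d1, hd1, hr1⟩ := ih t (fun x hx => hl x (by simp [hx]))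
      refine ⟨4 + d1, by simp only [List.length_cons]; omega, ?_⟩
      have := (pfister_rep (hl a (by simp)) (hl b (by simp)) (hl e (by simp)) (hl f (by simp))).add hr1
      convert this using 1
      rw [s8]; simp; abel

lemma rep_diff {m c : ℕ} (M : Matrix (Fin m) (Fin m) ℤ) (hs : M.IsSymm) (hd : M.det ≠ 0) :
    ∃ d, d + 2 * min (sigPlus M) (4 * c) ≤ 8 * c + m ∧ Rep d ((8 * c) • cls 1 - W.mk (zObj M hs hd)) := by
  obtain ⟨a, ha, h1, h2, h3⟩ := inertia M hs hd
  obtain ⟨d, hd1, hr⟩ := rep_pos c ((Finset.univ.filter fun i => 0 < a i).toList.map a) (by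
    intro x hx
    simp only [List.mem_map, Finset.mem_toList, Finset.mem_filter] at hx
    obtain ⟨i, hi, rfl⟩ := hx
    exact hi.2)
  have hadd := sig_add M hs hd
  simp only [List.length_map, Finset.length_toList, h2] at hd1
  refine ⟨d + sigMinus M, by omega, ?_⟩
  have := hr.add (Rep.sum (Finset.univ.filter fun i => a i < 0) a fun i _ => ha i).neg
  rw [h3] at this
  convert this using 1
  rw [h1, List.map_map, ← Finset.sum_filter_add_sum_filter_not Finset.univ (fun i => 0 < a i)]
  have e1 : (Finset.univ.filter fun i => ¬ 0 < a i) = Finset.univ.filter fun i => a i < 0 := by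
    ext i
    simp only [Finset.mem_filter, Finset.mem_univ, true_and, not_lt]
    exact ⟨fun h => lt_of_le_of_ne h (ha i), le_of_lt⟩
  have e2 : ((Finset.univ.filter fun i => 0 < a i).toList.map (cls ∘ a)).sum = ∑ i with 0 < a i, cls (a i) := Finset.sum_map_toList _ _
  rw [e1, e2]
  abel

lemma perp_class {m n : ℕ} (G : Matrix (Fin n) (Fin n) ℤ) (hs : G.IsSymm) (hd : G.det ≠ 0)
    (M : Matrix (Fin m) (Fin m) ℤ) (hMs : M.IsSymm) (hMd : M.det ≠ 0) (T : Matrix (Fin n) (Fin m) ℤ)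
    (hT : ∀ x y : Fin m → ℤ, T *ᵥ x ⬝ᵥ G *ᵥ (T *ᵥ y) = x ⬝ᵥ M *ᵥ y) :
    ∃ (X : Obj) (f : X.V →ₗ[ℚ] (Fin n → ℚ)), Function.Injective f ∧ W.mk X = W.mk (zObj G hs hd) - W.mk (zObj M hMs hMd) ∧ n ≤ X.dim + m ∧
      (∀ x y, mform (G.map (Int.cast : ℤ → ℚ)) (f x) (f y) = X.B x y) ∧
      ∀ x (y : Fin m → ℤ), mform (G.map (Int.cast : ℤ → ℚ)) (f x) (cv ℚ (T *ᵥ y)) = 0 := by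
  set GQ := G.map (Int.cast : ℤ → ℚ) with hGQ
  set B := mform GQ with hB
  have hBs : Sym B := mform_sym (by rw [IsSymm, ← transpose_map, hs.eq])
  have hBn : Nd B := (zObj G hs hd).nd
  set BM := mform (M.map (Int.cast : ℤ → ℚ)) with hBM
  have hMn : Nd BM := (zObj M hMs hMd).nd
  let t : (Fin m → ℚ) →ₗ[ℚ] (Fin n → ℚ) := (T.map (Int.cast : ℤ → ℚ)).mulVecLin
  have ht : ∀ y : Fin m → ℤ, t (cv ℚ y) = cv ℚ (T *ᵥ y) := by
    intro y
    ext i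
    simp [t, mulVec, dotProduct]
  have htB : ∀ x y, B (t x) (t y) = BM x y := by
    intro x y
    obtain ⟨k, x', hk, hx⟩ := exists_int_multiple x
    obtain ⟨l, y', hl, hy⟩ := exists_int_multiple y
    have hk' : (k : ℚ) ≠ 0 := by exact_mod_cast hk
    have hl' : (l : ℚ) ≠ 0 := by exact_mod_cast hl
    have h1 : B (t ((k : ℚ) • x)) (t ((l : ℚ) • y)) = BM ((k : ℚ) • x) ((l : ℚ) • y) := by
      rw [hx, hy, ht, ht, hB, hBM, mform_apply, mform_apply, hGQ, cv_dot, cv_dot, hT]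
    simp only [map_smul, LinearMap.smul_apply, smul_eq_mul] at h1
    exact mul_left_cancel₀ hk' (mul_left_cancel₀ hl' (by linarith))
  let f : (Fin n → ℚ) →ₗ[ℚ] ((Fin m → ℚ) →ₗ[ℚ] ℚ) :=
    { toFun := fun v => (B v).comp t
      map_add' := by intros; ext; simp
      map_smul' := by intros; ext; simp }
  have hf : ∀ v w, f v w = B v (t w) := fun _ _ => rfl
  let K := LinearMap.ker f
  have hrank : n ≤ Module.finrank ℚ K + m := by
    have h1 := LinearMap.finrank_range_add_finrank_ker f
    have h2 := Submodule.finrank_le (LinearMap.range f)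
    have h3 : Module.finrank ℚ ((Fin m → ℚ) →ₗ[ℚ] ℚ) = m := by
      exact (Subspace.dual_finrank_eq (K := ℚ) (V := Fin m → ℚ)).trans (Module.finrank_fin_fun ℚ)
    rw [Module.finrank_fin_fun] at h1
    change _ + Module.finrank ℚ K = _ at h1
    omega
  have hK : ∀ x ∈ K, ∀ w, B x (t w) = 0 := fun x hx w => by rw [← hf, LinearMap.mem_ker.1 hx]; rfl
  have hmemK : ∀ x, (∀ w, B x (t w) = 0) → x ∈ K := fun x hx => by
    rw [LinearMap.mem_ker]; ext w; simp [hf, hx]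
  have hdec : ∀ v, ∃ w, v - t w ∈ K := by
    intro v
    let g : (Fin m → ℚ) →ₗ[ℚ] ((Fin m → ℚ) →ₗ[ℚ] ℚ) := BM
    have hg : Function.Injective g := by
      rw [← LinearMap.ker_eq_bot, LinearMap.ker_eq_bot']
      intro x hx
      exact hMn x fun y => by change g x y = 0; rw [hx]; rfl
    have hgs : Function.Surjective g := by
      refine (LinearMap.injective_iff_surjective_of_finrank_eq_finrank ?_).1 hg
      exact (Subspace.dual_finrank_eq (K := ℚ) (V := Fin m → ℚ)).symm
    obtain ⟨w, hw⟩ := hgs (f v)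
    refine ⟨w, hmemK _ fun w' => ?_⟩
    rw [map_sub, LinearMap.sub_apply, htB, ← hf, ← hw, sub_self]
  let X : Obj := 
    { V := K
      B := (B.comp K.subtype).compl₂ K.subtype
      sym := fun x y => hBs x y
      nd := fun x hx => by
        have : (x : Fin n → ℚ) = 0 := by
          apply hBn
          intro v
          obtain ⟨w, hw⟩ := hdec v
          have h1 := hx ⟨_, hw⟩
          change B x (v - t w) = 0 at h1
          rw [map_sub, hK x x.2, sub_zero] at h1
          exact h1
        exact Subtype.ext this }
  have hXd : X.dim = Module.finrank ℚ K := rfl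
  refine ⟨X, K.subtype, K.subtype_injective, ?_, by omega, fun _ _ => rfl, fun x y => ?_⟩
  · rw [eq_sub_iff_add_eq]
    refine W.mk_eq_of_map (X := X.sum (zObj M hMs hMd)) (Y := zObj G hs hd) (LinearMap.coprod K.subtype t) ?_ ?_
    · rintro ⟨(a : K), (b : Fin m → ℚ)⟩ ⟨(a' : K), (b' : Fin m → ℚ)⟩
      change B ((a : Fin n → ℚ) + t b) ((a' : Fin n → ℚ) + t b') = B a a' + BM b b'
      rw [map_add, map_add, LinearMap.add_apply, LinearMap.add_apply, hK a a.2, hBs (t b), hK a' a'.2, htB]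
      ring
    · rw [Obj.dim_sum, zObj_dim, zObj_dim, Fintype.card_fin, Fintype.card_fin]; omega
  · rw [← ht]
    exact hK x x.2 _

lemma iso_perp {m n c : ℕ} (G : Matrix (Fin n) (Fin n) ℤ) (hs : G.IsSymm) (hd : G.det ≠ 0)
    (hc : W.mk (zObj G hs hd) = (8 * c) • cls 1)
    (M : Matrix (Fin m) (Fin m) ℤ) (hMs : M.IsSymm) (hMd : M.det ≠ 0) (T : Matrix (Fin n) (Fin m) ℤ)
    (hT : ∀ x y : Fin m → ℤ, T *ᵥ x ⬝ᵥ G *ᵥ (T *ᵥ y) = x ⬝ᵥ M *ᵥ y)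
    (hn : n = 2 * sigMinus G + 8 * c) (h1 : sigMinus M < sigMinus G) (h2 : 2 * m + 2 ≤ n) :
    ∃ e : Fin n → ℤ, e ≠ 0 ∧ e ⬝ᵥ G *ᵥ e = 0 ∧ ∀ y, e ⬝ᵥ G *ᵥ (T *ᵥ y) = 0 := by
  obtain ⟨X, f, hf, hX, hXd, hB, hP⟩ := perp_class G hs hd M hMs hMd T hT
  obtain ⟨d, hd1, Y, hY, hYd⟩ := rep_diff (c := c) M hMs hMd
  have ha := sig_add M hMs hMd
  rw [hc, ← hY] at hX
  obtain ⟨x, hx0, hx⟩ := isotropic_of_mk_eq hX (by omega)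
  obtain ⟨k, e, hk, he⟩ := exists_int_multiple (f x)
  have hinj : ∀ z : ℤ, (z : ℚ) = 0 → z = 0 := fun z hz => by exact_mod_cast hz
  refine ⟨e, ?_, ?_, fun y => ?_⟩
  · rintro rfl
    rw [cv_zero, smul_eq_zero] at he
    rcases he with he | he
    · exact hk (hinj _ he)
    · exact hx0 (hf (by rw [he, map_zero]))
  · apply hinj
    rw [← cv_dot, ← mform_apply, ← he, map_smul, map_smul, LinearMap.smul_apply, hB, hx]; simp
  · apply hinj
    rw [← cv_dot, ← mform_apply, ← he, map_smul, LinearMap.smul_apply, hP, smul_zero]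

end NK

namespace NK
open Matrix

lemma exists_K (p : ℕ) [hp : Fact p.Prime] : ∃ k : Matrix (Fin 4) (Fin 4) ℤ, (∀ v w : Fin 4 → ℤ, (p : ℤ) ∣ v ⬝ᵥ w + (k *ᵥ v) ⬝ᵥ (k *ᵥ w)) ∧
    (p = 2 → ∀ v : Fin 4 → ℤ, 4 ∣ v ⬝ᵥ v + (k *ᵥ v) ⬝ᵥ (k *ᵥ v)) := by
  by_cases h2 : p = 2
  · subst h2
    refine ⟨!![1,1,1,0;1,1,0,1;1,0,1,1;0,1,1,1], fun v w => ?_, fun _ v => ?_⟩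
    · refine ⟨2 * (v ⬝ᵥ w) + v 0 * w 1 + v 0 * w 2 + v 0 * w 3 + v 1 * w 0 + v 1 * w 2 + v 1 * w 3 + v 2 * w 0 + v 2 * w 1 + v 2 * w 3
        + v 3 * w 0 + v 3 * w 1 + v 3 * w 2, ?_⟩
      simp [mulVec, dotProduct, Fin.sum_univ_succ]
      ring
    · refine ⟨v ⬝ᵥ v + v 0 * v 1 + v 0 * v 2 + v 0 * v 3 + v 1 * v 2 + v 1 * v 3 + v 2 * v 3, ?_⟩
      simp [mulVec, dotProduct, Fin.sum_univ_succ]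
      ring
  · obtain ⟨x, y, hxy⟩ := two_squares h2 (one_ne_zero : (1 : ZMod p) ≠ 0) one_ne_zero (-1)
    obtain ⟨a, rfl⟩ := ZMod.intCast_surjective x
    obtain ⟨b, rfl⟩ := ZMod.intCast_surjective y
    have h : (p : ℤ) ∣ a ^ 2 + b ^ 2 + 1 := by
      rw [← ZMod.intCast_zmod_eq_zero_iff_dvd]
      push_cast
      linear_combination hxy
    refine ⟨!![a,-b,0,0;b,a,0,0;0,0,a,-b;0,0,b,a], fun v w => ?_, fun h => absurd h h2⟩
    obtain ⟨r, hr⟩ := h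
    refine ⟨r * (v ⬝ᵥ w), ?_⟩
    simp [mulVec, dotProduct, Fin.sum_univ_succ]
    linear_combination (v 0 * w 0 + v 1 * w 1 + v 2 * w 2 + v 3 * w 3) * hr

lemma hyp_mod {n c : ℕ} (G : Matrix (Fin n) (Fin n) ℤ) (hs : G.IsSymm) (he : ∀ i, 2 ∣ G i i) (hu : IsUnit G.det)
    (h : W.mk (zObj G hs hu.ne_zero) = (8 * c) • cls 1) (p : ℕ) [hp : Fact p.Prime] :
    ∃ H : Submodule (ZMod p) (Fin n → ZMod p), n ≤ 2 * Module.finrank (ZMod p) H ∧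
      (∀ x y : Fin n → ℤ, cv _ x ∈ H → cv _ y ∈ H → (p : ℤ) ∣ x ⬝ᵥ G *ᵥ y) ∧
      (∀ x : Fin n → ℤ, cv _ x ∈ H → (2 * p : ℤ) ∣ x ⬝ᵥ G *ᵥ x) := by
  obtain ⟨k, hk1, hk2⟩ := exists_K p
  let ι := Fin c × Fin 4
  obtain ⟨Λ, N, h1, h2, h3⟩ := lagr_mod (κ := ι ⊕ ι) G hs hu (by rw [h]; congr 1; simp [ι]; ring) p
  -- the graph of `k`
  let kk : (ι → ℤ) → (ι → ℤ) := fun v ij => (k *ᵥ fun l => v (ij.1, l)) ij.2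
  let Φ : (ι → ZMod p) →ₗ[ZMod p] (ι ⊕ ι → ZMod p) :=
    { toFun := fun v => Sum.elim v fun ij => ∑ l, (k ij.2 l : ZMod p) * v (ij.1, l)
      map_add' := by
        intro v w
        ext i
        rcases i with i | i
        · rfl
        · simp [mul_add, Finset.sum_add_distrib]
      map_smul' := by
        intro r w
        ext i
        rcases i with i | i
        · rfl
        · simp only [Sum.elim_inr, Pi.smul_apply, smul_eq_mul, RingHom.id_apply, Finset.mul_sum]
          exact Finset.sum_congr rfl fun _ _ => by ring }
  have hΦ : ∀ v : ι → ℤ, Φ (cv _ v) = cv _ (Sum.elim v (kk v)) := by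
    intro v
    ext i
    rcases i with i | i
    · rfl
    · simp [Φ, kk, mulVec, dotProduct]
  have hsum : ∀ v w : ι → ℤ, Sum.elim v (kk v) ⬝ᵥ Sum.elim w (kk w) =
      ∑ i, ((fun l => v (i, l)) ⬝ᵥ (fun l => w (i, l)) + (k *ᵥ fun l => v (i, l)) ⬝ᵥ (k *ᵥ fun l => w (i, l))) := by
    intro v w
    rw [dotProduct, Fintype.sum_sum_type]
    simp only [Sum.elim_inl, Sum.elim_inr]
    rw [Fintype.sum_prod_type, Fintype.sum_prod_type, ← Finset.sum_add_distrib]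
    rfl
  have hBn : Nd (mform (G.map (Int.cast : ℤ → ZMod p))) := by
    apply mform_nd
    · rw [IsSymm, ← transpose_map, hs.eq]
    · have : (G.map (Int.cast : ℤ → ZMod p)).det = (G.det : ZMod p) := (Int.cast_det G).symm
      rw [this]
      exact (hu.map (Int.castRingHom (ZMod p))).ne_zero
  have hBn2 : Nd (mform (-1 : Matrix (ι ⊕ ι) (ι ⊕ ι) (ZMod p))) := by
    apply mform_nd isSymm_one.neg
    rw [det_neg, det_one, mul_one]; exact pow_ne_zero _ (neg_ne_zero.2 one_ne_zero)
  have hdotc : ∀ (s t : ι ⊕ ι → ℤ), mform (-1 : Matrix (ι ⊕ ι) (ι ⊕ ι) (ZMod p)) (cv _ s) (cv _ t) = -((s ⬝ᵥ t : ℤ) : ZMod p) := by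
    intro s t
    rw [mform_apply, neg_mulVec, one_mulVec, dotProduct_neg]
    simp only [dotProduct, Int.cast_sum, Int.cast_mul, cv_apply]
  obtain ⟨H, hH1, hH2, hH3⟩ := lagr_red hBn hBn2 N (by
      intro z hz w hw
      obtain ⟨z', hz', hz1, hz2⟩ := h3 z hz
      obtain ⟨w', hw', hw1, hw2⟩ := h3 w hw
      rw [bsum_apply, ← hz1, ← hw1, ← hz2, ← hw2, hdotc, mform_apply, cv_dot, h1 _ hz' _ hw']
      exact add_neg_cancel _) (by
      rw [Module.finrank_fin_fun, Module.finrank_fintype_fun_eq_card]; exact h2) (LinearMap.range Φ) (by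
      rintro _ ⟨v, rfl⟩ _ ⟨w, rfl⟩
      obtain ⟨v', rfl⟩ := cv_surj v
      obtain ⟨w', rfl⟩ := cv_surj w
      rw [hΦ, hΦ, hdotc, hsum, neg_eq_zero, ZMod.intCast_zmod_eq_zero_iff_dvd]
      exact Finset.dvd_sum fun i _ => hk1 _ _) (by
      rw [LinearMap.finrank_range_of_inj]
      · rw [Module.finrank_fintype_fun_eq_card, Module.finrank_fintype_fun_eq_card, Fintype.card_sum]; omega
      · intro v w hvw
        ext i
        exact congrFun hvw (Sum.inl i))
  rw [Module.finrank_fin_fun] at hH2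
  have hTI : ∀ x y : Fin n → ℤ, cv _ x ∈ H → cv _ y ∈ H → (p : ℤ) ∣ x ⬝ᵥ G *ᵥ y := by
    intro x y hx hy
    rw [← ZMod.intCast_zmod_eq_zero_iff_dvd, ← cv_dot, ← mform_apply]
    exact hH1 _ hx _ hy
  refine ⟨H, hH2, hTI, fun x hx => ?_⟩
  by_cases hp2 : p = 2
  · subst hp2
    obtain ⟨_, ⟨v, rfl⟩, hc⟩ := hH3 _ hx
    obtain ⟨v, rfl⟩ := cv_surj v
    rw [hΦ] at hc
    obtain ⟨z, hz, hz1, hz2⟩ := h3 _ hc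
    obtain ⟨u1, hu1⟩ := lift_of_mod hz1
    obtain ⟨u2, hu2⟩ := lift_of_mod hz2
    have e := h1 z hz z hz
    have e4 : (4 : ℤ) ∣ Sum.elim v (kk v) ⬝ᵥ Sum.elim v (kk v) := by
      rw [hsum]; exact Finset.dvd_sum fun i _ => hk2 rfl _
    set s := Sum.elim v (kk v)
    rw [hu1, hu2] at e
    simp only [mulVec_add, mulVec_smul, dotProduct_add, add_dotProduct, dotProduct_smul, smul_dotProduct, smul_eq_mul] at e
    have e5 : u1 ⬝ᵥ G *ᵥ x = x ⬝ᵥ G *ᵥ u1 := by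
      rw [dotProduct_mulVec, ← mulVec_transpose, hs.eq, dotProduct_comm]
    rw [e5, dotProduct_comm u2 s] at e
    push_cast at e ⊢
    omega
  · have a1 := even_diag hs he x
    have a2 := hTI x x hx hx
    refine IsCoprime.mul_dvd ?_ a1 a2
    rw [Int.isCoprime_iff_gcd_eq_one]
    have := (Nat.coprime_primes Nat.prime_two hp.out).2 (Ne.symm hp2)
    exact_mod_cast this

end NK

namespace NK

/-- a module with an even bilinear form -/
structure QM (R A : Type*) [CommRing R] [AddCommGroup A] [Module R A] where
  b : A →ₗ[R] A →ₗ[R] R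
  q : A → R
  sym : ∀ x y, b x y = b y x
  hq : ∀ x, b x x = 2 * q x

namespace QM
variable {R A : Type*} [CommRing R] [IsDomain R] [CharZero R] [AddCommGroup A] [Module R A] (Q : QM R A)

lemma q_add (x y : A) : Q.q (x + y) = Q.q x + Q.q y + Q.b x y := by
  have h := Q.hq (x + y)
  simp only [map_add, LinearMap.add_apply, Q.hq, Q.sym y x] at h
  exact mul_left_cancel₀ (two_ne_zero (α := R)) (by linear_combination -h)

lemma q_smul (k : R) (x : A) : Q.q (k • x) = k ^ 2 * Q.q x := by
  have h := Q.hq (k • x)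
  simp only [map_smul, LinearMap.smul_apply, Q.hq, smul_eq_mul] at h
  exact mul_left_cancel₀ (two_ne_zero (α := R)) (by linear_combination -h)

lemma q_sub (x y : A) : Q.q (x - y) = Q.q x + Q.q y - Q.b x y := by
  have h := Q.hq (x - y)
  simp only [map_sub, LinearMap.sub_apply, Q.hq, Q.sym y x] at h
  exact mul_left_cancel₀ (two_ne_zero (α := R)) (by linear_combination -h)

lemma q_neg (x : A) : Q.q (-x) = Q.q x := by
  have h := Q.q_smul (-1) x
  rw [neg_one_smul] at h
  rw [h]; ring

lemma q_zero : Q.q 0 = 0 := by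
  have h := Q.q_smul 0 0
  rw [zero_smul] at h
  rw [h]; ring

end QM

/-- Chinese remainder theorem in a ℤ-module -/
lemma crt {X : Type*} [AddCommGroup X] (S : Finset ℕ) (hS : ∀ p ∈ S, p.Prime) (x : ℕ → X) :
    ∃ y : X, ∀ p ∈ S, ∃ u : X, y = x p + (p : ℤ) • u := by
  classical
  induction S using Finset.induction_on with
  | empty => exact ⟨0, by simp⟩
  | insert p S hp ih =>
    obtain ⟨y, hy⟩ := ih fun r hr => hS r (by simp [hr])
    have hcop : IsCoprime (p : ℤ) ((∏ r ∈ S, r : ℕ) : ℤ) := by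
      rw [Nat.isCoprime_iff_coprime]
      refine Nat.Coprime.prod_right fun r hr => ?_
      refine (Nat.coprime_primes (hS p (by simp)) (hS r (by simp [hr]))).2 ?_
      rintro rfl; exact hp hr
    obtain ⟨a, b, hab⟩ := hcop
    refine ⟨(a * p) • y + (b * ((∏ r ∈ S, r : ℕ) : ℤ)) • x p, fun r hr => ?_⟩
    rcases Finset.mem_insert.1 hr with rfl | hr
    · refine ⟨a • (y - x r), ?_⟩
      rw [show b * ((∏ r ∈ S, r : ℕ) : ℤ) = 1 - a * r by linear_combination hab]
      module
    · obtain ⟨u, hu⟩ := hy r hr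
      obtain ⟨k, hk⟩ := Finset.dvd_prod_of_mem (fun r => r) hr
      have hk' : ((∏ r ∈ S, r : ℕ) : ℤ) = r * k := by exact_mod_cast hk
      refine ⟨u + (b * k) • (x p - y), ?_⟩
      rw [show a * (p : ℤ) = 1 - b * (r * k) by rw [← hk']; linear_combination hab, hk']
      rw [show x r = y - (r : ℤ) • u by rw [hu]; abel]
      module

lemma crt_prop {X : Type*} [AddCommGroup X] (S : Finset ℕ) (hS : ∀ p ∈ S, p.Prime) (P : ℕ → X → Prop)
    (h : ∀ p ∈ S, ∃ x, P p x) (hP : ∀ p ∈ S, ∀ x u, P p x → P p (x + (p : ℤ) • u)) : ∃ y, ∀ p ∈ S, P p y := by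
  classical
  let x : ℕ → X := fun p => if hp : p ∈ S then (h p hp).choose else 0
  obtain ⟨y, hy⟩ := crt S hS x
  refine ⟨y, fun p hp => ?_⟩
  obtain ⟨u, rfl⟩ := hy p hp
  apply hP p hp
  simp only [x, hp, dif_pos]
  exact (h p hp).choose_spec

lemma coprime_part (P : ℕ) (d : ℕ) (hd : 0 < d) : ∃ d' u k : ℕ, d = d' * u ∧ u.Coprime P ∧ d' ∣ P ^ (k + 1) := by
  induction d using Nat.strong_induction_on with
  | _ d ih =>
    by_cases h : d.Coprime P
    · exact ⟨1, d, 0, by simp, h, by simp⟩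
    · obtain ⟨d1, hd1⟩ := Nat.gcd_dvd_left d P
      have hg : 1 < d.gcd P := by
        have := Nat.gcd_pos_of_pos_left P hd
        have h' : d.gcd P ≠ 1 := h
        omega
      have hd1p : 0 < d1 := Nat.pos_of_ne_zero (by rintro rfl; simp at hd1; omega)
      obtain ⟨d', u, k, h1, h2, h3⟩ := ih d1 (by rw [hd1]; nlinarith) hd1p
      refine ⟨d.gcd P * d', u, k + 1, by rw [mul_assoc, ← h1]; exact hd1, h2, ?_⟩
      rw [pow_succ, mul_comm]
      exact mul_dvd_mul h3 (Nat.gcd_dvd_right d P)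

section stageI
variable {A : Type*} [AddCommGroup A] (Q : QM ℤ A)

lemma loc_improve {p : ℕ} [hp : Fact p.Prime] (φ : A →ₗ[ℤ] ℤ) (hφ : ∃ x, φ x = 1)
    (h : ∃ z t, (p : ℤ) ∣ Q.q z ∧ ¬ (p : ℤ) ∣ Q.b z t) :
    ∃ z t, (p : ℤ) ∣ Q.q z ∧ ¬ (p : ℤ) ∣ Q.b z t ∧ ¬ (p : ℤ) ∣ φ z := by
  obtain ⟨z, t, hz, ht⟩ := h
  simp only [← ZMod.intCast_zmod_eq_zero_iff_dvd] at hz ht ⊢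
  obtain ⟨c, hc⟩ := ZMod.intCast_surjective (n := p) ((Q.b z t : ZMod p)⁻¹)
  have hct : (c : ZMod p) * (Q.b z t : ZMod p) = 1 := by rw [hc, inv_mul_cancel₀ ht]
  set t' := c • t - (Q.q (c • t)) • z with ht'
  have h1 : ((Q.b z t' : ℤ) : ZMod p) = 1 := by
    rw [ht']
    simp only [map_sub, map_smul, smul_eq_mul, Q.hq]
    push_cast
    rw [hz]
    linear_combination hct
  have h2 : ((Q.q t' : ℤ) : ZMod p) = 0 := by
    rw [ht', Q.q_sub, Q.q_smul _ z]
    simp only [map_smul, LinearMap.smul_apply, smul_eq_mul, Q.sym t z]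
    push_cast
    rw [hz]
    linear_combination (-(Q.q (c • t) : ZMod p)) * hct
  clear_value t'
  by_cases hz1 : ((φ z : ℤ) : ZMod p) = 0
  · by_cases hz2 : ((φ t' : ℤ) : ZMod p) = 0
    · obtain ⟨x, hx⟩ := hφ
      set x' := x - Q.b x t' • z - Q.b x z • t' with hx'
      have e1 : ((Q.b x' z : ℤ) : ZMod p) = 0 := by
        rw [hx']
        simp only [map_sub, map_smul, LinearMap.sub_apply, LinearMap.smul_apply, smul_eq_mul, Q.hq, Q.sym t' z]
        push_cast
        rw [hz, h1]; ring
      have e2 : ((Q.b x' t' : ℤ) : ZMod p) = 0 := by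
        rw [hx']
        simp only [map_sub, map_smul, LinearMap.sub_apply, LinearMap.smul_apply, smul_eq_mul, Q.hq]
        push_cast
        rw [h2, h1]; ring
      have e3 : ((φ x' : ℤ) : ZMod p) = 1 := by
        rw [hx']
        simp only [map_sub, map_smul, smul_eq_mul, hx]
        push_cast
        rw [hz1, hz2]; ring
      clear_value x'
      refine ⟨z + x' - Q.q x' • t', t', ?_, ?_, ?_⟩
      · rw [Q.q_sub, Q.q_add, Q.q_smul]
        simp only [map_add, map_smul, LinearMap.add_apply, smul_eq_mul, Q.sym z x']
        push_cast
        rw [hz, h2, e1, e2, h1]; ring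
      · simp only [map_add, map_sub, map_smul, LinearMap.add_apply, LinearMap.sub_apply, LinearMap.smul_apply, smul_eq_mul, Q.hq]
        push_cast
        rw [h1, e2, h2]; simp
      · simp only [map_add, map_sub, map_smul, smul_eq_mul]
        push_cast
        rw [hz1, hz2, e3]; simp
    · exact ⟨t', z, h2, by rw [Q.sym, h1]; exact one_ne_zero, hz2⟩
  · exact ⟨z, t', hz, by rw [h1]; exact one_ne_zero, hz1⟩

lemma hensel {P : ℤ} {z t : A} (hz : P ∣ Q.q z) (ht : IsCoprime (Q.b z t) P) (k : ℕ) :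
    ∃ u, P ^ (k + 1) ∣ Q.q (z + P • u) := by
  induction k with
  | zero => exact ⟨0, by simpa using hz⟩
  | succ k ih =>
    obtain ⟨u, r, hr⟩ := ih
    have hc : IsCoprime (Q.b (z + P • u) t) P := by
      rw [map_add, map_smul, LinearMap.add_apply, LinearMap.smul_apply, smul_eq_mul]
      exact ht.add_mul_left_left _
    obtain ⟨a, b, hab⟩ := hc
    refine ⟨u - (P ^ k * (a * r)) • t, r * b + P ^ k * (a * r) ^ 2 * Q.q t, ?_⟩
    rw [show z + P • (u - (P ^ k * (a * r)) • t) = (z + P • u) - (P ^ (k + 1) * (a * r)) • t by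
      rw [pow_succ]; module]
    rw [Q.q_sub, Q.q_smul, map_smul, hr, smul_eq_mul]
    linear_combination (-P ^ (k + 1) * r) * hab

lemma exists_primitive {e t : A} (h : Q.b e t ≠ 0) : ∃ (k : ℤ) (e' : A), e = k • e' ∧ k ≠ 0 ∧ ∀ p : ℕ, p.Prime → ∀ x : A, e' ≠ (p : ℤ) • x := by
  obtain ⟨N, hN⟩ : ∃ N, (Q.b e t).natAbs = N := ⟨_, rfl⟩
  induction N using Nat.strong_induction_on generalizing e with
  | _ N ih =>
    by_cases hp : ∀ p : ℕ, p.Prime → ∀ x : A, e ≠ (p : ℤ) • x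
    · exact ⟨1, e, by simp, one_ne_zero, hp⟩
    · push Not at hp
      obtain ⟨p, hp, x, rfl⟩ := hp
      rw [map_smul, LinearMap.smul_apply, smul_eq_mul] at h hN
      have h0 := right_ne_zero_of_mul h
      rw [Int.natAbs_mul, Int.natAbs_natCast] at hN
      have h1 : 0 < (Q.b x t).natAbs := Int.natAbs_pos.2 h0
      obtain ⟨k, e', h2, h3, h4⟩ := ih _ (by rw [← hN]; nlinarith [hp.two_le]) h0 rfl
      exact ⟨p * k, e', by rw [mul_smul, ← h2], mul_ne_zero (by exact_mod_cast hp.ne_zero) h3, h4⟩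

/-- a linear functional on a ℤ-module factors as `d` times a surjective one -/
lemma functional_factor (ψ : A →ₗ[ℤ] ℤ) (h : ψ ≠ 0) : ∃ (d : ℕ) (φ : A →ₗ[ℤ] ℤ), 0 < d ∧ (∀ x, ψ x = d * φ x) ∧ ∃ x, φ x = 1 := by
  obtain ⟨g, hg⟩ := (IsPrincipalIdealRing.principal (LinearMap.range ψ : Ideal ℤ)).principal
  have hmem : ∀ x, g ∣ ψ x := fun x => by
    have : ψ x ∈ (Submodule.span ℤ {g} : Submodule ℤ ℤ) := by rw [← hg]; exact ⟨x, rfl⟩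
    exact Ideal.mem_span_singleton.1 this
  have hg0 : g ≠ 0 := by
    rintro rfl
    apply h
    ext x
    simpa using hmem x
  have hd0 : ((g.natAbs : ℕ) : ℤ) ≠ 0 := by simpa using hg0
  have hmem' : ∀ x, ((g.natAbs : ℕ) : ℤ) ∣ ψ x := fun x => by simpa using hmem x
  choose φ hφ using hmem'
  refine ⟨g.natAbs, ⟨⟨φ, fun x y => ?_⟩, fun k x => ?_⟩, Int.natAbs_pos.2 hg0, hφ, ?_⟩
  · apply mul_left_cancel₀ hd0
    rw [← hφ, map_add, hφ, hφ]; ring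
  · apply mul_left_cancel₀ hd0
    rw [← hφ, map_smul, hφ]; simp only [smul_eq_mul, eq_intCast, Int.cast_id]; ring
  · have : g ∈ LinearMap.range ψ := by rw [hg]; exact Submodule.mem_span_singleton_self g
    obtain ⟨x, hx⟩ := this
    have h1 := hφ x
    rw [hx] at h1
    have : φ x = 1 ∨ φ x = -1 := by
      have h2 : (g.natAbs : ℤ) * (φ x).natAbs = g.natAbs := by
        have h5 := congrArg Int.natAbs h1
        rw [Int.natAbs_mul, Int.natAbs_natCast] at h5
        exact_mod_cast h5.symm
      have h3 : ((φ x).natAbs : ℤ) = 1 := mul_left_cancel₀ hd0 (by rw [h2, mul_one])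
      omega
    rcases this with h2 | h2
    · exact ⟨x, h2⟩
    · refine ⟨-x, ?_⟩
      change φ (-x) = 1
      apply mul_left_cancel₀ hd0
      rw [← hφ, map_neg, hφ, h2]; ring

theorem hyperbolic_pair (S : Finset ℕ) (hS : ∀ p ∈ S, p.Prime)
    (hnd : ∀ e : A, e ≠ 0 → ∃ t, Q.b e t ≠ 0) (e0 : A) (he0 : e0 ≠ 0) (hq0 : Q.q e0 = 0)
    (hloc : ∀ p ∈ S, ∃ z t, (p : ℤ) ∣ Q.q z ∧ ¬ (p : ℤ) ∣ Q.b z t)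
    (hout : ∀ p : ℕ, p.Prime → p ∉ S → ∀ e : A, (∀ x, (p : ℤ) ∣ Q.b e x) → ∃ e', e = (p : ℤ) • e') :
    ∃ e f, Q.q e = 0 ∧ Q.q f = 0 ∧ Q.b e f = 1 := by
  obtain ⟨t0, ht0⟩ := hnd e0 he0
  obtain ⟨d, φ, hd, hdφ, hφ⟩ := functional_factor (Q.b e0) (by intro h; rw [h] at ht0; exact ht0 rfl)
  -- local solutions and CRT
  obtain ⟨⟨z, t⟩, hzt⟩ := crt_prop (X := A × A) S hS
    (fun p x => (p : ℤ) ∣ Q.q x.1 ∧ ¬ (p : ℤ) ∣ Q.b x.1 x.2 ∧ ¬ (p : ℤ) ∣ φ x.1)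
    (fun p hp => by
      haveI : Fact p.Prime := ⟨hS p hp⟩
      obtain ⟨z, t, h⟩ := loc_improve Q φ hφ (hloc p hp)
      exact ⟨(z, t), h⟩) (by
      rintro p hp ⟨z, t⟩ ⟨u, v⟩ ⟨h1, h2, h3⟩
      simp only [Prod.smul_mk, Prod.mk_add_mk] at h1 h2 h3 ⊢
      simp only [← ZMod.intCast_zmod_eq_zero_iff_dvd] at h1 h2 h3 ⊢
      simp only [Q.q_add, Q.q_smul, map_add, map_smul, LinearMap.add_apply, LinearMap.smul_apply, smul_eq_mul]
      push_cast
      simp [h1, h2, h3])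
  simp only at hzt
  set P := ∏ p ∈ S, p with hP
  have hcopP : ∀ a : ℤ, (∀ p ∈ S, ¬ (p : ℤ) ∣ a) → IsCoprime a (P : ℤ) := by
    intro a ha
    rw [hP]; push_cast
    refine IsCoprime.prod_right fun p hp => ?_
    exact ((Prime.coprime_iff_not_dvd (Nat.prime_iff_prime_int.1 (hS p hp))).2 (ha p hp)).symm
  have hSP : ∀ p ∈ S, (p : ℤ) ∣ P := fun p hp => by
    exact_mod_cast Finset.dvd_prod_of_mem (fun p => p) hp
  have hPq : (P : ℤ) ∣ Q.q z := by
    rw [hP]; push_cast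
    refine Finset.prod_dvd_of_coprime ?_ fun p hp => (hzt p hp).1
    intro p hp r hr hpr
    exact Nat.isCoprime_iff_coprime.2 ((Nat.coprime_primes (hS p hp) (hS r hr)).2 hpr)
  obtain ⟨d', v, k, hdv, hv, hdk⟩ := coprime_part P d hd
  obtain ⟨u, hu⟩ := hensel Q hPq (hcopP _ fun p hp => (hzt p hp).2.1) k
  set z' := z + (P : ℤ) • u with hz'
  have hd'z : (d' : ℤ) ∣ Q.q z' := dvd_trans (by exact_mod_cast hdk) hu
  obtain ⟨r, hr⟩ := hd'z
  have hd'0 : (d' : ℤ) ≠ 0 := by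
    rintro h; have : d' = 0 := by exact_mod_cast h
    rw [this] at hdv; omega
  let e1 := r • e0 - (v * φ z') • z'
  have hdv' : (d : ℤ) = d' * v := by exact_mod_cast hdv
  have he1 : Q.q e1 = 0 := by
    simp only [e1, Q.q_sub, Q.q_smul, map_smul, LinearMap.smul_apply, smul_eq_mul, hdφ, hq0]
    rw [hr, hdv']; ring
  have he1t : IsCoprime (Q.b e1 t) (P : ℤ) := by
    apply hcopP
    intro p hp hdiv
    haveI : Fact p.Prime := ⟨hS p hp⟩
    obtain ⟨g1, g2, g3⟩ := hzt p hp
    have e : (Q.b e1 t) = v * (Q.q z' * φ t - φ z' * Q.b z' t) := by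
      simp only [e1, map_sub, map_smul, LinearMap.sub_apply, LinearMap.smul_apply, smul_eq_mul, hdφ]
      rw [hr, hdv']; ring
    rw [e] at hdiv
    have hpr := Nat.prime_iff_prime_int.1 (hS p hp)
    rcases hpr.dvd_or_dvd hdiv with h1 | h1
    · have := hpr.not_unit
      have h2 : IsCoprime (v : ℤ) P := Nat.isCoprime_iff_coprime.2 hv
      exact this (h2.isUnit_of_dvd' h1 (hSP p hp))
    · rw [← ZMod.intCast_zmod_eq_zero_iff_dvd] at g1 g2 g3 h1
      have hP0 : ((P : ℤ) : ZMod p) = 0 := (ZMod.intCast_zmod_eq_zero_iff_dvd _ _).2 (hSP p hp)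
      rw [hz'] at h1
      simp only [Q.q_add, Q.q_smul, map_add, map_smul, LinearMap.add_apply, LinearMap.smul_apply, smul_eq_mul] at h1
      push_cast at h1 hP0
      rw [hP0, g1] at h1
      simp at h1
      rcases h1 with h1 | h1
      · exact g3 h1
      · exact g2 h1
  by_cases hone : Q.b e1 t = 0
  · -- then P is a unit, no primes in S
    rw [hone, isCoprime_zero_left] at he1t
    have hSe : S = ∅ := by
      rw [Finset.eq_empty_iff_forall_notMem]
      intro p hp
      exact (Nat.prime_iff_prime_int.1 (hS p hp)).not_unit (isUnit_of_dvd_unit (hSP p hp) he1t)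
    obtain ⟨k, e, hk, hk0, hprim⟩ := exists_primitive Q ht0
    have hqe : Q.q e = 0 := by
      rw [hk, Q.q_smul] at hq0
      exact (mul_eq_zero.1 hq0).resolve_left (pow_ne_zero _ hk0)
    obtain ⟨g, ψ, hg, hgψ, x, hx⟩ := functional_factor (Q.b e) (by
      intro h; rw [hk, map_smul, h] at ht0; exact ht0 (by simp))
    have hg1 : g = 1 := by
      by_contra hne
      obtain ⟨p, hp, hpg⟩ := Nat.exists_prime_and_dvd hne
      obtain ⟨e', he'⟩ := hout p hp (by simp [hSe]) e fun x => by
        rw [hgψ]; exact Dvd.dvd.mul_right (by exact_mod_cast hpg) _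
      exact hprim p hp e' he'
    have hex : Q.b e x = 1 := by rw [hgψ, hg1, hx]; rfl
    refine ⟨e, x - Q.q x • e, hqe, ?_, ?_⟩
    · rw [Q.q_sub, Q.q_smul, map_smul, hqe, Q.sym x e, hex]; simp
    · rw [map_sub, map_smul, hex, Q.hq, hqe]; simp
  · obtain ⟨k, e, hk, hk0, hprim⟩ := exists_primitive Q hone
    have hqe : Q.q e = 0 := by
      rw [hk, Q.q_smul] at he1
      exact (mul_eq_zero.1 he1).resolve_left (pow_ne_zero _ hk0)
    obtain ⟨g, ψ, hg, hgψ, x, hx⟩ := functional_factor (Q.b e) (by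
      intro h; rw [hk, map_smul, h] at hone; exact hone (by simp))
    have hg1 : g = 1 := by
      by_contra hne
      obtain ⟨p, hp, hpg⟩ := Nat.exists_prime_and_dvd hne
      obtain ⟨e', he'⟩ := hout p hp (by
        intro hpS
        have h1 : (p : ℤ) ∣ Q.b e1 t := by
          rw [hk, map_smul, LinearMap.smul_apply, hgψ, smul_eq_mul]
          exact Dvd.dvd.mul_left (Dvd.dvd.mul_right (by exact_mod_cast hpg) _) _
        exact (Nat.prime_iff_prime_int.1 hp).not_unit (he1t.isUnit_of_dvd' h1 (hSP p hpS))) e fun x => by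
        rw [hgψ]; exact Dvd.dvd.mul_right (by exact_mod_cast hpg) _
      exact hprim p hp e' he'
    have hex : Q.b e x = 1 := by rw [hgψ, hg1, hx]; rfl
    refine ⟨e, x - Q.q x • e, hqe, ?_, ?_⟩
    · rw [Q.q_sub, Q.q_smul, map_smul, hqe, Q.sym x e, hex]; simp
    · rw [map_sub, map_smul, hex, Q.hq, hqe]; simp

end stageI
end NK

namespace NK
open Matrix

/-- the even integral form of a Gram matrix -/
noncomputable def QG {n : ℕ} (G : Matrix (Fin n) (Fin n) ℤ) (hs : G.IsSymm) (he : ∀ i, 2 ∣ G i i) : QM ℤ (Fin n → ℤ) where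
  b := Matrix.toLinearMap₂' ℤ G
  q := fun x => (x ⬝ᵥ G *ᵥ x) / 2
  sym := fun x y => by
    rw [Matrix.toLinearMap₂'_apply', Matrix.toLinearMap₂'_apply', dotProduct_mulVec, ← mulVec_transpose, hs.eq, dotProduct_comm]
  hq := fun x => by
    rw [Matrix.toLinearMap₂'_apply']
    exact (Int.mul_ediv_cancel' (even_diag hs he x)).symm

lemma QG_b {n : ℕ} {G : Matrix (Fin n) (Fin n) ℤ} {hs : G.IsSymm} {he : ∀ i, 2 ∣ G i i} (x y : Fin n → ℤ) :
    (QG G hs he).b x y = x ⬝ᵥ G *ᵥ y := Matrix.toLinearMap₂'_apply' _ _ _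

lemma uni_dvd {n : ℕ} {G : Matrix (Fin n) (Fin n) ℤ} (hs : G.IsSymm) (hu : IsUnit G.det) {k : ℤ} {e : Fin n → ℤ}
    (h : ∀ x, k ∣ e ⬝ᵥ G *ᵥ x) : ∃ e', e = k • e' := by
  have h1 : ∀ i, k ∣ (G *ᵥ e) i := fun i => by
    have := h (Pi.single i 1)
    rw [dotProduct_mulVec, ← mulVec_transpose, hs.eq, dotProduct_single_one] at this
    exact this
  choose v hv using h1
  refine ⟨G⁻¹ *ᵥ v, ?_⟩
  rw [← mulVec_smul, show k • v = G *ᵥ e by ext i; rw [hv]; rfl, mulVec_mulVec, nonsing_inv_mul _ hu, one_mulVec]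

lemma uni_zero {n : ℕ} {G : Matrix (Fin n) (Fin n) ℤ} (hs : G.IsSymm) (hu : IsUnit G.det) {e : Fin n → ℤ}
    (h : ∀ x, e ⬝ᵥ G *ᵥ x = 0) : e = 0 := by
  obtain ⟨e', h'⟩ := uni_dvd hs hu (k := 0) (e := e) fun x => by rw [h]
  rw [h', zero_smul]

/-- a primitive family and its dual family -/
structure Fam {n : ℕ} (m : ℕ) (G : Matrix (Fin n) (Fin n) ℤ) where
  hs : G.IsSymm
  he : ∀ i, 2 ∣ G i i
  hu : IsUnit G.det
  y : Fin m → Fin n → ℤ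
  ys : Fin m → Fin n → ℤ
  M : Matrix (Fin m) (Fin m) ℤ
  hM : ∀ i j, y i ⬝ᵥ G *ᵥ y j = M i j
  hMd : M.det ≠ 0
  dual : ∀ i j, ys i ⬝ᵥ G *ᵥ y j = if i = j then 1 else 0

lemma exists_fam {m n : ℕ} (G : Matrix (Fin n) (Fin n) ℤ) (hs : G.IsSymm) (he : ∀ i, 2 ∣ G i i) (hu : IsUnit G.det)
    (M : Matrix (Fin m) (Fin m) ℤ) (hMd : M.det ≠ 0) (T : Matrix (Fin n) (Fin m) ℤ)
    (hT : IsPrimitiveLatticeEmbedding M G T) : ∃ F : Fam m G, F.M = M ∧ ∀ i, F.y i = T *ᵥ Pi.single i 1 := by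
  obtain ⟨⟨hinj, hB⟩, hprim⟩ := hT
  obtain ⟨ρ, hρ⟩ := sat_dual (LinearMap.range T.mulVecLin) (by
    intro k x hk hx
    obtain ⟨v, hv⟩ := hx
    obtain ⟨w, hw⟩ := hprim x k hk ⟨v, hv⟩
    exact ⟨w, hw⟩)
  let E : (Fin m → ℤ) ≃ₗ[ℤ] LinearMap.range T.mulVecLin := LinearEquiv.ofInjective T.mulVecLin hinj
  let r : Fin m → (Fin n → ℤ) := fun i k => E.symm (ρ (Pi.single k 1)) i
  have hr : ∀ i x, r i ⬝ᵥ x = E.symm (ρ x) i := by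
    intro i x
    have : x = ∑ k, x k • (Pi.single k 1 : Fin n → ℤ) := by
      ext j; simp [Finset.sum_apply, Pi.single_apply]
    conv_rhs => rw [this]
    simp only [map_sum, map_smul, Finset.sum_apply, Pi.smul_apply, smul_eq_mul, dotProduct, r]
    exact Finset.sum_congr rfl fun _ _ => mul_comm _ _
  refine ⟨⟨hs, he, hu, fun i => T *ᵥ Pi.single i 1, fun i => G⁻¹ *ᵥ r i, M, ?_, hMd, ?_⟩, rfl, fun i => rfl⟩
  · intro i j
    rw [hB]; simp
  · intro i j
    rw [dotProduct_mulVec, ← mulVec_transpose, hs.eq, mulVec_mulVec, mul_nonsing_inv _ hu, one_mulVec, hr]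
    have h1 : T *ᵥ Pi.single j 1 = (E (Pi.single j 1) : Fin n → ℤ) := rfl
    rw [h1, hρ, LinearEquiv.symm_apply_apply, Pi.single_apply]

namespace Fam
variable {m n : ℕ} {G : Matrix (Fin n) (Fin n) ℤ} (F : Fam m G)

/-- the form -/
noncomputable def Q : QM ℤ (Fin n → ℤ) := QG G F.hs F.he

lemma Qb (x y : Fin n → ℤ) : F.Q.b x y = x ⬝ᵥ G *ᵥ y := QG_b x y

lemma Qdual (i j : Fin m) : F.Q.b (F.ys i) (F.y j) = if i = j then 1 else 0 := by rw [Qb, F.dual]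

lemma QM_y (i j : Fin m) : F.Q.b (F.y i) (F.y j) = F.M i j := by rw [Qb, F.hM]

/-- orthogonal complement -/
noncomputable def T : Submodule ℤ (Fin n → ℤ) where
  carrier := {x | ∀ i, F.Q.b x (F.y i) = 0}
  add_mem' := fun {a b} ha hb i => by rw [map_add, LinearMap.add_apply, ha i, hb i, add_zero]
  zero_mem' := fun i => by simp
  smul_mem' := fun k x hx i => by rw [map_smul, LinearMap.smul_apply, hx i, smul_zero]

lemma mem_T {x} : x ∈ F.T ↔ ∀ i, F.Q.b x (F.y i) = 0 := Iff.rfl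

/-- projection to the complement -/
noncomputable def π (x : Fin n → ℤ) : Fin n → ℤ := x - ∑ i, F.Q.b x (F.y i) • F.ys i

lemma π_mem (x) : F.π x ∈ F.T := by
  intro j
  simp only [π, map_sub, map_sum, map_smul, LinearMap.sub_apply, LinearMap.sum_apply, LinearMap.smul_apply, smul_eq_mul, F.Qdual]
  simp

lemma b_π (e x : Fin n → ℤ) : F.Q.b e (F.π x) = F.Q.b (e - ∑ i, F.Q.b e (F.ys i) • F.y i) x := by
  simp only [π, map_sub, map_sum, map_smul, LinearMap.sub_apply, LinearMap.sum_apply, LinearMap.smul_apply, smul_eq_mul, F.Q.sym (F.y _) x]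
  congr 1
  exact Finset.sum_congr rfl fun _ _ => mul_comm _ _

lemma T_nd {e} (he : e ∈ F.T) (h : ∀ t ∈ F.T, F.Q.b e t = 0) : e = 0 := by
  have h1 : e - ∑ i, F.Q.b e (F.ys i) • F.y i = 0 := uni_zero F.hs F.hu fun x => by
    rw [← F.Qb, ← F.b_π, h _ (F.π_mem x)]
  have h2 : F.M *ᵥ (fun i => F.Q.b e (F.ys i)) = 0 := by
    ext j
    have := he j
    rw [sub_eq_zero.1 h1] at this
    simp only [map_sum, map_smul, LinearMap.sum_apply, LinearMap.smul_apply, F.Q.sym _ (F.y j), F.QM_y, smul_eq_mul] at this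
    rw [mulVec, dotProduct]
    simp only [Pi.zero_apply]
    rw [← this]
    exact Finset.sum_congr rfl fun _ _ => mul_comm _ _
  have h3 := Matrix.eq_zero_of_mulVec_eq_zero F.hMd h2
  rw [sub_eq_zero.1 h1]
  exact Finset.sum_eq_zero fun i _ => by rw [show F.Q.b e (F.ys i) = 0 from congrFun h3 i, zero_smul]

lemma T_out {p : ℕ} (hp : p.Prime) (hpD : ¬ (p : ℤ) ∣ F.M.det) {e} (he : e ∈ F.T) (h : ∀ t ∈ F.T, (p : ℤ) ∣ F.Q.b e t) :
    ∃ e' ∈ F.T, e = (p : ℤ) • e' := by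
  have hp0 : (p : ℤ) ≠ 0 := by exact_mod_cast hp.ne_zero
  obtain ⟨e1, he1⟩ : ∃ e1, e - ∑ i, F.Q.b e (F.ys i) • F.y i = (p : ℤ) • e1 := uni_dvd F.hs F.hu fun x => by
    rw [← F.Qb, ← F.b_π]; exact h _ (F.π_mem x)
  set c : Fin m → ℤ := fun i => F.Q.b e (F.ys i) with hc
  have h2 : ∀ j, (p : ℤ) ∣ (F.M *ᵥ c) j := by
    intro j
    have h3 : (F.M *ᵥ c) j = F.Q.b (∑ i, c i • F.y i) (F.y j) := by
      simp only [map_sum, map_smul, LinearMap.sum_apply, LinearMap.smul_apply, F.Q.sym _ (F.y j), F.QM_y, smul_eq_mul, mulVec, dotProduct]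
      exact Finset.sum_congr rfl fun _ _ => mul_comm _ _
    have h4 : ∑ i, c i • F.y i = e - (p : ℤ) • e1 := by rw [← he1]; simp [hc]
    rw [h3, h4, map_sub, LinearMap.sub_apply, he j, map_smul, LinearMap.smul_apply, zero_sub, smul_eq_mul]
    exact (Dvd.intro _ rfl).neg_right
  choose v hv using h2
  have h3 : ∀ i, (p : ℤ) ∣ c i := by
    intro i
    have h5 : F.M.adjugate *ᵥ (F.M *ᵥ c) = F.M.det • c := by
      rw [mulVec_mulVec, adjugate_mul, smul_mulVec, one_mulVec]
    have h6 : F.M *ᵥ c = (p : ℤ) • v := by ext j; rw [hv]; rfl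
    rw [h6, mulVec_smul] at h5
    have h7 := congrFun h5 i
    simp only [Pi.smul_apply, smul_eq_mul] at h7
    have h8 : (p : ℤ) ∣ F.M.det * c i := by rw [← h7]; exact Dvd.intro _ rfl
    exact ((Nat.prime_iff_prime_int.1 hp).dvd_or_dvd h8).resolve_left hpD
  choose w hw using h3
  have hfin : e = (p : ℤ) • (e1 + ∑ i, w i • F.y i) := by
    rw [smul_add, ← he1, Finset.smul_sum]
    simp only [smul_smul, ← hw]
    simp [hc]
  refine ⟨_, fun j => ?_, hfin⟩
  have := he j
  rw [hfin, map_smul, LinearMap.smul_apply, smul_eq_mul] at this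
  exact (mul_eq_zero.1 this).resolve_left hp0

end Fam
end NK

namespace NK
open Matrix
namespace Fam
variable {m n : ℕ} {G : Matrix (Fin n) (Fin n) ℤ} (F : Fam m G)

lemma exists_compl_sub {K V : Type*} [Field K] [AddCommGroup V] [Module K V] [FiniteDimensional K V] (A B : Submodule K V) (h : A ≤ B) :
    ∃ C : Submodule K V, C ≤ B ∧ A ⊓ C = ⊥ ∧ B = A ⊔ C ∧ Module.finrank K A + Module.finrank K C = Module.finrank K B := by
  obtain ⟨C, hC⟩ := exists_isCompl A
  have h1 : A ⊓ (C ⊓ B) = ⊥ := by rw [← inf_assoc, hC.inf_eq_bot, bot_inf_eq]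
  have h2 : B = A ⊔ (C ⊓ B) := by
    rw [← sup_inf_assoc_of_le C h, hC.sup_eq_top, top_inf_eq]
  refine ⟨C ⊓ B, inf_le_right, h1, h2, ?_⟩
  have := Submodule.finrank_sup_add_finrank_inf_eq A (C ⊓ B)
  rw [h1, finrank_bot, ← h2] at this
  omega

lemma loc (h2 : 2 * m + 2 ≤ n) (p : ℕ) [hp : Fact p.Prime]
    (hH : ∃ H : Submodule (ZMod p) (Fin n → ZMod p), n ≤ 2 * Module.finrank (ZMod p) H ∧
      (∀ x y : Fin n → ℤ, cv _ x ∈ H → cv _ y ∈ H → (p : ℤ) ∣ x ⬝ᵥ G *ᵥ y) ∧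
      (∀ x : Fin n → ℤ, cv _ x ∈ H → (2 * p : ℤ) ∣ x ⬝ᵥ G *ᵥ x)) :
    ∃ z ∈ F.T, ∃ t ∈ F.T, (p : ℤ) ∣ F.Q.q z ∧ ¬ (p : ℤ) ∣ F.Q.b z t := by
  obtain ⟨H, hHd, hH1, hH2⟩ := hH
  set B := mform (G.map (Int.cast : ℤ → ZMod p)) with hB
  have hBs : Sym B := mform_sym (by rw [IsSymm, ← transpose_map, F.hs.eq])
  have hBn : Nd B := by
    apply mform_nd
    · rw [IsSymm, ← transpose_map, F.hs.eq]
    · have : (G.map (Int.cast : ℤ → ZMod p)).det = (G.det : ZMod p) := (Int.cast_det G).symm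
      rw [this]
      exact (F.hu.map (Int.castRingHom (ZMod p))).ne_zero
  have hBc : ∀ x y : Fin n → ℤ, B (cv _ x) (cv _ y) = (F.Q.b x y : ZMod p) := by
    intro x y; rw [hB, mform_apply, cv_dot, F.Qb]
  -- the quadratic form mod p
  have hq0 : ∀ x y : Fin n → ℤ, cv (ZMod p) x = cv (ZMod p) y → (F.Q.q x : ZMod p) = F.Q.q y := by
    intro x y hxy
    obtain ⟨u, rfl⟩ := lift_of_mod hxy
    rw [F.Q.q_add, F.Q.q_smul, map_smul, smul_eq_mul]
    push_cast; simp
  choose lf hlf using fun x : Fin n → ZMod p => cv_surj x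
  let qb : (Fin n → ZMod p) → ZMod p := fun x => F.Q.q (lf x)
  have hqc : ∀ x : Fin n → ℤ, qb (cv _ x) = F.Q.q x := fun x => hq0 _ _ (hlf _)
  have hqadd : ∀ x y, qb (x + y) = qb x + qb y + B x y := by
    intro x y
    obtain ⟨x, rfl⟩ := cv_surj x
    obtain ⟨y, rfl⟩ := cv_surj y
    rw [← cv_add, hqc, hqc, hqc, hBc, F.Q.q_add]; push_cast; rfl
  have hqsmul : ∀ (a : ZMod p) x, qb (a • x) = a ^ 2 * qb x := by
    intro a x
    obtain ⟨x, rfl⟩ := cv_surj x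
    obtain ⟨a, rfl⟩ := ZMod.intCast_surjective a
    rw [← cv_smul, hqc, hqc, F.Q.q_smul]; push_cast; rfl
  have hqzero : qb 0 = 0 := by
    have := hqsmul 0 0
    rw [zero_smul] at this
    rw [this]; ring
  have hHti : ∀ x ∈ H, ∀ y ∈ H, B x y = 0 := by
    intro x hx y hy
    obtain ⟨x, rfl⟩ := cv_surj x
    obtain ⟨y, rfl⟩ := cv_surj y
    rw [hBc, ZMod.intCast_zmod_eq_zero_iff_dvd, F.Qb]
    exact hH1 x y hx hy
  have hHq : ∀ x ∈ H, qb x = 0 := by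
    intro x hx
    obtain ⟨x, rfl⟩ := cv_surj x
    rw [hqc, ZMod.intCast_zmod_eq_zero_iff_dvd]
    have h1 := hH2 x hx
    rw [← F.Qb, F.Q.hq] at h1
    exact (mul_dvd_mul_iff_left two_ne_zero).1 h1
  -- subspaces
  let Y : Submodule (ZMod p) (Fin n → ZMod p) := Submodule.span _ (Set.range fun i => cv _ (F.y i))
  have hYd : Module.finrank (ZMod p) Y ≤ m := by
    have := finrank_range_le_card (R := ZMod p) (b := fun i : Fin m => cv (ZMod p) (F.y i))
    rw [Fintype.card_fin] at this
    exact this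
  have hYperp : ∀ x, (∀ i, B x (cv _ (F.y i)) = 0) → ∀ y ∈ Y, B x y = 0 := by
    intro x hx y hy
    induction hy using Submodule.span_induction with
    | mem y hy => obtain ⟨i, rfl⟩ := hy; exact hx i
    | zero => simp
    | add a b _ _ ha hb => rw [map_add, ha, hb, add_zero]
    | smul a b _ hb => rw [map_smul, hb, smul_zero]
  let R0 : Submodule (ZMod p) (Fin n → ZMod p) :=
    { carrier := {x | x ∈ Y ∧ (∀ y ∈ Y, B x y = 0) ∧ qb x = 0}
      add_mem' := by
        rintro a b ⟨h1, h2, h3⟩ ⟨h4, h5, h6⟩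
        refine ⟨Y.add_mem h1 h4, fun y hy => by rw [map_add, LinearMap.add_apply, h2 y hy, h5 y hy, add_zero], ?_⟩
        rw [hqadd, h3, h6, h2 b h4]; ring
      zero_mem' := ⟨Y.zero_mem, by simp, hqzero⟩
      smul_mem' := by
        rintro a x ⟨h1, h2, h3⟩
        refine ⟨Y.smul_mem _ h1, fun y hy => by rw [map_smul, LinearMap.smul_apply, h2 y hy, smul_zero], ?_⟩
        rw [hqsmul, h3, mul_zero] }
  have hR0 : ∀ x, x ∈ R0 ↔ (x ∈ Y ∧ (∀ y ∈ Y, B x y = 0) ∧ qb x = 0) := fun x => Iff.rfl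
  have hR0Y : R0 ≤ Y := fun x hx => hx.1
  obtain ⟨R1, hR1, hR1a, hR1b, hR1c⟩ := exists_compl_sub (H ⊓ R0) R0 inf_le_right
  obtain ⟨P, hP1, hP2, -, hP4⟩ := finrank_ortho_ge B R1 H
  have hPR : ∀ x ∈ P, ∀ y ∈ R0, B x y = 0 := by
    intro x hx y hy
    rw [hR1b] at hy
    obtain ⟨a, ha, b, hb, rfl⟩ := Submodule.mem_sup.1 hy
    rw [map_add, hHti x (hP1 hx) a ha.1, hP2 b hb x hx, add_zero]
  have hPR1 : P ⊓ R1 = ⊥ := by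
    rw [eq_bot_iff, ← hR1a]
    rintro x ⟨h3, h4⟩
    exact ⟨⟨hP1 h3, hR1 h4⟩, h4⟩
  set H' := P ⊔ R1 with hH'
  have hH'd : Module.finrank (ZMod p) H ≤ Module.finrank (ZMod p) H' := by
    have := Submodule.finrank_sup_add_finrank_inf_eq P R1
    rw [← hH', hPR1, finrank_bot] at this
    omega
  have hH'q : ∀ x ∈ H', qb x = 0 := by
    intro x hx
    obtain ⟨a, ha, b, hb, rfl⟩ := Submodule.mem_sup.1 hx
    rw [hqadd, hHq a (hP1 ha), ((hR0 b).1 (hR1 hb)).2.2, hPR a ha b (hR1 hb)]; ring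
  have hH'R : ∀ x ∈ H', ∀ y ∈ R0, B x y = 0 := by
    intro x hx y hy
    obtain ⟨a, ha, b, hb, rfl⟩ := Submodule.mem_sup.1 hx
    rw [map_add, LinearMap.add_apply, hPR a ha y hy, ((hR0 b).1 (hR1 hb)).2.1 y (hR0Y hy), add_zero]
  obtain ⟨Y1, hY1, -, hY1b, hY1c⟩ := exists_compl_sub R0 Y hR0Y
  obtain ⟨Z, hZ1, hZ2, -, hZ4⟩ := finrank_ortho_ge B Y1 H'
  have hZY : ∀ z ∈ Z, ∀ y ∈ Y, B z y = 0 := by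
    intro z hz y hy
    rw [hY1b] at hy
    obtain ⟨a, ha, b, hb, rfl⟩ := Submodule.mem_sup.1 hy
    rw [map_add, hH'R z (hZ1 hz) a ha, hZ2 b hb z hz, add_zero]
  obtain ⟨z, hz, hzR⟩ : ∃ z ∈ Z, z ∉ R0 := by
    by_contra hcon
    push Not at hcon
    have : Z ≤ R0 := hcon
    have := Submodule.finrank_mono this
    omega
  have hzY : z ∉ Y := fun hzY => hzR ⟨hzY, hZY z hz, hH'q z (hZ1 hz)⟩
  -- lifting
  have lift : ∀ x : Fin n → ZMod p, (∀ y ∈ Y, B x y = 0) → ∃ x' ∈ F.T, cv _ x' = x := by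
    intro x hx
    refine ⟨F.π (lf x), F.π_mem _, ?_⟩
    rw [π, cv_sub, cv_sum, hlf, sub_eq_self]
    refine Finset.sum_eq_zero fun i _ => ?_
    rw [cv_smul, ← hBc, hlf, hx _ (Submodule.subset_span ⟨i, rfl⟩), zero_smul]
  obtain ⟨z', hz'T, rfl⟩ := lift z (hZY z hz)
  refine ⟨z', hz'T, ?_⟩
  have hqz : (p : ℤ) ∣ F.Q.q z' := by
    rw [← ZMod.intCast_zmod_eq_zero_iff_dvd, ← hqc]; exact hH'q _ (hZ1 hz)
  by_contra hcon
  push Not at hcon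
  have hall : ∀ t ∈ F.T, (p : ℤ) ∣ F.Q.b z' t := fun t ht => hcon t ht hqz
  apply hzY
  have h0 : cv (ZMod p) (z' - ∑ i, F.Q.b z' (F.ys i) • F.y i) = 0 := by
    apply hBn
    intro x
    obtain ⟨x, rfl⟩ := cv_surj x
    rw [hBc, ← F.b_π, ZMod.intCast_zmod_eq_zero_iff_dvd]
    exact hall _ (F.π_mem x)
  rw [cv_sub, sub_eq_zero] at h0
  rw [h0, cv_sum]
  refine Submodule.sum_mem _ fun i _ => ?_
  rw [cv_smul]
  exact Y.smul_mem _ (Submodule.subset_span ⟨i, rfl⟩)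

/-- hyperbolic pair orthogonal to the family -/
theorem pair (h2 : 2 * m + 2 ≤ n)
    (hH : ∀ (p : ℕ) [Fact p.Prime], ∃ H : Submodule (ZMod p) (Fin n → ZMod p), n ≤ 2 * Module.finrank (ZMod p) H ∧
      (∀ x y : Fin n → ℤ, cv _ x ∈ H → cv _ y ∈ H → (p : ℤ) ∣ x ⬝ᵥ G *ᵥ y) ∧
      (∀ x : Fin n → ℤ, cv _ x ∈ H → (2 * p : ℤ) ∣ x ⬝ᵥ G *ᵥ x))
    (hiso : ∃ e ∈ F.T, e ≠ 0 ∧ F.Q.q e = 0) :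
    ∃ e ∈ F.T, ∃ f ∈ F.T, F.Q.q e = 0 ∧ F.Q.q f = 0 ∧ F.Q.b e f = 1 := by
  let QT : QM ℤ F.T := ⟨(F.Q.b.comp F.T.subtype).compl₂ F.T.subtype, fun x => F.Q.q x, fun x y => F.Q.sym _ _, fun x => F.Q.hq _⟩
  have hb : ∀ x y : F.T, QT.b x y = F.Q.b x y := fun _ _ => rfl
  obtain ⟨e0, he0, he00, heq⟩ := hiso
  obtain ⟨e, f, h3, h4, h5⟩ := hyperbolic_pair QT F.M.det.natAbs.primeFactors (fun p hp => Nat.prime_of_mem_primeFactors hp)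
    (fun e he => by
      by_contra hcon
      push Not at hcon
      exact he (Subtype.ext (F.T_nd e.2 fun t ht => hcon ⟨t, ht⟩))) ⟨e0, he0⟩ (fun h => he00 (congrArg Subtype.val h)) heq
    (fun p hp => by
      haveI : Fact p.Prime := ⟨Nat.prime_of_mem_primeFactors hp⟩
      obtain ⟨z, hz, t, ht, h⟩ := F.loc h2 p (hH p)
      exact ⟨⟨z, hz⟩, ⟨t, ht⟩, h⟩)
    (fun p hp hpS e he => by
      obtain ⟨e', he', h⟩ := F.T_out hp (fun hd => hpS (by
        rw [Nat.mem_primeFactors]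
        exact ⟨hp, Int.natCast_dvd.1 hd, Int.natAbs_ne_zero.2 F.hMd⟩)) e.2 (fun t ht => he ⟨t, ht⟩)
      exact ⟨⟨e', he'⟩, Subtype.ext h⟩)
  exact ⟨e, e.2, f, f.2, h3, h4, h5⟩

end Fam
end NK

namespace NK

/-- the integers inside ℚ -/
def Zs : Subring ℚ := (Int.castRingHom ℚ).range

lemma mem_Zs {r : ℚ} : r ∈ Zs ↔ ∃ k : ℤ, r = k := by
  constructor
  · rintro ⟨k, rfl⟩; exact ⟨k, rfl⟩
  · rintro ⟨k, rfl⟩; exact ⟨k, rfl⟩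

lemma int_mem (k : ℤ) : (k : ℚ) ∈ Zs := ⟨k, rfl⟩

variable {V : Type*} [AddCommGroup V] [Module ℚ V]

/-- even self-dual lattice -/
structure Lat (Q : QM ℚ V) (L : AddSubgroup V) : Prop where
  even : ∀ x ∈ L, Q.q x ∈ Zs
  dual : ∀ x, (∀ y ∈ L, Q.b x y ∈ Zs) → x ∈ L

lemma zmem {L : AddSubgroup V} {r : ℚ} (hr : r ∈ Zs) {x : V} (hx : x ∈ L) : r • x ∈ L := by
  obtain ⟨k, rfl⟩ := mem_Zs.1 hr
  rw [Int.cast_smul_eq_zsmul]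
  exact L.zsmul_mem hx k

lemma Lat.int {Q : QM ℚ V} {L : AddSubgroup V} (h : Lat Q L) {x y : V} (hx : x ∈ L) (hy : y ∈ L) : Q.b x y ∈ Zs := by
  have : Q.b x y = Q.q (x + y) - Q.q x - Q.q y := by rw [Q.q_add]; ring
  rw [this]
  exact sub_mem (sub_mem (h.even _ (add_mem hx hy)) (h.even _ hx)) (h.even _ hy)

lemma isom_b {Q : QM ℚ V} {g : V ≃ₗ[ℚ] V} (hg : ∀ x, Q.q (g x) = Q.q x) (x y : V) : Q.b (g x) (g y) = Q.b x y := by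
  have h := hg (x + y)
  rw [map_add, Q.q_add, Q.q_add, hg, hg] at h
  linarith

lemma isom_symm {Q : QM ℚ V} {g : V ≃ₗ[ℚ] V} (hg : ∀ x, Q.q (g x) = Q.q x) (x : V) : Q.q (g.symm x) = Q.q x := by
  rw [← hg, g.apply_symm_apply]

/-- the image lattice -/
def img (g : V ≃ₗ[ℚ] V) (L : AddSubgroup V) : AddSubgroup V := L.comap (g.symm : V →+ V)

lemma mem_img {g : V ≃ₗ[ℚ] V} {L : AddSubgroup V} {x : V} : x ∈ img g L ↔ g.symm x ∈ L := Iff.rfl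

lemma Lat.img {Q : QM ℚ V} {L : AddSubgroup V} (h : Lat Q L) {g : V ≃ₗ[ℚ] V} (hg : ∀ x, Q.q (g x) = Q.q x) : Lat Q (img g L) where
  even := fun x hx => by rw [← isom_symm hg]; exact h.even _ hx
  dual := fun x hx => by
    rw [mem_img]
    apply h.dual
    intro y hy
    have := hx (g y) (by rw [mem_img, g.symm_apply_apply]; exact hy)
    rw [← isom_b (isom_symm hg), g.symm_apply_apply] at this
    exact this

/-- hyperbolic rotation -/
def rotL (Q : QM ℚ V) (e f : V) (k : ℚ) : V →ₗ[ℚ] V :=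
  LinearMap.id + (k - 1) • (Q.b f).smulRight e + (k⁻¹ - 1) • (Q.b e).smulRight f

lemma rotL_apply (Q : QM ℚ V) (e f : V) (k : ℚ) (x : V) : rotL Q e f k x = x + ((k - 1) * Q.b f x) • e + ((k⁻¹ - 1) * Q.b e x) • f := by
  simp [rotL, smul_smul]

lemma rotL_comp {Q : QM ℚ V} {e f : V} (he : Q.q e = 0) (hf : Q.q f = 0) (hef : Q.b e f = 1) {k : ℚ} (hk : k ≠ 0) (x : V) :
    rotL Q e f k (rotL Q e f k⁻¹ x) = x := by
  have hfe : Q.b f e = 1 := by rw [Q.sym, hef]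
  have hee : Q.b e e = 0 := by rw [Q.hq, he, mul_zero]
  have hff : Q.b f f = 0 := by rw [Q.hq, hf, mul_zero]
  simp only [rotL_apply, map_add, map_smul, smul_eq_mul, hfe, hee, hff, hef, inv_inv]
  have c1 : (k - 1) * Q.b f x + (k⁻¹ - 1) * Q.b f x * (1 + (k - 1)) = 0 := by
    field_simp; ring
  have c2 : (k⁻¹ - 1) * Q.b e x + (k - 1) * Q.b e x * (1 + (k⁻¹ - 1)) = 0 := by
    field_simp; ring
  trans x + ((k - 1) * Q.b f x + (k⁻¹ - 1) * Q.b f x * (1 + (k - 1))) • e + ((k⁻¹ - 1) * Q.b e x + (k - 1) * Q.b e x * (1 + (k⁻¹ - 1))) • f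
  · module
  · rw [c1, c2]; simp

/-- hyperbolic rotation -/
def rot (Q : QM ℚ V) {e f : V} (he : Q.q e = 0) (hf : Q.q f = 0) (hef : Q.b e f = 1) {k : ℚ} (hk : k ≠ 0) : V ≃ₗ[ℚ] V :=
  LinearEquiv.ofLinear (rotL Q e f k) (rotL Q e f k⁻¹) (by ext x; exact rotL_comp he hf hef hk x)
    (by ext x; have := rotL_comp he hf hef (inv_ne_zero hk) x; rw [inv_inv] at this; exact this)

lemma rot_q (Q : QM ℚ V) {e f : V} (he : Q.q e = 0) (hf : Q.q f = 0) (hef : Q.b e f = 1) {k : ℚ} (hk : k ≠ 0) (x : V) :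
    Q.q (rot Q he hf hef hk x) = Q.q x := by
  change Q.q (rotL Q e f k x) = _
  rw [rotL_apply]
  simp only [Q.q_add, Q.q_smul, he, hf, map_add, map_smul, LinearMap.add_apply, LinearMap.smul_apply, smul_eq_mul, hef, Q.sym x e, Q.sym x f]
  field_simp
  ring

section neighbor
variable {Q : QM ℚ V} {m : ℕ} (y : Fin m → V)

/-- existence of a better hyperbolic pair -/
lemma better_pair {Λ : AddSubgroup V} (hΛ : Lat Q Λ) (hy : ∀ i, y i ∈ Λ) {D : ℤ}
    (hD : ∀ x : V, (∀ j, Q.b x (y j) ∈ Zs) → ∃ c : Fin m → ℤ, ∀ j, Q.b ((D : ℚ) • x - ∑ i, (c i : ℚ) • y i) (y j) = 0)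
    {e f : V} (heΛ : e ∈ Λ) (hfΛ : f ∈ Λ) (he : Q.q e = 0) (hf : Q.q f = 0) (hef : Q.b e f = 1)
    (hey : ∀ i, Q.b e (y i) = 0) (hfy : ∀ i, Q.b f (y i) = 0)
    {p : ℕ} (hp : p.Prime) (hpD : ¬ (p : ℤ) ∣ D) {x : V} (hx : x ∉ Λ) (hpx : (p : ℚ) • x ∈ Λ) (hxy : ∀ i, Q.b x (y i) = 0) :
    ∃ e f, e ∈ Λ ∧ f ∈ Λ ∧ Q.q e = 0 ∧ Q.q f = 0 ∧ Q.b e f = 1 ∧ (∀ i, Q.b e (y i) = 0) ∧ (∀ i, Q.b f (y i) = 0) ∧ Q.b x e ∉ Zs := by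
  have hfe : Q.b f e = 1 := by rw [Q.sym, hef]
  by_cases h1 : Q.b x e ∈ Zs
  · by_cases h2 : Q.b x f ∈ Zs
    · obtain ⟨u, hu, huy, hue, huf, hxu⟩ : ∃ u ∈ Λ, (∀ i, Q.b u (y i) = 0) ∧ Q.b u e = 0 ∧ Q.b u f = 0 ∧ Q.b x u ∉ Zs := by
        by_contra hcon
        push Not at hcon
        apply hx
        apply hΛ.dual
        intro v hv
        obtain ⟨c, hc⟩ := hD v fun j => hΛ.int hv (hy j)
        set t := (D : ℚ) • v - ∑ i, (c i : ℚ) • y i with ht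
        have htΛ : t ∈ Λ := sub_mem (zmem (int_mem D) hv) (sum_mem fun i _ => zmem (int_mem _) (hy i))
        have hee : Q.b e e = 0 := by rw [Q.hq, he, mul_zero]
        have hff : Q.b f f = 0 := by rw [Q.hq, hf, mul_zero]
        have h3 := hcon (t - Q.b t f • e - Q.b t e • f)
          (sub_mem (sub_mem htΛ (zmem (hΛ.int htΛ hfΛ) heΛ)) (zmem (hΛ.int htΛ heΛ) hfΛ))
          (fun i => by simp only [map_sub, map_smul, LinearMap.sub_apply, LinearMap.smul_apply, hey, hfy, hc]; simp)
          (by simp only [map_sub, map_smul, LinearMap.sub_apply, LinearMap.smul_apply, hee, hfe, smul_eq_mul]; ring)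
          (by simp only [map_sub, map_smul, LinearMap.sub_apply, LinearMap.smul_apply, hff, hef, smul_eq_mul]; ring)
        simp only [map_sub, map_smul, smul_eq_mul] at h3
        have h4 : Q.b x t ∈ Zs := by
          have := add_mem (add_mem h3 (mul_mem (hΛ.int htΛ hfΛ) h1)) (mul_mem (hΛ.int htΛ heΛ) h2)
          convert this using 1; ring
        rw [ht] at h4
        simp only [map_sub, map_smul, map_sum, hxy, smul_eq_mul, mul_zero, Finset.sum_const_zero, sub_zero] at h4
        have h5 : (p : ℚ) * Q.b x v ∈ Zs := by
          have := hΛ.int hpx hv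
          rwa [map_smul, LinearMap.smul_apply, smul_eq_mul] at this
        obtain ⟨a, b, hab⟩ := ((Prime.coprime_iff_not_dvd (Nat.prime_iff_prime_int.1 hp)).2 hpD)
        have h6 : (a : ℚ) * p + b * D = 1 := by exact_mod_cast hab
        have h7 : Q.b x v = a * (p * Q.b x v) + b * (D * Q.b x v) := by linear_combination (-Q.b x v) * h6
        rw [h7]
        exact add_mem (mul_mem (int_mem a) h5) (mul_mem (int_mem b) h4)
      have hqu := hΛ.even u hu
      refine ⟨e + u - Q.q u • f, f, sub_mem (add_mem heΛ hu) (zmem hqu hfΛ), hfΛ, ?_, hf, ?_, ?_, hfy, ?_⟩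
      · simp only [Q.q_sub, Q.q_add, Q.q_smul, map_add, map_smul, LinearMap.add_apply, smul_eq_mul, he, hf, hef, huf, Q.sym e u, hue]
        ring
      · simp only [map_add, map_sub, map_smul, LinearMap.add_apply, LinearMap.sub_apply, LinearMap.smul_apply, smul_eq_mul, hef, huf, Q.hq, hf]
        ring
      · intro i
        simp only [map_add, map_sub, map_smul, LinearMap.add_apply, LinearMap.sub_apply, LinearMap.smul_apply, smul_eq_mul, hey, hfy, huy]
        ring
      · intro hmem
        apply hxu
        simp only [map_add, map_sub, map_smul, smul_eq_mul] at hmem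
        have := add_mem (sub_mem hmem h1) (mul_mem hqu h2)
        convert this using 1; ring
    · exact ⟨f, e, hfΛ, heΛ, hf, he, hfe, hfy, hey, h2⟩
  · exact ⟨e, f, heΛ, hfΛ, he, hf, hef, hey, hfy, h1⟩

end neighbor
end NK

namespace NK
variable {V : Type*} [AddCommGroup V] [Module ℚ V]

lemma nat_mem (k : ℕ) : (k : ℚ) ∈ Zs := ⟨k, by simp⟩

section neighbor
variable {Q : QM ℚ V} {m : ℕ} (y : Fin m → V)

lemma neighbor_step {L Λ : AddSubgroup V} (hL : Lat Q L) (hΛ : Lat Q Λ) 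
    {e f : V} (heΛ : e ∈ Λ) (hfΛ : f ∈ Λ) (he : Q.q e = 0) (hf : Q.q f = 0) (hef : Q.b e f = 1)
    (hey : ∀ i, Q.b e (y i) = 0) (hfy : ∀ i, Q.b f (y i) = 0)
    {p : ℕ} (hp : p.Prime) {x : V} (hxL : x ∈ L) (hpx : (p : ℚ) • x ∈ Λ) (hxy : ∀ i, Q.b x (y i) = 0)
    (hxe : Q.b x e ∉ Zs) :
    ∃ h : V ≃ₗ[ℚ] V, (∀ v, Q.q (h v) = Q.q v) ∧ (∀ i, h (y i) = y i) ∧ (∀ v ∈ Λ, v ∈ L → v ∈ img h Λ) ∧ x ∈ img h Λ ∧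
      (∀ v ∈ Λ, (p : ℚ) • v ∈ img h Λ) := by
  have hfe : Q.b f e = 1 := by rw [Q.sym, hef]
  have hee : Q.b e e = 0 := by rw [Q.hq, he, mul_zero]
  have hff : Q.b f f = 0 := by rw [Q.hq, hf, mul_zero]
  have hp0 : (p : ℚ) ≠ 0 := by exact_mod_cast hp.ne_zero
  obtain ⟨a, ha⟩ := mem_Zs.1 (hΛ.int hpx hfΛ)
  obtain ⟨b, hb⟩ := mem_Zs.1 (hΛ.int hpx heΛ)
  obtain ⟨r, hr⟩ := mem_Zs.1 (hL.even x hxL)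
  have hpb : ¬ (p : ℤ) ∣ b := by
    rintro ⟨k, hk⟩
    apply hxe
    rw [map_smul, LinearMap.smul_apply, smul_eq_mul, hk] at hb
    push_cast at hb
    rw [mul_left_cancel₀ hp0 hb]
    exact int_mem k
  obtain ⟨c, k0, hck⟩ : IsCoprime b ((p : ℤ) ^ 2) :=
    (IsCoprime.symm ((Prime.coprime_iff_not_dvd (Nat.prime_iff_prime_int.1 hp)).2 hpb)).pow_right
  have hcp : IsCoprime c (p : ℤ) := ⟨b, k0 * p, by linear_combination hck⟩
  have hckq : (c : ℚ) * b + k0 * (p : ℚ) ^ 2 = 1 := by exact_mod_cast hck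
  obtain ⟨w, hw⟩ : ∃ w, w = (p : ℚ) • x - (a : ℚ) • e - (b : ℚ) • f := ⟨_, rfl⟩
  have hwΛ : w ∈ Λ := by
    rw [hw]; exact sub_mem (sub_mem hpx (zmem (int_mem _) heΛ)) (zmem (int_mem _) hfΛ)
  rw [map_smul, LinearMap.smul_apply, smul_eq_mul] at ha hb
  have hwe : Q.b w e = 0 := by
    rw [hw]
    simp only [map_sub, map_smul, LinearMap.sub_apply, LinearMap.smul_apply, smul_eq_mul, hee, hfe, hb]; ring
  have hwf : Q.b w f = 0 := by
    rw [hw]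
    simp only [map_sub, map_smul, LinearMap.sub_apply, LinearMap.smul_apply, smul_eq_mul, hff, hef, ha]; ring
  have hwy : ∀ i, Q.b w (y i) = 0 := by
    intro i
    rw [hw]
    simp only [map_sub, map_smul, LinearMap.sub_apply, LinearMap.smul_apply, smul_eq_mul, hxy, hey, hfy]; ring
  have hqw : Q.q w = (p : ℚ) ^ 2 * r - a * b := by
    have h1 : (p : ℚ) • x = w + (a : ℚ) • e + (b : ℚ) • f := by rw [hw]; module
    have h2 := congrArg Q.q h1
    simp only [Q.q_add, Q.q_smul, map_add, map_smul, LinearMap.add_apply, LinearMap.smul_apply, smul_eq_mul, hwe, hwf, he, hf, hef, hr] at h2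
    linear_combination -h2
  have hqwZ := hΛ.even w hwΛ
  obtain ⟨g, hg⟩ : ∃ g, g = f + (c : ℚ) • w - ((c : ℚ) ^ 2 * Q.q w) • e := ⟨_, rfl⟩
  have hgΛ : g ∈ Λ := by
    rw [hg]
    exact sub_mem (add_mem hfΛ (zmem (int_mem _) hwΛ)) (zmem (mul_mem (pow_mem (int_mem _) 2) hqwZ) heΛ)
  have hgq : Q.q g = 0 := by
    rw [hg]
    simp only [Q.q_sub, Q.q_add, Q.q_smul, map_add, map_smul, LinearMap.add_apply, LinearMap.smul_apply, smul_eq_mul, he, hf, hfe, hwe, Q.sym f w, hwf]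
    ring
  have heg : Q.b e g = 1 := by
    rw [hg]
    simp only [map_add, map_sub, map_smul, smul_eq_mul, hef, hee, Q.sym e w, hwe]
    ring
  have hgy : ∀ i, Q.b g (y i) = 0 := by
    intro i
    rw [hg]
    simp only [map_add, map_sub, map_smul, LinearMap.add_apply, LinearMap.sub_apply, LinearMap.smul_apply, smul_eq_mul, hwy, hey, hfy]; ring
  obtain ⟨l, hl⟩ : ∃ l, l = (-(k0 : ℚ)) • f + ((c : ℚ) * a * k0 + (c : ℚ) ^ 2 * r) • e := ⟨_, rfl⟩
  have hlΛ : l ∈ Λ := by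
    rw [hl]
    exact add_mem (zmem (neg_mem (int_mem _)) hfΛ) (zmem (add_mem (mul_mem (mul_mem (int_mem _) (int_mem _)) (int_mem _)) (mul_mem (pow_mem (int_mem _) 2) (int_mem _))) heΛ)
  have hcz : ((c : ℚ) * p) • x = g + ((p : ℚ) ^ 2) • l := by
    have h1 : (p : ℚ) • x = w + (a : ℚ) • e + (b : ℚ) • f := by rw [hw]; module
    rw [mul_smul, h1, hg, hl, hqw]
    have c1 : (c : ℚ) * a = -((c : ℚ) ^ 2 * ((p : ℚ) ^ 2 * r - a * b)) + (p : ℚ) ^ 2 * ((c : ℚ) * a * k0 + (c : ℚ) ^ 2 * r) := by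
      linear_combination (-(c : ℚ) * a) * hckq
    have c2 : (c : ℚ) * b = 1 + (p : ℚ) ^ 2 * (-k0) := by linear_combination hckq
    trans (c : ℚ) • w + ((c : ℚ) * a) • e + ((c : ℚ) * b) • f
    · module
    trans (c : ℚ) • w + (-((c : ℚ) ^ 2 * ((p : ℚ) ^ 2 * r - a * b)) + (p : ℚ) ^ 2 * ((c : ℚ) * a * k0 + (c : ℚ) ^ 2 * r)) • e + (1 + (p : ℚ) ^ 2 * (-k0)) • f
    · rw [← c1, ← c2]
    · module
  have hsymm : ∀ v, (rot Q he hgq heg hp0).symm v = v + (((p : ℚ)⁻¹ - 1) * Q.b g v) • e + (((p : ℚ) - 1) * Q.b e v) • g := by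
    intro v
    change rotL Q e g (p : ℚ)⁻¹ v = _
    rw [rotL_apply, inv_inv]
  have key : ∀ v ∈ Λ, (p : ℚ)⁻¹ * Q.b g v ∈ Zs → v ∈ img (rot Q he hgq heg hp0) Λ := by
    intro v hv h
    rw [mem_img, hsymm]
    refine add_mem (add_mem hv (zmem ?_ heΛ)) (zmem (mul_mem (sub_mem (nat_mem p) (one_mem _)) (hΛ.int heΛ hv)) hgΛ)
    rw [sub_mul, one_mul]
    exact sub_mem h (hΛ.int hgΛ hv)
  have hpΛ : ∀ v ∈ Λ, (p : ℚ) • v ∈ img (rot Q he hgq heg hp0) Λ := by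
    intro v hv
    apply key _ (zmem (nat_mem p) hv)
    rw [map_smul, smul_eq_mul, inv_mul_cancel_left₀ hp0]
    exact hΛ.int hgΛ hv
  have hΛL : ∀ v ∈ Λ, v ∈ L → v ∈ img (rot Q he hgq heg hp0) Λ := by
    intro v hv hvL
    apply key v hv
    have h1 : Q.b g v = ((c : ℚ) * p) * Q.b x v - (p : ℚ) ^ 2 * Q.b l v := by
      have := congrArg (fun t => Q.b t v) hcz
      simp only [map_add, map_smul, LinearMap.add_apply, LinearMap.smul_apply, smul_eq_mul] at this
      linear_combination -this
    have h2 : (p : ℚ)⁻¹ * Q.b g v = (c : ℚ) * Q.b x v - (p : ℚ) * Q.b l v := by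
      rw [h1]; field_simp
    rw [h2]
    exact sub_mem (mul_mem (int_mem _) (hL.int hxL hvL)) (mul_mem (nat_mem p) (hΛ.int hlΛ hv))
  refine ⟨rot Q he hgq heg hp0, rot_q Q he hgq heg hp0, fun i => ?_, hΛL, ?_, hpΛ⟩
  · change rotL Q e g p (y i) = _
    rw [rotL_apply, hey, hgy]; simp
  · have h1 : (c : ℚ) • x ∈ img (rot Q he hgq heg hp0) Λ := by
      have h2 : (c : ℚ) • x = (p : ℚ)⁻¹ • g + (p : ℚ) • l := by
        have h3 : (c : ℚ) • x = (p : ℚ)⁻¹ • ((c : ℚ) * p) • x := by rw [smul_smul]; congr 1; field_simp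
        rw [h3, hcz, smul_add, smul_smul]
        congr 2; field_simp
      rw [h2]
      refine add_mem ?_ (hpΛ l hlΛ)
      rw [mem_img, hsymm, map_smul, map_smul, Q.hq, hgq, heg]
      have : (p : ℚ)⁻¹ • g + (((p : ℚ)⁻¹ - 1) * (p : ℚ)⁻¹ • (2 * 0)) • e + (((p : ℚ) - 1) * (p : ℚ)⁻¹ • 1) • g = g := by
        simp only [smul_eq_mul, mul_zero, zero_smul, add_zero, mul_one]
        rw [← add_smul, show (p : ℚ)⁻¹ + (p - 1) * (p : ℚ)⁻¹ = 1 by field_simp; ring, one_smul]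
      rw [this]; exact hgΛ
    have h3 : (p : ℚ) • x ∈ img (rot Q he hgq heg hp0) Λ := hΛL _ hpx (zmem (nat_mem p) hxL)
    obtain ⟨u, v, huv⟩ := hcp
    have h4 : x = (u : ℚ) • (c : ℚ) • x + (v : ℚ) • (p : ℚ) • x := by
      rw [smul_smul, smul_smul, ← add_smul, show (u : ℚ) * c + v * p = 1 by exact_mod_cast huv, one_smul]
    rw [h4]
    exact add_mem (zmem (int_mem _) h1) (zmem (int_mem _) h3)

lemma exists_prime_mult (Λ : AddSubgroup V) (s : ℕ) : s ≠ 0 → ∀ x : V, (s : ℚ) • x ∈ Λ → x ∉ Λ →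
    ∃ p k : ℕ, p.Prime ∧ p ∣ s ∧ (k : ℚ) • x ∉ Λ ∧ (p : ℚ) • (k : ℚ) • x ∈ Λ := by
  induction s using induction_on_primes with
  | zero => simp
  | one => intro _ x h1 h2; simp at h1; exact absurd h1 h2
  | prime_mul p a hp ih =>
    intro h0 x h1 h2
    by_cases h : (a : ℚ) • x ∈ Λ
    · obtain ⟨r, k, h3, h4, h5⟩ := ih (by rintro rfl; simp at h0) x h h2
      exact ⟨r, k, h3, h4.mul_left p, h5⟩
    · refine ⟨p, a, hp, dvd_mul_right _ _, h, ?_⟩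
      rw [smul_smul]; exact_mod_cast h1

theorem neighbor {L : AddSubgroup V} (hL : Lat Q L) (hyL : ∀ i, y i ∈ L) {D : ℤ}
    (hD : ∀ x : V, (∀ j, Q.b x (y j) ∈ Zs) → ∃ c : Fin m → ℤ, ∀ j, Q.b ((D : ℚ) • x - ∑ i, (c i : ℚ) • y i) (y j) = 0)
    (N : ℕ) : ∀ Λ : AddSubgroup V, Λ.relIndex L = N → N ≠ 0 → Lat Q Λ → (∀ i, y i ∈ Λ) → 
    (∃ s : ℕ, s ≠ 0 ∧ IsCoprime (s : ℤ) D ∧ ∀ x ∈ L, (s : ℚ) • x ∈ Λ) →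
    (∃ e ∈ Λ, ∃ f ∈ Λ, Q.q e = 0 ∧ Q.q f = 0 ∧ Q.b e f = 1 ∧ (∀ i, Q.b e (y i) = 0) ∧ (∀ i, Q.b f (y i) = 0)) →
    ∃ h : V ≃ₗ[ℚ] V, (∀ v, Q.q (h v) = Q.q v) ∧ (∀ i, h (y i) = y i) ∧ img h Λ = L := by
  induction N using Nat.strong_induction_on with
  | _ N ih =>
  rintro Λ hN hN0 hΛ hy ⟨s, hs0, hsD, hs⟩ ⟨e, heΛ, f, hfΛ, he, hf, hef, hey, hfy⟩
  by_cases hT : ∀ x ∈ L, (∀ i, Q.b x (y i) = 0) → x ∈ Λ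
  · refine ⟨LinearEquiv.refl ℚ V, fun _ => rfl, fun _ => rfl, ?_⟩
    have hLΛ : ∀ x ∈ L, x ∈ Λ := by
      intro x hx
      obtain ⟨c, hc⟩ := hD x fun j => hL.int hx (hyL j)
      have h1 := hT _ (sub_mem (zmem (int_mem D) hx) (sum_mem fun i _ => zmem (int_mem (c i)) (hyL i))) hc
      have h2 : (D : ℚ) • x ∈ Λ := by
        have := add_mem h1 (sum_mem (t := Finset.univ) fun i _ => zmem (int_mem (c i)) (hy i))
        rwa [sub_add_cancel] at this
      obtain ⟨u, v, huv⟩ := hsD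
      have h4 : x = (u : ℚ) • (s : ℚ) • x + (v : ℚ) • (D : ℚ) • x := by
        rw [smul_smul, smul_smul, ← add_smul, show (u : ℚ) * s + v * D = 1 by exact_mod_cast huv, one_smul]
      rw [h4]
      exact add_mem (zmem (int_mem _) (hs x hx)) (zmem (int_mem _) h2)
    ext x
    rw [mem_img]
    change x ∈ Λ ↔ x ∈ L
    exact ⟨fun hx => hL.dual x fun z hz => hΛ.int hx (hLΛ z hz), hLΛ x⟩
  · push Not at hT
    obtain ⟨x0, hx0L, hx0y, hx0⟩ := hT
    obtain ⟨p, k, hp, hps, hk1, hk2⟩ := exists_prime_mult Λ s hs0 x0 (hs x0 hx0L) hx0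
    have hpD : IsCoprime (p : ℤ) D := hsD.of_isCoprime_of_dvd_left (by exact_mod_cast hps)
    have hpD' : ¬ (p : ℤ) ∣ D := (Prime.coprime_iff_not_dvd (Nat.prime_iff_prime_int.1 hp)).1 hpD
    have hxy : ∀ i, Q.b ((k : ℚ) • x0) (y i) = 0 := by
      intro i; rw [map_smul, LinearMap.smul_apply, hx0y, smul_zero]
    have hxL : (k : ℚ) • x0 ∈ L := zmem (nat_mem k) hx0L
    obtain ⟨e', f', heΛ', hfΛ', he', hf', hef', hey', hfy', hxe⟩ :=
      better_pair y hΛ hy hD heΛ hfΛ he hf hef hey hfy hp hpD' hk1 hk2 hxy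
    obtain ⟨h0, hh0, hh0y, hh1, hh2, hh3⟩ := neighbor_step y hL hΛ heΛ' hfΛ' he' hf' hef' hey' hfy' hp hxL hk2 hxy hxe
    have hlt : Λ.addSubgroupOf L < (img h0 Λ).addSubgroupOf L := by
      rw [lt_iff_le_not_ge]
      constructor
      · intro v hv
        exact hh1 _ hv v.2
      · intro hle
        exact hk1 (hle (show (⟨_, hxL⟩ : L) ∈ _ from hh2))
    have hfi : (Λ.addSubgroupOf L).FiniteIndex := ⟨by change Λ.relIndex L ≠ 0; rw [hN]; exact hN0⟩
    have hidx : (img h0 Λ).relIndex L < N := by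
      rw [← hN]
      exact AddSubgroup.index_strictAnti hlt
    have hne : (img h0 Λ).relIndex L ≠ 0 := by
      have := AddSubgroup.finiteIndex_of_le hlt.le
      exact this.index_ne_zero
    have hmem : ∀ v ∈ Λ, h0 v ∈ img h0 Λ := fun v hv => by rw [mem_img, h0.symm_apply_apply]; exact hv
    obtain ⟨h, hh, hhy, himg⟩ := ih _ hidx (img h0 Λ) rfl hne (hΛ.img hh0) (fun i => hh1 _ (hy i) (hyL i))
      ⟨p * s, mul_ne_zero hp.ne_zero hs0, by push_cast; exact hpD.mul_left hsD, fun x hx => by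
        push_cast; rw [mul_smul]; exact hh3 _ (hs x hx)⟩
      ⟨h0 e, hmem e heΛ, h0 f, hmem f hfΛ, by rw [hh0, he], by rw [hh0, hf], by rw [isom_b hh0, hef],
        fun i => by rw [← hh0y i, isom_b hh0, hey], fun i => by rw [← hh0y i, isom_b hh0, hfy]⟩
    refine ⟨h0.trans h, fun v => by rw [LinearEquiv.trans_apply, hh, hh0], fun i => by rw [LinearEquiv.trans_apply, hh0y, hhy], ?_⟩
    rw [← himg]
    ext x
    rfl

end neighbor
end NK

namespace NK
variable {V : Type*} [AddCommGroup V] [Module ℚ V]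

open Classical in
/-- the p-adic valuation on the rationals -/
noncomputable def nu (p : ℕ) : Valuation ℚ (WithZero (Multiplicative ℤ)) :=
  if h : p.Prime then @Rat.padicValuation p ⟨h⟩ else Rat.padicValuation 2

lemma nu_int_le (p : ℕ) (k : ℤ) : nu p k ≤ 1 := by
  unfold nu
  split_ifs with h
  · haveI := Fact.mk h
    rw [Rat.padicValuation_cast]; exact Int.padicValuation_le_one p k
  · rw [Rat.padicValuation_cast]; exact Int.padicValuation_le_one 2 k

lemma nu_int_lt {p : ℕ} (hp : p.Prime) (k : ℤ) : nu p k < 1 ↔ (p : ℤ) ∣ k := by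
  haveI := Fact.mk hp
  unfold nu
  rw [dif_pos hp, Rat.padicValuation_cast, Int.padicValuation_lt_one_iff]

lemma nu_den {p : ℕ} (hp : p.Prime) (r : ℚ) : nu p r ≤ 1 ↔ ¬ p ∣ r.den := by
  haveI := Fact.mk hp
  unfold nu
  rw [dif_pos hp, Rat.padicValuation_le_one_iff]

/-- the maximal ideal -/
def MM (p : ℕ) : AddSubgroup ℚ where
  carrier := {r | nu p r < 1}
  add_mem' := fun {a b} (ha : nu p a < 1) (hb : nu p b < 1) => show nu p (a + b) < 1 from (nu p).map_add_lt ha hb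
  zero_mem' := by simp
  neg_mem' := by intro x hx; simpa using hx

lemma mem_MM {p : ℕ} {r : ℚ} : r ∈ MM p ↔ nu p r < 1 := Iff.rfl

/-- S-integers -/
def ZS (S : Finset ℕ) : Subring ℚ where
  carrier := {r | ∀ p ∈ S, nu p r ≤ 1}
  add_mem' := fun ha hb p hp => (nu p).map_add_le (ha p hp) (hb p hp)
  zero_mem' := by simp
  one_mem' := by simp
  mul_mem' := fun ha hb p hp => by rw [map_mul]; exact mul_le_one' (ha p hp) (hb p hp)
  neg_mem' := by intro x hx p hp; simpa using hx p hp

lemma mem_ZS {S : Finset ℕ} {r : ℚ} : r ∈ ZS S ↔ ∀ p ∈ S, nu p r ≤ 1 := Iff.rfl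

lemma Zs_ZS {S : Finset ℕ} {r : ℚ} (h : r ∈ Zs) : r ∈ ZS S := by
  obtain ⟨k, rfl⟩ := mem_Zs.1 h
  exact fun p _ => nu_int_le p k

lemma MM_mul {S : Finset ℕ} {p : ℕ} (hp : p ∈ S) {r t : ℚ} (hr : r ∈ ZS S) (ht : t ∈ MM p) : r * t ∈ MM p := by
  rw [mem_MM, map_mul]
  exact lt_of_le_of_lt (mul_le_of_le_one_left' (hr p hp)) ht

lemma MM_cancel {S : Finset ℕ} {p : ℕ} (hp : p ∈ S) {r t : ℚ} (hr : r ∈ ZS S) (hr' : r ∉ MM p) (h : r * t ∈ MM p) : t ∈ MM p := by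
  rw [mem_MM, map_mul, le_antisymm (hr p hp) (not_lt.1 hr'), one_mul] at h
  exact h

lemma ZS_inv {S : Finset ℕ} {r : ℚ} (h : ∀ p ∈ S, r ∉ MM p) : r⁻¹ ∈ ZS S := by
  intro p hp
  rw [map_inv₀]
  exact inv_le_one_of_one_le₀ (not_lt.1 (h p hp))

lemma p_MM {p : ℕ} (hp : p.Prime) : (p : ℚ) ∈ MM p := by
  have := (nu_int_lt hp (p : ℤ)).2 dvd_rfl
  rw [mem_MM]; exact_mod_cast this

lemma ZS_denom {S : Finset ℕ} (hS : ∀ p ∈ S, p.Prime) {r : ℚ} (h : r ∈ ZS S) : (∀ p ∈ S, ¬ p ∣ r.den) :=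
  fun p hp => (nu_den (hS p hp) r).1 (h p hp)

/-- S-localisation of a lattice -/
def LS (S : Finset ℕ) (hS : ∀ p ∈ S, p.Prime) (L : AddSubgroup V) : AddSubgroup V where
  carrier := {x | ∃ s : ℕ, s ≠ 0 ∧ (∀ p ∈ S, ¬ p ∣ s) ∧ (s : ℚ) • x ∈ L}
  add_mem' := by
    rintro x y ⟨s, hs0, hs, hx⟩ ⟨t, ht0, ht, hy⟩
    refine ⟨s * t, mul_ne_zero hs0 ht0, fun p hp h => ((hS p hp).dvd_mul.1 h).elim (hs p hp) (ht p hp), ?_⟩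
    have : ((s * t : ℕ) : ℚ) • (x + y) = (t : ℚ) • (s : ℚ) • x + (s : ℚ) • (t : ℚ) • y := by push_cast; module
    rw [this]
    exact add_mem (zmem (nat_mem t) hx) (zmem (nat_mem s) hy)
  zero_mem' := ⟨1, one_ne_zero, fun p hp => by rw [Nat.dvd_one]; exact (hS p hp).ne_one, by simp [zero_mem]⟩
  neg_mem' := by
    rintro x ⟨s, hs0, hs, hx⟩
    exact ⟨s, hs0, hs, by rw [smul_neg]; exact neg_mem hx⟩

section
variable {S : Finset ℕ} {hS : ∀ p ∈ S, p.Prime} {L : AddSubgroup V} {Q : QM ℚ V}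

lemma mem_LS {x : V} : x ∈ LS S hS L ↔ ∃ s : ℕ, s ≠ 0 ∧ (∀ p ∈ S, ¬ p ∣ s) ∧ (s : ℚ) • x ∈ L := Iff.rfl

lemma LS_of_mem {x : V} (h : x ∈ L) : x ∈ LS S hS L :=
  ⟨1, one_ne_zero, fun p hp => by rw [Nat.dvd_one]; exact (hS p hp).ne_one, by simpa using h⟩

lemma LS_smul {x : V} {r : ℚ} (hr : r ∈ ZS S) (h : x ∈ LS S hS L) : r • x ∈ LS S hS L := by
  obtain ⟨s, hs0, hs, hx⟩ := h
  refine ⟨r.den * s, mul_ne_zero r.den_ne_zero hs0, fun p hp h => ((hS p hp).dvd_mul.1 h).elim (ZS_denom hS hr p hp) (hs p hp), ?_⟩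
  have : ((r.den * s : ℕ) : ℚ) • r • x = (r.num : ℚ) • (s : ℚ) • x := by
    rw [smul_smul, smul_smul]
    congr 1
    push_cast
    rw [← Rat.den_mul_eq_num]; ring
  rw [this]
  exact zmem (int_mem _) hx

lemma nat_not_MM {p : ℕ} (hp : p.Prime) {s : ℕ} (h : ¬ p ∣ s) : (s : ℚ) ∉ MM p := by
  intro h'
  have := (nu_int_lt hp (s : ℤ)).1 (by exact_mod_cast h')
  exact h (by exact_mod_cast this)

lemma ZS_of_mul {s : ℕ} (hS : ∀ p ∈ S, p.Prime) (hs0 : s ≠ 0) (hs : ∀ p ∈ S, ¬ p ∣ s) {r : ℚ} (h : (s : ℚ) * r ∈ ZS S) : r ∈ ZS S := by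
  have h1 := mul_mem (ZS_inv (fun p hp => nat_not_MM (hS p hp) (hs p hp))) h
  rwa [inv_mul_cancel_left₀ (by exact_mod_cast hs0)] at h1

lemma LS_b (hL : Lat Q L) {x y : V} (hx : x ∈ LS S hS L) (hy : y ∈ LS S hS L) : Q.b x y ∈ ZS S := by
  obtain ⟨s, hs0, hs, hx⟩ := hx
  obtain ⟨t, ht0, ht, hy⟩ := hy
  have h := hL.int hx hy
  rw [map_smul, map_smul, LinearMap.smul_apply, smul_eq_mul, smul_eq_mul] at h
  exact ZS_of_mul hS hs0 hs (ZS_of_mul hS ht0 ht (Zs_ZS h))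

lemma LS_q (hL : Lat Q L) {x : V} (hx : x ∈ LS S hS L) : Q.q x ∈ ZS S := by
  obtain ⟨s, hs0, hs, hx⟩ := hx
  have h := hL.even _ hx
  rw [Q.q_smul, pow_two, mul_assoc] at h
  exact ZS_of_mul hS hs0 hs (ZS_of_mul hS hs0 hs (Zs_ZS h))

/-- if a quadratic function vanishes mod p on K then so do its coefficients -/
lemma quad_zero (hL : Lat Q L) {K : AddSubgroup V} (hK : K ≤ L) {p : ℕ} (hp : p ∈ S) {u1 u2 : V} (hu1 : u1 ∈ K) (hu2 : u2 ∈ K)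
    (hα : Q.b u1 u2 ∉ MM p) {c k : ℚ} {l : V →ₗ[ℚ] ℚ} (h : ∀ u ∈ K, c + l u + k * Q.q u ∈ MM p) :
    c ∈ MM p ∧ k ∈ MM p ∧ ∀ u ∈ K, l u ∈ MM p := by
  have h0 : c ∈ MM p := by
    have := h 0 (zero_mem _)
    rwa [map_zero, Q.q_zero, mul_zero, add_zero, add_zero] at this
  have h1 : ∀ u ∈ K, l u + k * Q.q u ∈ MM p := by
    intro u hu
    have := sub_mem (h u hu) h0
    convert this using 1; ring
  have h2 : k ∈ MM p := by
    have h3 := sub_mem (sub_mem (h1 _ (add_mem hu1 hu2)) (h1 _ hu1)) (h1 _ hu2)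
    apply MM_cancel hp (Zs_ZS (hL.int (hK hu1) (hK hu2))) hα
    convert h3 using 1
    rw [Q.q_add, map_add]; ring
  refine ⟨h0, h2, fun u hu => ?_⟩
  have h3 := sub_mem (h1 u hu) (MM_mul hp (Zs_ZS (hL.even u (hK hu))) h2)
  convert h3 using 1; ring

lemma quad_crt (hS : ∀ p ∈ S, p.Prime) (hL : Lat Q L) {K : AddSubgroup V} (hK : K ≤ L) {c k : ℚ} {l : V →ₗ[ℚ] ℚ} (hk : k ∈ ZS S) (hl : ∀ u ∈ K, l u ∈ ZS S)
    (h : ∀ p ∈ S, ∃ u ∈ K, c + l u + k * Q.q u ∉ MM p) : ∃ u ∈ K, ∀ p ∈ S, c + l u + k * Q.q u ∉ MM p := by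
  obtain ⟨u, hu⟩ := crt_prop (X := K) S hS (fun p u => c + l (u : V) + k * Q.q (u : V) ∉ MM p)
    (fun p hp => by obtain ⟨u, hu, h⟩ := h p hp; exact ⟨⟨u, hu⟩, h⟩)
    (fun p hp x u hx hcon => by
      apply hx
      have e1 : ((x + (p : ℤ) • u : K) : V) = (x : V) + (p : ℚ) • (u : V) := by
        push_cast
        rw [← Int.cast_smul_eq_zsmul ℚ]; simp
      rw [e1] at hcon
      have h1 : (l u + k * (p * Q.q u + Q.b x u)) * p ∈ MM p := by
        refine MM_mul hp (add_mem (hl _ u.2) (mul_mem hk (add_mem (mul_mem (Zs_ZS (nat_mem p)) (Zs_ZS (hL.even _ (hK u.2)))) (Zs_ZS (hL.int (hK x.2) (hK u.2)))))) (p_MM (hS p hp))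
      have h2 := sub_mem hcon h1
      convert h2 using 1
      simp only [Q.q_add, Q.q_smul, map_add, map_smul, smul_eq_mul]
      ring)
  exact ⟨u, u.2, hu⟩

end
end NK

namespace NK
variable {V : Type*} [AddCommGroup V] [Module ℚ V]

section
variable {Q : QM ℚ V} {S : Finset ℕ} {hS : ∀ p ∈ S, p.Prime} {L : AddSubgroup V}

/-- isometries preserving the S-localisation -/
structure Good (Q : QM ℚ V) (S : Finset ℕ) (hS : ∀ p ∈ S, p.Prime) (L : AddSubgroup V) (g : V ≃ₗ[ℚ] V) : Prop where
  q : ∀ x, Q.q (g x) = Q.q x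
  mem : ∀ x ∈ LS S hS L, g x ∈ LS S hS L
  mem' : ∀ x ∈ LS S hS L, g.symm x ∈ LS S hS L

lemma Good.symm {g : V ≃ₗ[ℚ] V} (h : Good Q S hS L g) : Good Q S hS L g.symm :=
  ⟨isom_symm h.q, h.mem', h.mem⟩

lemma Good.trans {g g' : V ≃ₗ[ℚ] V} (h : Good Q S hS L g) (h' : Good Q S hS L g') : Good Q S hS L (g.trans g') :=
  ⟨fun x => by rw [LinearEquiv.trans_apply, h'.q, h.q], fun x hx => h'.mem _ (h.mem _ hx), fun x hx => h.mem' _ (h'.mem' _ hx)⟩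

lemma Good.refl : Good Q S hS L (LinearEquiv.refl ℚ V) := ⟨fun _ => rfl, fun _ h => h, fun _ h => h⟩

/-- Eichler transvection -/
def eichL (Q : QM ℚ V) (e u : V) : V →ₗ[ℚ] V :=
  LinearMap.id + (Q.b e).smulRight u - (Q.b u).smulRight e - Q.q u • (Q.b e).smulRight e

lemma eichL_apply (Q : QM ℚ V) (e u x : V) : eichL Q e u x = x + Q.b e x • u - Q.b u x • e - (Q.q u * Q.b e x) • e := by
  simp [eichL, smul_smul]

lemma eichL_comp {e u : V} (he : Q.q e = 0) (heu : Q.b e u = 0) (x : V) : eichL Q e (-u) (eichL Q e u x) = x := by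
  have hee : Q.b e e = 0 := by rw [Q.hq, he, mul_zero]
  have hue : Q.b u e = 0 := by rw [Q.sym, heu]
  simp only [eichL_apply, map_add, map_sub, map_smul, map_neg, LinearMap.neg_apply, Q.q_neg, smul_eq_mul, hee, hue, heu, Q.hq]
  module

/-- Eichler transvection -/
def eich (Q : QM ℚ V) {e u : V} (he : Q.q e = 0) (heu : Q.b e u = 0) : V ≃ₗ[ℚ] V :=
  LinearEquiv.ofLinear (eichL Q e u) (eichL Q e (-u))
    (by ext x; have := eichL_comp (Q := Q) (e := e) (u := -u) he (by rw [map_neg, heu, neg_zero]) x; rw [neg_neg] at this; exact this)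
    (by ext x; exact eichL_comp he heu x)

lemma eichL_q {e u : V} (he : Q.q e = 0) (heu : Q.b e u = 0) (x : V) : Q.q (eichL Q e u x) = Q.q x := by
  have hue : Q.b u e = 0 := by rw [Q.sym, heu]
  rw [eichL_apply]
  simp only [Q.q_sub, Q.q_add, Q.q_smul, map_add, map_sub, map_smul, LinearMap.add_apply, LinearMap.sub_apply, LinearMap.smul_apply,
    smul_eq_mul, he, heu, hue, Q.sym x e, Q.sym x u, Q.hq]
  ring

lemma eichL_mem (hL : Lat Q L) {e u : V} (he : e ∈ LS S hS L) (hu : u ∈ LS S hS L) {x : V} (hx : x ∈ LS S hS L) : eichL Q e u x ∈ LS S hS L := by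
  rw [eichL_apply]
  exact sub_mem (sub_mem (add_mem hx (LS_smul (LS_b hL he hx) hu)) (LS_smul (LS_b hL hu hx) he))
    (LS_smul (mul_mem (LS_q hL hu) (LS_b hL he hx)) he)

lemma eich_good (hL : Lat Q L) {e u : V} (he : Q.q e = 0) (heu : Q.b e u = 0) (heL : e ∈ LS S hS L) (huL : u ∈ LS S hS L) :
    Good Q S hS L (eich Q he heu) :=
  ⟨eichL_q he heu, fun _ hx => eichL_mem hL heL huL hx, fun _ hx => eichL_mem hL heL (neg_mem huL) hx⟩

lemma eich_fix {e u : V} (he : Q.q e = 0) (heu : Q.b e u = 0) {y : V} (h1 : Q.b e y = 0) (h2 : Q.b u y = 0) : eich Q he heu y = y := by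
  change eichL Q e u y = y
  rw [eichL_apply, h1, h2]; simp

/-- reflection -/
noncomputable def reflL (Q : QM ℚ V) (r : V) : V →ₗ[ℚ] V := LinearMap.id - (Q.q r)⁻¹ • (Q.b r).smulRight r

lemma reflL_apply (r x : V) : reflL Q r x = x - ((Q.q r)⁻¹ * Q.b r x) • r := by
  simp [reflL, smul_smul]

lemma reflL_comp {r : V} (hr : Q.q r ≠ 0) (x : V) : reflL Q r (reflL Q r x) = x := by
  simp only [reflL_apply, map_sub, map_smul, smul_eq_mul, Q.hq]
  have h1 : (Q.q r)⁻¹ * Q.b r x - ((Q.q r)⁻¹ * Q.b r x) * (1 - (Q.q r)⁻¹ * (2 * Q.q r)) = 2 * ((Q.q r)⁻¹ * Q.b r x) := by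
    field_simp; ring
  have h2 : (Q.q r)⁻¹ * Q.b r x - (Q.q r)⁻¹ * (Q.b r x * 2) = - ((Q.q r)⁻¹ * Q.b r x) := by ring
  have h3 : (Q.q r)⁻¹ * Q.q r = 1 := inv_mul_cancel₀ hr
  have h4 : ((Q.q r)⁻¹ * Q.b r x) + ((Q.q r)⁻¹ * (Q.b r x - (Q.q r)⁻¹ * Q.b r x * (2 * Q.q r))) = 0 := by
    linear_combination (-2 * (Q.q r)⁻¹ * Q.b r x) * h3
  trans x - (((Q.q r)⁻¹ * Q.b r x) + ((Q.q r)⁻¹ * (Q.b r x - (Q.q r)⁻¹ * Q.b r x * (2 * Q.q r)))) • r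
  · module
  · rw [h4]; simp

/-- reflection -/
noncomputable def reflE (Q : QM ℚ V) {r : V} (hr : Q.q r ≠ 0) : V ≃ₗ[ℚ] V :=
  LinearEquiv.ofLinear (reflL Q r) (reflL Q r) (by ext x; exact reflL_comp hr x) (by ext x; exact reflL_comp hr x)

lemma reflL_q {r : V} (hr : Q.q r ≠ 0) (x : V) : Q.q (reflL Q r x) = Q.q x := by
  rw [reflL_apply]
  simp only [Q.q_sub, Q.q_smul, map_smul, smul_eq_mul, Q.sym x r]
  field_simp; ring

lemma reflE_good (hL : Lat Q L) {r : V} (hr : Q.q r ≠ 0) (hrL : r ∈ LS S hS L) (hu : ∀ p ∈ S, Q.q r ∉ MM p) : Good Q S hS L (reflE Q hr) := by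
  have : ∀ x ∈ LS S hS L, reflL Q r x ∈ LS S hS L := by
    intro x hx
    rw [reflL_apply]
    exact sub_mem hx (LS_smul (mul_mem (ZS_inv hu) (LS_b hL hrL hx)) hrL)
  exact ⟨reflL_q hr, this, this⟩

/-- the orthogonal complement of Y, e, f in L -/
def KK (Q : QM ℚ V) (L : AddSubgroup V) (Y : Set V) (e f : V) : AddSubgroup V where
  carrier := {u | u ∈ L ∧ (∀ y ∈ Y, Q.b u y = 0) ∧ Q.b u e = 0 ∧ Q.b u f = 0}
  add_mem' := by
    rintro a b ⟨h1, h2, h3, h4⟩ ⟨h1', h2', h3', h4'⟩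
    refine ⟨add_mem h1 h1', fun y hy => ?_, ?_, ?_⟩
    · rw [map_add, LinearMap.add_apply, h2 y hy, h2' y hy, add_zero]
    · rw [map_add, LinearMap.add_apply, h3, h3', add_zero]
    · rw [map_add, LinearMap.add_apply, h4, h4', add_zero]
  zero_mem' := ⟨zero_mem _, by simp, by simp, by simp⟩
  neg_mem' := by
    rintro a ⟨h1, h2, h3, h4⟩
    refine ⟨neg_mem h1, fun y hy => ?_, ?_, ?_⟩
    · rw [map_neg, LinearMap.neg_apply, h2 y hy, neg_zero]
    · rw [map_neg, LinearMap.neg_apply, h3, neg_zero]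
    · rw [map_neg, LinearMap.neg_apply, h4, neg_zero]

lemma KK_le {Y : Set V} {e f : V} : KK Q L Y e f ≤ L := fun _ h => h.1

/-- making the e-coordinate a unit -/
lemma witt_b (hL : Lat Q L) {Y : Set V} {e f : V} (heL : e ∈ L) (hfL : f ∈ L) (he : Q.q e = 0) (hf : Q.q f = 0) (hef : Q.b e f = 1)
    (heY : ∀ y ∈ Y, Q.b e y = 0) (hfY : ∀ y ∈ Y, Q.b f y = 0)
    (hα : ∀ p ∈ S, ∃ u1 ∈ KK Q L Y e f, ∃ u2 ∈ KK Q L Y e f, Q.b u1 u2 ∉ MM p)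
    {v t : V} (hv : v ∈ LS S hS L) (ht : t ∈ LS S hS L) (htY : ∀ y ∈ Y, Q.b t y = 0) (hvt : Q.b v t = 1) :
    ∃ g, Good Q S hS L g ∧ (∀ y ∈ Y, g y = y) ∧ ∀ p ∈ S, Q.b (g v) e ∉ MM p := by
  have hfe : Q.b f e = 1 := by rw [Q.sym, hef]
  have hee : Q.b e e = 0 := by rw [Q.hq, he, mul_zero]
  have hff : Q.b f f = 0 := by rw [Q.hq, hf, mul_zero]
  have heLS : e ∈ LS S hS L := LS_of_mem heL
  have hfLS : f ∈ LS S hS L := LS_of_mem hfL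
  obtain ⟨u, hu, hu'⟩ := quad_crt (c := Q.b v e) (k := - Q.b v f) (l := - Q.b v) hS hL (KK_le (Y := Y) (e := e) (f := f))
    (neg_mem (LS_b hL hv hfLS)) (fun u hu => neg_mem (LS_b hL hv (LS_of_mem hu.1))) (fun p hp => by
      by_contra hcon
      push Not at hcon
      obtain ⟨u1, hu1, u2, hu2, h12⟩ := hα p hp
      obtain ⟨h1, h2, h3⟩ := quad_zero hL KK_le hp hu1 hu2 h12 hcon
      obtain ⟨w, hw⟩ : ∃ w, w = t - Q.b t f • e - Q.b t e • f := ⟨_, rfl⟩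
      have htf := LS_b hL ht hfLS
      have hte := LS_b hL ht heLS
      have hwLS : w ∈ LS S hS L := by
        rw [hw]
        exact sub_mem (sub_mem ht (LS_smul htf heLS)) (LS_smul hte hfLS)
      obtain ⟨s, hs0, hs, hsw⟩ := hwLS
      have hK : (s : ℚ) • w ∈ KK Q L Y e f := by
        refine ⟨hsw, fun y hy => ?_, ?_, ?_⟩
        · rw [hw]
          simp only [map_sub, map_smul, LinearMap.sub_apply, LinearMap.smul_apply, smul_eq_mul, htY y hy, heY y hy, hfY y hy]; ring
        · rw [hw]
          simp only [map_sub, map_smul, LinearMap.sub_apply, LinearMap.smul_apply, smul_eq_mul, hee, hfe]; ring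
        · rw [hw]
          simp only [map_sub, map_smul, LinearMap.sub_apply, LinearMap.smul_apply, smul_eq_mul, hff, hef]; ring
      have h4 := h3 _ hK
      rw [map_smul, smul_eq_mul] at h4
      have h5 := MM_cancel hp (Zs_ZS (nat_mem s)) (nat_not_MM (hS p hp) (hs p hp)) h4
      have h6 := sub_mem (sub_mem (MM_mul hp htf h1) (MM_mul hp hte h2)) h5
      have h7 : Q.b t f * Q.b v e - Q.b t e * -Q.b v f - (-Q.b v) w = 1 := by
        rw [← hvt, hw]
        simp only [map_sub, map_smul, LinearMap.neg_apply, smul_eq_mul]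
        ring
      rw [h7, mem_MM, map_one] at h6
      exact lt_irrefl _ h6)
  have hfu : Q.b f u = 0 := by rw [Q.sym]; exact hu.2.2.2
  refine ⟨eich Q hf hfu, eich_good hL hf hfu hfLS (LS_of_mem hu.1), fun y hy => eich_fix hf hfu (hfY y hy) (hu.2.1 y hy), fun p hp h => hu' p hp ?_⟩
  convert h using 1
  change _ = Q.b (eichL Q f u v) e
  rw [eichL_apply]
  simp only [map_add, map_sub, map_smul, LinearMap.add_apply, LinearMap.sub_apply, LinearMap.smul_apply, LinearMap.neg_apply, smul_eq_mul, hu.2.2.1, hfe, Q.sym f v, Q.sym u v]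
  ring

/-- one step of semi-local Witt -/
lemma witt_step (hL : Lat Q L) {Y : Set V} {e f : V} (heL : e ∈ L) (hfL : f ∈ L) (he : Q.q e = 0) (hf : Q.q f = 0) (hef : Q.b e f = 1)
    (heY : ∀ y ∈ Y, Q.b e y = 0) (hfY : ∀ y ∈ Y, Q.b f y = 0) (hSne : S.Nonempty)
    (hα : ∀ p ∈ S, ∃ u1 ∈ KK Q L Y e f, ∃ u2 ∈ KK Q L Y e f, Q.b u1 u2 ∉ MM p)
    {v t : V} (hv : v ∈ LS S hS L) (ht : t ∈ LS S hS L) (htY : ∀ y ∈ Y, Q.b t y = 0) (hvt : Q.b v t = 1)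
    {v' t' : V} (hv' : v' ∈ LS S hS L) (ht' : t' ∈ LS S hS L) (htY' : ∀ y ∈ Y, Q.b t' y = 0) (hvt' : Q.b v' t' = 1)
    (hq : Q.q v = Q.q v') (hY : ∀ y ∈ Y, Q.b v y = Q.b v' y) :
    ∃ g, Good Q S hS L g ∧ (∀ y ∈ Y, g y = y) ∧ g v = v' := by
  obtain ⟨g, hg, hgY, hgu⟩ := witt_b hL heL hfL he hf hef heY hfY hα hv ht htY hvt
  obtain ⟨g', hg', hgY', hgu'⟩ := witt_b hL heL hfL he hf hef heY hfY hα hv' ht' htY' hvt'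
  have heLS : e ∈ LS S hS L := LS_of_mem heL
  obtain ⟨w, hw⟩ : ∃ w, w = g v := ⟨_, rfl⟩
  obtain ⟨w', hw'⟩ : ∃ w, w = g' v' := ⟨_, rfl⟩
  have hwL : w ∈ LS S hS L := by rw [hw]; exact hg.mem _ hv
  have hwL' : w' ∈ LS S hS L := by rw [hw']; exact hg'.mem _ hv'
  have hww : Q.q w = Q.q w' := by rw [hw, hw', hg.q, hg'.q, hq]
  have hwY : ∀ y ∈ Y, Q.b w y = Q.b w' y := by
    intro y hy
    rw [hw, hw']
    conv_lhs => rw [← hgY y hy]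
    conv_rhs => rw [← hgY' y hy]
    rw [isom_b hg.q, isom_b hg'.q, hY y hy]
  rw [← hw] at hgu
  rw [← hw'] at hgu'
  obtain ⟨l, hl⟩ : ∃ l : V →ₗ[ℚ] ℚ, l = Q.b w' e • Q.b w - Q.b w e • Q.b w' := ⟨_, rfl⟩
  have hb := LS_b hL hwL heLS
  have hb' := LS_b hL hwL' heLS
  obtain ⟨u, hu, hu'⟩ := quad_crt (c := 2 * Q.q w - Q.b w w') (k := Q.b w e * Q.b w' e) (l := l) hS hL (KK_le (Y := Y) (e := e) (f := f))
    (mul_mem hb hb') (fun u hu => by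
      rw [hl]
      simp only [LinearMap.sub_apply, LinearMap.smul_apply, smul_eq_mul]
      exact sub_mem (mul_mem hb' (LS_b hL hwL (LS_of_mem hu.1))) (mul_mem hb (LS_b hL hwL' (LS_of_mem hu.1)))) (fun p hp => by
      by_contra hcon
      push Not at hcon
      obtain ⟨u1, hu1, u2, hu2, h12⟩ := hα p hp
      obtain ⟨h1, h2, h3⟩ := quad_zero hL KK_le hp hu1 hu2 h12 hcon
      exact hgu' p hp (MM_cancel hp hb (hgu p hp) h2))
  have heu : Q.b e u = 0 := by rw [Q.sym]; exact hu.2.2.1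
  obtain ⟨z, hz⟩ : ∃ z, z = eich Q he heu w := ⟨_, rfl⟩
  have hE : Good Q S hS L (eich Q he heu) := eich_good hL he heu heLS (LS_of_mem hu.1)
  have hEY : ∀ y ∈ Y, eich Q he heu y = y := fun y hy => eich_fix he heu (heY y hy) (hu.2.1 y hy)
  have hzz : Q.q z = Q.q w := by rw [hz, hE.q]
  have hqr : Q.q (z - w') = 2 * Q.q w - Q.b w w' + l u + Q.b w e * Q.b w' e * Q.q u := by
    rw [Q.q_sub, hzz, ← hww, hl, hz]
    change _ - Q.b (eichL Q e u w) w' = _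
    rw [eichL_apply]
    simp only [map_add, map_sub, map_smul, LinearMap.add_apply, LinearMap.sub_apply, LinearMap.smul_apply, smul_eq_mul, Q.sym e w, Q.sym e w', Q.sym u w, Q.sym u w']
    ring
  have hru : ∀ p ∈ S, Q.q (z - w') ∉ MM p := by rw [hqr]; exact hu'
  have hr0 : Q.q (z - w') ≠ 0 := by
    intro h0
    obtain ⟨p, hp⟩ := hSne
    apply hru p hp
    rw [h0]; exact zero_mem _
  have hzL : z ∈ LS S hS L := by rw [hz]; exact hE.mem _ hwL
  have hR : Good Q S hS L (reflE Q hr0) := reflE_good hL hr0 (sub_mem hzL hwL') hru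
  have hzY : ∀ y ∈ Y, Q.b z y = Q.b w y := by
    intro y hy
    rw [hz]
    conv_lhs => rw [← hEY y hy]
    rw [isom_b hE.q]
  have hRY : ∀ y ∈ Y, reflE Q hr0 y = y := by
    intro y hy
    change reflL Q _ y = y
    rw [reflL_apply, map_sub, LinearMap.sub_apply, hzY y hy, hwY y hy]; simp
  have hRz : reflE Q hr0 z = w' := by
    change reflL Q _ z = w'
    have : Q.b (z - w') z = Q.q (z - w') := by
      rw [Q.q_sub, map_sub, LinearMap.sub_apply, Q.hq, hzz, ← hww, Q.sym z w']; ring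
    rw [reflL_apply, this, inv_mul_cancel₀ hr0, one_smul]; abel
  refine ⟨(((g.trans (eich Q he heu)).trans (reflE Q hr0)).trans g'.symm), ((hg.trans hE).trans hR).trans hg'.symm, fun y hy => ?_, ?_⟩
  · simp only [LinearEquiv.trans_apply, hgY y hy, hEY y hy, hRY y hy]
    rw [LinearEquiv.symm_apply_eq, hgY' y hy]
  · simp only [LinearEquiv.trans_apply]
    rw [LinearEquiv.symm_apply_eq, ← hw, ← hz, hRz, hw']

/-- semi-local Witt -/
theorem witt (hL : Lat Q L) {m : ℕ} (x y xs ys : Fin m → V) (hx : ∀ i, x i ∈ L) (hy : ∀ i, y i ∈ L) (hxs : ∀ i, xs i ∈ L) (hys : ∀ i, ys i ∈ L)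
    (hxy : ∀ i j, Q.b (x i) (x j) = Q.b (y i) (y j)) (hxd : ∀ i j, Q.b (xs i) (x j) = if i = j then 1 else 0)
    (hyd : ∀ i j, Q.b (ys i) (y j) = if i = j then 1 else 0) {e f : V} (heL : e ∈ L) (hfL : f ∈ L) (he : Q.q e = 0) (hf : Q.q f = 0) (hef : Q.b e f = 1)
    (heY : ∀ i, Q.b e (y i) = 0) (hfY : ∀ i, Q.b f (y i) = 0) (hSne : S.Nonempty)
    (hα : ∀ i, ∀ p ∈ S, ∃ u1 ∈ KK Q L (Set.image y {j | j < i}) e f, ∃ u2 ∈ KK Q L (Set.image y {j | j < i}) e f, Q.b u1 u2 ∉ MM p) :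
    ∃ g, Good Q S hS L g ∧ ∀ i, g (x i) = y i := by
  have key : ∀ k : ℕ, k ≤ m → ∃ g, Good Q S hS L g ∧ ∀ i : Fin m, i.1 < k → g (x i) = y i := by
    intro k
    induction k with
    | zero => exact fun _ => ⟨LinearEquiv.refl ℚ V, Good.refl, fun i hi => absurd hi (Nat.not_lt_zero _)⟩
    | succ k ih =>
      intro hk
      obtain ⟨g, hg, hgx⟩ := ih (by omega)
      obtain ⟨i, hi⟩ : ∃ i : Fin m, i.1 = k := ⟨⟨k, hk⟩, rfl⟩
      have hgx' : ∀ j, j < i → g (x j) = y j := fun j hj => hgx j (by rw [← hi]; exact hj)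
      obtain ⟨h, hh, hhY, hhv⟩ := witt_step (hS := hS) (Y := Set.image y {j | j < i}) hL heL hfL he hf hef
        (by rintro _ ⟨j, _, rfl⟩; exact heY j) (by rintro _ ⟨j, _, rfl⟩; exact hfY j) hSne (hα i)
        (v := g (x i)) (t := g (xs i)) (hg.mem _ (LS_of_mem (hx i))) (hg.mem _ (LS_of_mem (hxs i)))
        (by rintro _ ⟨j, hj, rfl⟩; rw [← hgx' j hj, isom_b hg.q, hxd, if_neg (ne_of_gt hj)])
        (by rw [Q.sym, isom_b hg.q, hxd, if_pos rfl])
        (v' := y i) (t' := ys i) (LS_of_mem (hy i)) (LS_of_mem (hys i))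
        (by rintro _ ⟨j, hj, rfl⟩; rw [hyd, if_neg (ne_of_gt hj)])
        (by rw [Q.sym, hyd, if_pos rfl])
        (by
          rw [hg.q]
          have := hxy i i
          rw [Q.hq, Q.hq] at this
          linarith)
        (by rintro _ ⟨j, hj, rfl⟩; rw [← hgx' j hj, isom_b hg.q, hgx' j hj, hxy])
      refine ⟨g.trans h, hg.trans hh, fun j hj => ?_⟩
      rw [LinearEquiv.trans_apply]
      rcases Nat.lt_succ_iff_lt_or_eq.1 hj with h1 | h1
      · rw [hgx j h1]
        exact hhY _ ⟨j, by rw [← hi] at h1; exact h1, rfl⟩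
      · obtain rfl : j = i := Fin.ext (h1.trans hi.symm)
        exact hhv
  obtain ⟨g, hg, h⟩ := key m le_rfl
  exact ⟨g, hg, fun i => h i i.2⟩

end
end NK

namespace NK
open Matrix
namespace Fam
variable {m n : ℕ} {G : Matrix (Fin n) (Fin n) ℤ} (F : Fam m G)

lemma alpha (h2 : 2 * m + 2 ≤ n) {e f : Fin n → ℤ} (heT : e ∈ F.T) (hfT : f ∈ F.T) (he : F.Q.q e = 0) (hf : F.Q.q f = 0) (hef : F.Q.b e f = 1)
    (i : Fin m) {p : ℕ} (hp : p.Prime) :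
    ∃ u1 u2, ((∀ j < i, F.Q.b u1 (F.y j) = 0) ∧ F.Q.b u1 e = 0 ∧ F.Q.b u1 f = 0) ∧
      ((∀ j < i, F.Q.b u2 (F.y j) = 0) ∧ F.Q.b u2 e = 0 ∧ F.Q.b u2 f = 0) ∧ ¬ (p : ℤ) ∣ F.Q.b u1 u2 := by
  haveI := Fact.mk hp
  by_contra hcon
  push Not at hcon
  have hfe : F.Q.b f e = 1 := by rw [F.Q.sym, hef]
  have hee : F.Q.b e e = 0 := by rw [F.Q.hq, he, mul_zero]
  have hff : F.Q.b f f = 0 := by rw [F.Q.hq, hf, mul_zero]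
  rw [F.mem_T] at heT hfT
  set B := mform (G.map (Int.cast : ℤ → ZMod p)) with hB
  have hBn : Nd B := by
    apply mform_nd
    · rw [IsSymm, ← transpose_map, F.hs.eq]
    · have : (G.map (Int.cast : ℤ → ZMod p)).det = (G.det : ZMod p) := (Int.cast_det G).symm
      rw [this]
      exact (F.hu.map (Int.castRingHom (ZMod p))).ne_zero
  have hBc : ∀ x y : Fin n → ℤ, B (cv _ x) (cv _ y) = (F.Q.b x y : ZMod p) := by
    intro x y; rw [hB, mform_apply, cv_dot, F.Qb]
  let w : Fin m → Fin n → ZMod p := fun k => if k < i then cv _ (F.y k) else cv _ e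
  let Y : Submodule (ZMod p) (Fin n → ZMod p) := Submodule.span _ (Set.range w)
  have hYd : Module.finrank (ZMod p) Y ≤ m := by
    have := finrank_range_le_card (R := ZMod p) (b := w)
    rw [Fintype.card_fin] at this
    exact this
  obtain ⟨P, -, hP2, -, hP4⟩ := finrank_ortho_ge B Y ⊤
  -- projection
  have key : ∀ x : Fin n → ℤ, cv _ x ∈ P → ∃ (x' : Fin n → ℤ) (k : ℤ) (z : Fin n → ℤ), x = x' + k • e + (p : ℤ) • z ∧ ((∀ j < i, F.Q.b x' (F.y j) = 0) ∧ F.Q.b x' e = 0 ∧ F.Q.b x' f = 0) := by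
    intro x hx
    have h1 : ∀ j < i, (p : ℤ) ∣ F.Q.b x (F.y j) := by
      intro j hj
      have := hP2 (w j) (Submodule.subset_span ⟨j, rfl⟩) _ hx
      simp only [w, if_pos hj] at this
      rwa [hBc, ZMod.intCast_zmod_eq_zero_iff_dvd] at this
    have h3 : (p : ℤ) ∣ F.Q.b x e := by
      have := hP2 (w i) (Submodule.subset_span ⟨i, rfl⟩) _ hx
      simp only [w, lt_irrefl, if_false] at this
      rwa [hBc, ZMod.intCast_zmod_eq_zero_iff_dvd] at this
    have h4 : ∀ j, ∃ c : ℤ, j < i → F.Q.b x (F.y j) = p * c := by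
      intro j
      by_cases hj : j < i
      · obtain ⟨c, hc⟩ := h1 j hj; exact ⟨c, fun _ => hc⟩
      · exact ⟨0, fun h => absurd h hj⟩
    choose c hc using h4
    obtain ⟨d, hd⟩ := h3
    obtain ⟨s, hs⟩ : ∃ s, s = ∑ j, (if j < i then c j else 0) • F.ys j := ⟨_, rfl⟩
    have hsy : ∀ j < i, F.Q.b s (F.y j) = c j := by
      intro j hj
      rw [hs]
      simp only [map_sum, map_smul, LinearMap.sum_apply, LinearMap.smul_apply, F.Qdual, smul_eq_mul, mul_ite, mul_one, mul_zero,
        Finset.sum_ite_eq', Finset.mem_univ, if_true, if_pos hj]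
    obtain ⟨t, ht⟩ : ∃ t, t = x - (p : ℤ) • s := ⟨_, rfl⟩
    have hte : F.Q.b t e = p * (d - F.Q.b s e) := by
      rw [ht]
      simp only [map_sub, map_smul, LinearMap.sub_apply, LinearMap.smul_apply, smul_eq_mul, hd]; ring
    refine ⟨t - F.Q.b t f • e - F.Q.b t e • f, F.Q.b t f, s + (d - F.Q.b s e) • f, ?_, fun j hj => ?_, ?_, ?_⟩
    · rw [hte, ht]; module
    · rw [ht]
      simp only [map_sub, map_smul, LinearMap.sub_apply, LinearMap.smul_apply, smul_eq_mul, heT, hfT, hc j hj, hsy j hj]; ring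
    · simp only [map_sub, map_smul, LinearMap.sub_apply, LinearMap.smul_apply, smul_eq_mul, hee, hfe]; ring
    · simp only [map_sub, map_smul, LinearMap.sub_apply, LinearMap.smul_apply, smul_eq_mul, hff, hef]; ring
  have hiso : Module.finrank (ZMod p) P + Module.finrank (ZMod p) P ≤ Module.finrank (ZMod p) (Fin n → ZMod p) := by
    apply finrank_add_le_of_ortho (B := B) hBn
    intro x hx y hy
    obtain ⟨x, rfl⟩ := cv_surj x
    obtain ⟨y, rfl⟩ := cv_surj y
    rw [hBc, ZMod.intCast_zmod_eq_zero_iff_dvd]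
    obtain ⟨x', k, z, rfl, hx1⟩ := key x hx
    obtain ⟨y', k', z', rfl, hy1⟩ := key y hy
    obtain ⟨r, hr⟩ := hcon x' y' hx1 hy1
    have hey' : F.Q.b e y' = 0 := by rw [F.Q.sym]; exact hy1.2.1
    refine ⟨r + F.Q.b (x' + k • e + (p : ℤ) • z) z' + F.Q.b z (y' + k' • e), ?_⟩
    simp only [map_add, map_smul, LinearMap.add_apply, LinearMap.smul_apply, smul_eq_mul, hr, hx1.2.1, hey', hee]
    ring
  rw [finrank_top] at hP4
  rw [Module.finrank_fin_fun] at hP4 hiso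
  have := i.2
  omega

end Fam
end NK

namespace NK
open Matrix

variable {m n : ℕ} {G : Matrix (Fin n) (Fin n) ℤ}

/-- the rational quadratic space -/
noncomputable def QQ (G : Matrix (Fin n) (Fin n) ℤ) (hs : G.IsSymm) : QM ℚ (Fin n → ℚ) where
  b := mform (G.map (Int.cast : ℤ → ℚ))
  q := fun x => mform (G.map (Int.cast : ℤ → ℚ)) x x / 2
  sym := mform_sym (by rw [IsSymm, ← transpose_map, hs.eq])
  hq := fun x => by ring

/-- the integral points -/
noncomputable def ZL (n : ℕ) : AddSubgroup (Fin n → ℚ) :=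
  AddMonoidHom.range (⟨⟨fun x : Fin n → ℤ => cv ℚ x, cv_zero ℚ⟩, cv_add ℚ⟩ : (Fin n → ℤ) →+ (Fin n → ℚ))

lemma mem_ZL {x : Fin n → ℚ} : x ∈ ZL n ↔ ∃ z : Fin n → ℤ, cv ℚ z = x := Iff.rfl

lemma QQ_b {hs : G.IsSymm} (x y : Fin n → ℤ) : (QQ G hs).b (cv ℚ x) (cv ℚ y) = ((x ⬝ᵥ G *ᵥ y : ℤ) : ℚ) := by
  change mform _ _ _ = _
  rw [mform_apply, cv_dot]

lemma Fam.QQ_b (F : Fam m G) (x y : Fin n → ℤ) : (QQ G F.hs).b (cv ℚ x) (cv ℚ y) = (F.Q.b x y : ℤ) := by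
  rw [NK.QQ_b, F.Qb]

lemma Fam.QQ_q (F : Fam m G) (x : Fin n → ℤ) : (QQ G F.hs).q (cv ℚ x) = (F.Q.q x : ℤ) := by
  have h1 := (QQ G F.hs).hq (cv ℚ x)
  rw [F.QQ_b, F.Q.hq] at h1
  push_cast at h1
  linarith

lemma ZL_lat (hs : G.IsSymm) (he : ∀ i, 2 ∣ G i i) (hu : IsUnit G.det) : Lat (QQ G hs) (ZL n) where
  even := by
    rintro _ ⟨z, rfl⟩
    change mform _ (cv ℚ z) (cv ℚ z) / 2 ∈ _
    rw [mform_apply, cv_dot]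
    obtain ⟨k, hk⟩ := even_diag hs he z
    rw [hk, mem_Zs]
    exact ⟨k, by push_cast; ring⟩
  dual := by
    intro x hx
    have h1 : ∀ i, ∃ k : ℤ, ((G.map (Int.cast : ℤ → ℚ)) *ᵥ x) i = k := by
      intro i
      obtain ⟨k, hk⟩ := mem_Zs.1 (hx (cv ℚ (Pi.single i 1)) ⟨_, rfl⟩)
      refine ⟨k, ?_⟩
      rw [← hk, (QQ G hs).sym]
      change _ = mform _ _ _
      rw [mform_apply]
      have : cv ℚ (Pi.single i 1 : Fin n → ℤ) = Pi.single i 1 := by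
        ext j; rw [cv_apply, Pi.single_apply, Pi.single_apply]; split_ifs <;> simp
      rw [this]; simp
    choose k hk using h1
    refine ⟨G⁻¹ *ᵥ k, ?_⟩
    change cv ℚ (G⁻¹ *ᵥ k) = x
    have h2 : cv ℚ (G⁻¹ *ᵥ k) = (G⁻¹.map (Int.cast : ℤ → ℚ)) *ᵥ cv ℚ k := by
      ext i; simp [mulVec, dotProduct]
    have h3 : cv ℚ k = (G.map (Int.cast : ℤ → ℚ)) *ᵥ x := by ext i; rw [hk]; rfl
    have h4 : (G⁻¹.map (Int.cast : ℤ → ℚ)) * (G.map (Int.cast : ℤ → ℚ)) = 1 := by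
      have := congrArg (fun A : Matrix (Fin n) (Fin n) ℤ => A.map (Int.castRingHom ℚ)) (nonsing_inv_mul G hu)
      simp only [Matrix.map_mul] at this
      rw [Matrix.map_one _ (map_zero _) (map_one _)] at this
      exact this
    rw [h2, h3, mulVec_mulVec, h4, one_mulVec]

lemma cv_span (x : Fin n → ℤ) : cv ℚ x = ∑ k, (x k : ℚ) • cv ℚ (Pi.single k 1 : Fin n → ℤ) := by
  ext j
  simp [Finset.sum_apply, Pi.single_apply]

/-- extraction of the integral matrix -/
lemma extract (hs : G.IsSymm) (hu : IsUnit G.det) (k : (Fin n → ℚ) ≃ₗ[ℚ] (Fin n → ℚ)) (hk : ∀ x, (QQ G hs).q (k x) = (QQ G hs).q x)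
    (hkL : ∀ x ∈ ZL n, k x ∈ ZL n) : ∃ S : Matrix (Fin n) (Fin n) ℤ, IsLatticeAut G S ∧ ∀ z : Fin n → ℤ, cv ℚ (S *ᵥ z) = k (cv ℚ z) := by
  choose c hc using fun j : Fin n => hkL (cv ℚ (Pi.single j 1)) ⟨_, rfl⟩
  have hc' : ∀ j, cv ℚ (c j) = k (cv ℚ (Pi.single j 1)) := hc
  obtain ⟨S, hS⟩ : ∃ S : Matrix (Fin n) (Fin n) ℤ, S = Matrix.of fun i j => c j i := ⟨_, rfl⟩
  have hSk : ∀ z : Fin n → ℤ, cv ℚ (S *ᵥ z) = k (cv ℚ z) := by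
    intro z
    rw [cv_span z, map_sum]
    simp only [map_smul, ← hc']
    ext i
    rw [hS, cv_apply]
    simp [mulVec, dotProduct, Finset.sum_apply, mul_comm]
  have hSG : Sᵀ * G * S = G := by
    ext i j
    have h1 := isom_b hk (cv ℚ (Pi.single i 1)) (cv ℚ (Pi.single j 1))
    rw [← hSk, ← hSk, QQ_b, QQ_b] at h1
    have h2 : S *ᵥ Pi.single i 1 ⬝ᵥ G *ᵥ S *ᵥ Pi.single j 1 = (Pi.single i 1 : Fin n → ℤ) ⬝ᵥ G *ᵥ Pi.single j 1 := by exact_mod_cast h1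
    have h3 : S *ᵥ Pi.single i 1 ⬝ᵥ G *ᵥ S *ᵥ Pi.single j 1 = (Pi.single i 1 : Fin n → ℤ) ⬝ᵥ (Sᵀ * G * S) *ᵥ Pi.single j 1 := by
      rw [← mulVec_mulVec, ← mulVec_mulVec, ← vecMul_transpose, ← dotProduct_mulVec]
    rw [h2] at h3
    simpa using h3.symm
  refine ⟨S, ⟨?_, hSG⟩, hSk⟩
  have h1 := congrArg det hSG
  rw [det_mul, det_mul, det_transpose] at h1
  have h2 : S.det * S.det = 1 := by
    apply mul_right_cancel₀ hu.ne_zero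
    linear_combination h1
  exact IsUnit.of_mul_eq_one _ h2

lemma ZL_index (Λ : AddSubgroup (Fin n → ℚ)) (s : ℕ) (hs0 : s ≠ 0) (hs : ∀ x ∈ ZL n, (s : ℚ) • x ∈ Λ) : Λ.relIndex (ZL n) ≠ 0 := by
  haveI : AddGroup.FG (ZL n) := by unfold ZL; infer_instance
  have : Finite (ZL n ⧸ Λ.addSubgroupOf (ZL n)) := by
    apply AddCommGroup.finite_of_fg_isAddTorsion
    intro x
    obtain ⟨x, rfl⟩ := QuotientAddGroup.mk_surjective x
    rw [isOfFinAddOrder_iff_nsmul_eq_zero]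
    refine ⟨s, Nat.pos_of_ne_zero hs0, ?_⟩
    rw [← QuotientAddGroup.mk_nsmul, QuotientAddGroup.eq_zero_iff, AddSubgroup.mem_addSubgroupOf]
    have := hs x x.2
    rw [Nat.cast_smul_eq_nsmul] at this
    exact_mod_cast this
  exact AddSubgroup.index_ne_zero_of_finite

theorem two_fams (h2 : 2 * m + 2 ≤ n) (F F' : Fam m G) (hM : F.M = F'.M)
    (hp : ∃ e ∈ F.T, ∃ f ∈ F.T, F.Q.q e = 0 ∧ F.Q.q f = 0 ∧ F.Q.b e f = 1)
    (hp' : ∃ e ∈ F'.T, ∃ f ∈ F'.T, F'.Q.q e = 0 ∧ F'.Q.q f = 0 ∧ F'.Q.b e f = 1) :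
    ∃ S : Matrix (Fin n) (Fin n) ℤ, IsLatticeAut G S ∧ ∀ i, S *ᵥ F.y i = F'.y i := by
  obtain ⟨e, heT, f, hfT, he, hf, hef⟩ := hp
  obtain ⟨e', heT', f', hfT', he', hf', hef'⟩ := hp'
  obtain ⟨Q, hQ⟩ : ∃ Q, Q = QQ G F.hs := ⟨_, rfl⟩
  have Qb : ∀ x y : Fin n → ℤ, Q.b (cv ℚ x) (cv ℚ y) = (F.Q.b x y : ℤ) := by rw [hQ]; exact F.QQ_b
  have Qq : ∀ x : Fin n → ℤ, Q.q (cv ℚ x) = (F.Q.q x : ℤ) := by rw [hQ]; exact F.QQ_q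
  have Qb' : ∀ x y : Fin n → ℤ, Q.b (cv ℚ x) (cv ℚ y) = (F'.Q.b x y : ℤ) := by rw [hQ]; exact F'.QQ_b
  have Qq' : ∀ x : Fin n → ℤ, Q.q (cv ℚ x) = (F'.Q.q x : ℤ) := by rw [hQ]; exact F'.QQ_q
  have hL : Lat Q (ZL n) := by rw [hQ]; exact ZL_lat F.hs F.he F.hu
  have hcv : ∀ z : Fin n → ℤ, cv ℚ z ∈ ZL n := fun z => ⟨z, rfl⟩
  have hD0 : 2 * F.M.det.natAbs ≠ 0 := by have := F.hMd; simpa using this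
  obtain ⟨S, hSdef⟩ : ∃ S, S = (2 * F.M.det.natAbs).primeFactors := ⟨_, rfl⟩
  have hS : ∀ p ∈ S, p.Prime := fun p hp => by rw [hSdef] at hp; exact Nat.prime_of_mem_primeFactors hp
  have hSne : S.Nonempty := ⟨2, by rw [hSdef, Nat.mem_primeFactors]; exact ⟨Nat.prime_two, dvd_mul_right _ _, hD0⟩⟩
  rw [Fam.mem_T] at heT hfT heT' hfT'
  obtain ⟨g, hg, hgx⟩ := witt (hS := hS) hL (fun i => cv ℚ (F.y i)) (fun i => cv ℚ (F'.y i)) (fun i => cv ℚ (F.ys i)) (fun i => cv ℚ (F'.ys i))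
    (fun _ => hcv _) (fun _ => hcv _) (fun _ => hcv _) (fun _ => hcv _)
    (fun i j => by rw [Qb, Qb', F.QM_y, F'.QM_y, hM])
    (fun i j => by rw [Qb, F.Qdual]; split_ifs <;> simp)
    (fun i j => by rw [Qb', F'.Qdual]; split_ifs <;> simp)
    (e := cv ℚ e') (f := cv ℚ f') (hcv _) (hcv _) (by rw [Qq', he']; simp) (by rw [Qq', hf']; simp) (by rw [Qb', hef']; simp)
    (fun i => by rw [Qb', heT']; simp) (fun i => by rw [Qb', hfT']; simp) hSne
    (fun i p hp => by
      obtain ⟨u1, u2, ⟨h1, h2, h3⟩, ⟨h4, h5, h6⟩, h7⟩ := F'.alpha h2 heT' hfT' he' hf' hef' i (hS p hp)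
      refine ⟨cv ℚ u1, ⟨hcv _, ?_, by rw [Qb', h2]; simp, by rw [Qb', h3]; simp⟩, cv ℚ u2, ⟨hcv _, ?_, by rw [Qb', h5]; simp, by rw [Qb', h6]; simp⟩, ?_⟩
      · rintro _ ⟨j, hj, rfl⟩
        rw [Qb', h1 j hj]; simp
      · rintro _ ⟨j, hj, rfl⟩
        rw [Qb', h4 j hj]; simp
      · rw [Qb', mem_MM, nu_int_lt (hS p hp)]; exact h7)
  -- common denominator
  choose s hs0 hs hsL using fun k : Fin n => hg.mem' (cv ℚ (Pi.single k 1)) (LS_of_mem (hcv _))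
  have hprod0 : ∏ k, s k ≠ 0 := Finset.prod_ne_zero_iff.2 fun k _ => hs0 k
  have hprod : ∀ x ∈ ZL n, ((∏ k, s k : ℕ) : ℚ) • x ∈ img g (ZL n) := by
    rintro _ ⟨z, rfl⟩
    change _ • cv ℚ z ∈ _
    rw [cv_span, Finset.smul_sum]
    refine sum_mem fun k _ => ?_
    rw [← Finset.prod_erase_mul _ _ (Finset.mem_univ k), smul_comm]
    refine zmem (int_mem _) ?_
    push_cast
    rw [mul_smul, ← Nat.cast_prod]
    refine zmem (nat_mem _) ?_
    rw [mem_img, map_smul]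
    exact hsL k
  have hcop : IsCoprime ((∏ k, s k : ℕ) : ℤ) F.M.det := by
    rw [Int.isCoprime_iff_gcd_eq_one, Int.gcd_def, Int.natAbs_natCast]
    refine Nat.Coprime.prod_left fun k _ => ?_
    rw [Nat.coprime_iff_gcd_eq_one]
    by_contra hne
    obtain ⟨p, hp, hpd⟩ := Nat.exists_prime_and_dvd hne
    refine hs k p ?_ (hpd.trans (Nat.gcd_dvd_left _ _))
    rw [hSdef, Nat.mem_primeFactors]
    exact ⟨hp, (hpd.trans (Nat.gcd_dvd_right _ _)).mul_left 2, hD0⟩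
  have hMs : ∀ i j, F.M i j = F.M j i := by
    intro i j; rw [← F.QM_y, ← F.QM_y, F.Q.sym]
  have hmem : ∀ z : Fin n → ℤ, g (cv ℚ z) ∈ img g (ZL n) := fun z => by rw [mem_img, g.symm_apply_apply]; exact hcv _
  obtain ⟨h, hh, hhy, himg⟩ := neighbor (fun i => cv ℚ (F'.y i)) hL (fun _ => hcv _) (D := F.M.det)
    (fun x hx => by
      choose b hb using fun j => mem_Zs.1 (hx j)
      refine ⟨fun i => ∑ j, F.M.adjugate i j * b j, fun k => ?_⟩
      simp only [map_sub, map_smul, map_sum, LinearMap.sub_apply, LinearMap.smul_apply, LinearMap.sum_apply, smul_eq_mul, hb, Qb', F'.QM_y, ← hM]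
      have h1 : ∑ i, (∑ j, F.M.adjugate i j * b j) * F.M i k = F.M.det * b k := by
        have h3 := congrFun (congrArg (fun A => A *ᵥ b) (mul_adjugate F.M)) k
        simp only [← mulVec_mulVec, smul_mulVec, one_mulVec, Pi.smul_apply, smul_eq_mul] at h3
        rw [← h3]
        simp only [mulVec, dotProduct]
        exact Finset.sum_congr rfl fun i _ => by rw [mul_comm, hMs]
      have h4 : ((∑ i, (∑ j, F.M.adjugate i j * b j) * F.M i k : ℤ) : ℚ) = F.M.det * b k := by rw [h1]; push_cast; rfl
      rw [Int.cast_sum] at h4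
      rw [← h4, sub_eq_zero]
      exact Finset.sum_congr rfl fun i _ => by push_cast; rfl)
    _ (img g (ZL n)) rfl (ZL_index _ _ hprod0 hprod) (hL.img hg.q)
    (fun i => by rw [← hgx i]; exact hmem _) ⟨_, hprod0, hcop, hprod⟩
    ⟨g (cv ℚ e), hmem _, g (cv ℚ f), hmem _, by rw [hg.q, Qq, he]; simp, by rw [hg.q, Qq, hf]; simp, by rw [isom_b hg.q, Qb, hef]; simp,
      fun i => by rw [← hgx i, isom_b hg.q, Qb, heT]; simp, fun i => by rw [← hgx i, isom_b hg.q, Qb, hfT]; simp⟩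
  obtain ⟨A, hA, hAz⟩ := extract F.hs F.hu (g.trans h) (by rw [← hQ]; intro x; rw [LinearEquiv.trans_apply, hh, hg.q]) (by
    intro x hx
    rw [← himg, LinearEquiv.trans_apply, mem_img, h.symm_apply_apply, mem_img, g.symm_apply_apply]
    exact hx)
  refine ⟨A, hA, fun i => ?_⟩
  have h1 := hAz (F.y i)
  rw [LinearEquiv.trans_apply, hgx i, hhy i] at h1
  ext j
  have h2 := congrFun h1 j
  rw [cv_apply, cv_apply] at h2
  exact_mod_cast h2

end NK

open Matrix
namespace NK

lemma mk_zObj_neg {n : ℕ} (G : Matrix (Fin n) (Fin n) ℤ) (hs : G.IsSymm) (hd : G.det ≠ 0)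
    (hs' : (-G).IsSymm) (hd' : (-G).det ≠ 0) :
    W.mk (zObj (-G) hs' hd') = -W.mk (zObj G hs hd) := by
  rw [W.mk_neg]
  refine W.mk_eq_of_map (X := zObj (-G) hs' hd') (Y := (zObj G hs hd).op)
    (LinearMap.id : (Fin n → ℚ) →ₗ[ℚ] (Fin n → ℚ)) ?_ ?_
  · intro (x : Fin n → ℚ) (y : Fin n → ℚ)
    change -(mform (G.map (Int.cast : ℤ → ℚ)) x y) = mform ((-G).map (Int.cast : ℤ → ℚ)) x y
    have h : (-G).map (Int.cast : ℤ → ℚ) = -(G.map (Int.cast : ℤ → ℚ)) := by ext i j; simp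
    rw [mform_apply, mform_apply, h, neg_mulVec, dotProduct_neg]
  · rw [Obj.dim_op, zObj_dim, zObj_dim]

lemma det_neg_ne {n : ℕ} (G : Matrix (Fin n) (Fin n) ℤ) (hd : G.det ≠ 0) : (-G).det ≠ 0 := by
  rw [det_neg]
  exact mul_ne_zero (pow_ne_zero _ (by norm_num)) hd

lemma sig_neg {n : ℕ} (G : Matrix (Fin n) (Fin n) ℤ) (hs : G.IsSymm) (hd : G.det ≠ 0) :
    sigPlus (-G) = sigMinus G ∧ sigMinus (-G) = sigPlus G := by
  have hs' : (-G).IsSymm := hs.neg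
  have hd' := det_neg_ne G hd
  have h1 := (sigRep_zObj G hs hd).add (sigRep_zObj (-G) hs' hd')
  rw [mk_zObj_neg G hs hd, add_neg_cancel] at h1
  have h2 := h1.le SigRep.zero
  have h3 := SigRep.zero.le h1
  have h4 := sig_add G hs hd
  have h5 := sig_add (-G) hs' hd'
  omega

lemma get_pair {m n c : ℕ} (M : Matrix (Fin m) (Fin m) ℤ) (G : Matrix (Fin n) (Fin n) ℤ)
    (hMs : M.IsSymm) (hMd : M.det ≠ 0) (hs : G.IsSymm) (he : ∀ i, 2 ∣ G i i) (hu : IsUnit G.det)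
    (hc : W.mk (zObj G hs hu.ne_zero) = (8 * c) • cls 1)
    (hn : n = 2 * sigMinus G + 8 * c) (h1 : sigMinus M < sigMinus G) (h2 : 2 * m + 2 ≤ n)
    (T : Matrix (Fin n) (Fin m) ℤ) (hT : IsPrimitiveLatticeEmbedding M G T) :
    ∃ F : Fam m G, F.M = M ∧ (∀ i, F.y i = T *ᵥ Pi.single i 1) ∧
      ∃ e ∈ F.T, ∃ f ∈ F.T, F.Q.q e = 0 ∧ F.Q.q f = 0 ∧ F.Q.b e f = 1 := by
  obtain ⟨F, hF, hy⟩ := exists_fam G hs he hu M hMd T hT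
  refine ⟨F, hF, hy, F.pair h2 (fun p _ => hyp_mod G hs he hu hc p) ?_⟩
  obtain ⟨e, he0, hee, hp⟩ := iso_perp G hs hu.ne_zero hc M hMs hMd T hT.1.2 hn h1 h2
  refine ⟨e, ?_, he0, ?_⟩
  · rw [Fam.mem_T]
    intro i
    rw [Fam.Qb, hy, hp]
  · have := F.Q.hq e
    rw [Fam.Qb, hee] at this
    omega

lemma half_case {m n : ℕ} (M : Matrix (Fin m) (Fin m) ℤ) (G : Matrix (Fin n) (Fin n) ℤ)
    (hMs : M.IsSymm) (hMd : M.det ≠ 0) (hs : G.IsSymm) (he : ∀ i, 2 ∣ G i i) (hu : IsUnit G.det)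
    (h1 : sigMinus M < sigMinus G) (h2 : 2 * m + 2 ≤ n) (h : sigMinus G ≤ sigPlus G)
    (T T' : Matrix (Fin n) (Fin m) ℤ) (hT : IsPrimitiveLatticeEmbedding M G T)
    (hT' : IsPrimitiveLatticeEmbedding M G T') :
    ∃ S : Matrix (Fin n) (Fin n) ℤ, IsLatticeAut G S ∧ S * T = T' := by
  obtain ⟨k, hk⟩ := Nat.exists_eq_add_of_le h
  have hc := uni_class G hs hu
  rw [show (sigPlus G : ℤ) - sigMinus G = (k : ℤ) by omega, natCast_zsmul] at hc
  obtain ⟨c, rfl⟩ := sig_mod_eight G hs hu he hc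
  have hn : n = 2 * sigMinus G + 8 * c := by
    have := sig_add G hs hu.ne_zero
    omega
  obtain ⟨F, hF, hy, hp⟩ := get_pair M G hMs hMd hs he hu hc hn h1 h2 T hT
  obtain ⟨F', hF', hy', hp'⟩ := get_pair M G hMs hMd hs he hu hc hn h1 h2 T' hT'
  obtain ⟨S, hS, hSy⟩ := two_fams h2 F F' (hF.trans hF'.symm) hp hp'
  refine ⟨S, hS, ?_⟩
  apply Matrix.ext_of_mulVec_single
  intro i
  rw [← mulVec_mulVec, ← hy, ← hy', hSy]

lemma neg_prim {m n : ℕ} {M : Matrix (Fin m) (Fin m) ℤ} {G : Matrix (Fin n) (Fin n) ℤ}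
    {T : Matrix (Fin n) (Fin m) ℤ} (hT : IsPrimitiveLatticeEmbedding M G T) :
    IsPrimitiveLatticeEmbedding (-M) (-G) T := by
  refine ⟨⟨hT.1.1, fun x y => ?_⟩, hT.2⟩
  rw [neg_mulVec, neg_mulVec, dotProduct_neg, dotProduct_neg, hT.1.2]

theorem final {m n : ℕ} (M : Matrix (Fin m) (Fin m) ℤ) (G : Matrix (Fin n) (Fin n) ℤ)
    (hMs : M.IsSymm) (hMd : M.det ≠ 0) (hs : G.IsSymm) (he : ∀ i, 2 ∣ G i i) (hu : IsUnit G.det)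
    (h0 : sigPlus M < sigPlus G) (h1 : sigMinus M < sigMinus G)
    (h2 : 2 * sigPlus M + 2 * sigMinus M + 2 ≤ sigPlus G + sigMinus G)
    (T T' : Matrix (Fin n) (Fin m) ℤ) (hT : IsPrimitiveLatticeEmbedding M G T)
    (hT' : IsPrimitiveLatticeEmbedding M G T') :
    ∃ S : Matrix (Fin n) (Fin n) ℤ, IsLatticeAut G S ∧ S * T = T' := by
  have hm := sig_add M hMs hMd
  have hn := sig_add G hs hu.ne_zero
  have h3 : 2 * m + 2 ≤ n := by omega
  rcases le_total (sigMinus G) (sigPlus G) with h | h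
  · exact half_case M G hMs hMd hs he hu h1 h3 h T T' hT hT'
  · obtain ⟨a1, a2⟩ := sig_neg M hMs hMd
    obtain ⟨b1, b2⟩ := sig_neg G hs hu.ne_zero
    obtain ⟨S, hS, hST⟩ := half_case (-M) (-G) hMs.neg (det_neg_ne M hMd) hs.neg
      (fun i => by rw [neg_apply]; exact (he i).neg_right)
      (by rw [det_neg]; exact ((isUnit_one.neg).pow _).mul hu) (by omega) h3 (by omega) T T'
      (neg_prim hT) (neg_prim hT')
    refine ⟨S, ⟨hS.1, ?_⟩, hST⟩
    have := hS.2
    rw [Matrix.mul_neg, Matrix.neg_mul] at this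
    exact neg_injective this

end NK

/-- Uniqueness part of Nikulin's embedding theorem (simplified form): under the
signature conditions, any two primitive embeddings of `M` into `L` differ by an
automorphism of `L`. -/
theorem nikulin_simplified_uniqueness {m n : ℕ} (tp tm lp lm : ℕ)
    (M : Matrix (Fin m) (Fin m) ℤ) (G : Matrix (Fin n) (Fin n) ℤ)
    (hMsymm : M.IsSymm) (hMeven : ∀ i, 2 ∣ M i i) (hMnd : M.det ≠ 0)
    (hMsp : sigPlus M = tp) (hMsm : sigMinus M = tm)
    (hGsymm : G.IsSymm) (hGeven : ∀ i, 2 ∣ G i i) (hGuni : IsUnit G.det)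
    (hGsp : sigPlus G = lp) (hGsm : sigMinus G = lm)
    (h1 : tp < lp) (h2 : tm < lm)
    (h3 : 2 * tp + 2 * tm + 2 ≤ lp + lm)
    (T T' : Matrix (Fin n) (Fin m) ℤ)
    (hT : IsPrimitiveLatticeEmbedding M G T)
    (hT' : IsPrimitiveLatticeEmbedding M G T') :
    ∃ S : Matrix (Fin n) (Fin n) ℤ, IsLatticeAut G S ∧ S * T = T' := by
  subst hMsp hMsm hGsp hGsm
  exact NK.final M G hMsymm hMnd hGsymm hGeven hGuni h1 h2 h3 T T' hT hT'
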